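/- Let n ≥ 1, s > 1/4, θ > 1/2, 0 < a < min(4s − 1, 1 + s, 2s), and let p, q satisfy aq > 2, max((a−s)/2, 1/2 + a − 2s) < 1/q < min(a,1)/2, and 1 − 2/q + a − 2s ≤ 1/p < 1/2 − 1/q. Then there exist ε₀ > 0 and C such that: if A_0, f, φ are Schwartz M_n(ℂ)-valued functions on ℝ^{1+2} satisfying △A_0 = −∂_1[A_0,∂_2 f] + ∂_2[A_0,∂_1 f] + ∂_1[∂_1 f,φ] + ∂_2[∂_2 f,φ] pointwise and ‖∇f‖_{H^{s,θ}} ≤ ε₀, then ‖A_0‖_{L^p_t W^{a,q}_x} ≤ C·‖φ‖_{H^{s,θ}}·‖∇f‖_{H^{s,θ}}. -/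

import Mathlib

noncomputable section

open MeasureTheory Real
open scoped ENNReal RealInnerProductSpace

/-- The spatial domain `ℝ²`. -/
abbrev V2 : Type := EuclideanSpace ℝ (Fin 2)

/-- Space-time Fourier transform on `ℝ^{1+2}`, convention `e^{-i(tτ + x·ξ)}`. -/
def ftST (u : ℝ × V2 → ℂ) (τ : ℝ) (ξ : V2) : ℂ :=
  ∫ p : ℝ × V2, Complex.exp (-Complex.I * ((p.1 * τ + ⟪p.2, ξ⟫ : ℝ) : ℂ)) * u p

/-- The weight `(1+|ξ|²)^{s/2} (1+||τ|-|ξ||)^θ`. -/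
def wgt (s θ τ : ℝ) (ξ : V2) : ℝ :=
  (1 + ‖ξ‖ ^ 2) ^ (s / 2) * (1 + |(|τ| - ‖ξ‖)|) ^ θ

/-- The Wave–Sobolev norm `H^{s,θ}` on `ℝ^{1+2}`. -/
def HN (s θ : ℝ) (u : ℝ × V2 → ℂ) : ℝ≥0∞ :=
  (∫⁻ q : ℝ × V2, (ENNReal.ofReal (wgt s θ q.1 q.2) * (‖ftST u q.1 q.2‖₊ : ℝ≥0∞)) ^ (2 : ℕ)) ^
    ((1 : ℝ) / 2)

/-- Time derivative `∂ₜ u`. -/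
def dtime (u : ℝ × V2 → ℂ) : ℝ × V2 → ℂ :=
  fun p => fderiv ℝ u p ((1 : ℝ), (0 : V2))

/-- The norm of `𝓗^{s,θ}`: `‖u‖_{H^{s,θ}} + ‖∂ₜu‖_{H^{s-1,θ}}`. -/
def HHN (s θ : ℝ) (u : ℝ × V2 → ℂ) : ℝ≥0∞ :=
  HN s θ u + HN (s - 1) θ (dtime u)

/-- Spatial partial derivative `∂ⱼ u`, `j = 0, 1`. -/
def pdx (j : Fin 2) (u : ℝ × V2 → ℂ) : ℝ × V2 → ℂ :=
  fun p => fderiv ℝ u p ((0 : ℝ), EuclideanSpace.single j 1)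

/-- Inverse space-time Fourier transform. -/
def iftST (F : ℝ → V2 → ℂ) (t : ℝ) (x : V2) : ℂ :=
  ((((2 * π) ^ 3)⁻¹ : ℝ) : ℂ) *
    ∫ q : ℝ × V2, Complex.exp (Complex.I * ((t * q.1 + ⟪x, q.2⟫ : ℝ) : ℂ)) * F q.1 q.2

/-- The space-time Fourier multiplier with symbol `m`. -/
def mult (m : ℝ → V2 → ℂ) (u : ℝ × V2 → ℂ) : ℝ × V2 → ℂ :=
  fun p => iftST (fun τ ξ => m τ ξ * ftST u τ ξ) p.1 p.2

/-- Spatial Fourier transform on `ℝ²`, convention `e^{-i x·ξ}`. -/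
def ft2 (g : V2 → ℂ) (ξ : V2) : ℂ :=
  ∫ x : V2, Complex.exp (-Complex.I * ((⟪x, ξ⟫ : ℝ) : ℂ)) * g x

/-- Inverse spatial Fourier transform on `ℝ²`. -/
def ift2 (G : V2 → ℂ) (x : V2) : ℂ :=
  ((((2 * π) ^ 2)⁻¹ : ℝ) : ℂ) *
    ∫ ξ : V2, Complex.exp (Complex.I * ((⟪x, ξ⟫ : ℝ) : ℂ)) * G ξ

/-- The spatial Fourier multiplier `D_x^a` with symbol `|ξ|^a`, acting on functions
on space-time for each fixed time. -/
def DxA (a : ℝ) (u : ℝ × V2 → ℂ) : ℝ × V2 → ℂ :=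
  fun p => ift2 (fun ξ => ((‖ξ‖ ^ a : ℝ) : ℂ) * ft2 (fun y => u (p.1, y)) ξ) p.2

/-- Entrywise coercion of a Schwartz matrix-valued function to a matrix of functions. -/
def cF {n : ℕ} (A : Fin n → Fin n → SchwartzMap (ℝ × V2) ℂ) :
    Fin n → Fin n → (ℝ × V2 → ℂ) :=
  fun i k => ⇑(A i k)

/-- Entrywise commutator `[U,V] = UV - VU` of matrix-valued functions. -/
def mcomm {n : ℕ} (U V : Fin n → Fin n → (ℝ × V2 → ℂ)) (i k : Fin n) :
    ℝ × V2 → ℂ :=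
  fun p => (∑ l, U i l p * V l k p) - ∑ l, V i l p * U l k p

/-- The matrix `∂ⱼ f` of spatial partial derivatives of a Schwartz matrix-valued map. -/
def pdf {n : ℕ} (j : Fin 2) (f : Fin n → Fin n → SchwartzMap (ℝ × V2) ℂ) :
    Fin n → Fin n → (ℝ × V2 → ℂ) :=
  fun i k => pdx j ⇑(f i k)

/-- `H^{s,θ}` norm of a matrix-valued function, applied entrywise and summed. -/
def HNM {n : ℕ} (s θ : ℝ) (U : Fin n → Fin n → (ℝ × V2 → ℂ)) : ℝ≥0∞ :=
  ∑ i, ∑ k, HN s θ (U i k)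

/-- `‖∇f‖_{H^{s,θ}} = (‖∂₁f‖² + ‖∂₂f‖²)^{1/2}`. -/
def gradN {n : ℕ} (s θ : ℝ) (f : Fin n → Fin n → SchwartzMap (ℝ × V2) ℂ) : ℝ≥0∞ :=
  (HNM s θ (pdf 0 f) ^ (2 : ℕ) + HNM s θ (pdf 1 f) ^ (2 : ℕ)) ^ ((1 : ℝ) / 2)

/-- The elliptic equation
`△A₀ = -∂₁[A₀,∂₂f] + ∂₂[A₀,∂₁f] + ∂₁[∂₁f,φ] + ∂₂[∂₂f,φ]`, holding pointwise. -/
def EllipticEq {n : ℕ} (A0 f φ : Fin n → Fin n → SchwartzMap (ℝ × V2) ℂ) : Prop :=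
  ∀ (i k : Fin n) (p : ℝ × V2),
    pdx 0 (pdx 0 ⇑(A0 i k)) p + pdx 1 (pdx 1 ⇑(A0 i k)) p =
      -pdx 0 (mcomm (cF A0) (pdf 1 f) i k) p + pdx 1 (mcomm (cF A0) (pdf 0 f) i k) p +
        pdx 0 (mcomm (pdf 0 f) (cF φ) i k) p + pdx 1 (mcomm (pdf 1 f) (cF φ) i k) p

/-- Pointwise norm of a matrix of functions (entrywise and summed). -/
def mE {n : ℕ} (U : Fin n → Fin n → (ℝ × V2 → ℂ)) (p : ℝ × V2) : ℝ≥0∞ :=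
  ∑ i, ∑ k, (‖U i k p‖₊ : ℝ≥0∞)

/-- Entrywise application of the multiplier `D_x^a` to a matrix of functions. -/
def DxU {n : ℕ} (a : ℝ) (U : Fin n → Fin n → (ℝ × V2 → ℂ)) :
    Fin n → Fin n → (ℝ × V2 → ℂ) :=
  fun i k => DxA a (U i k)

/-- Spatial `L^q` norm of a matrix-valued function at fixed time `t`. -/
def LqAt {n : ℕ} (q : ℝ) (U : Fin n → Fin n → (ℝ × V2 → ℂ)) (t : ℝ) : ℝ≥0∞ :=
  (∫⁻ x : V2, mE U (t, x) ^ q) ^ q⁻¹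

/-- `L^p` norm in time, written in terms of `rp = 1/p ∈ [0,1]`; `rp = 0` is `L^∞`. -/
def LtR (rp : ℝ) (F : ℝ → ℝ≥0∞) : ℝ≥0∞ :=
  if rp = 0 then essSup F volume else (∫⁻ t : ℝ, F t ^ rp⁻¹) ^ rp

/-- `L^p` norm in time, `p` finite. -/
def Ltp (p : ℝ) (F : ℝ → ℝ≥0∞) : ℝ≥0∞ :=
  (∫⁻ t : ℝ, F t ^ p) ^ p⁻¹

notation "eO" => ENNReal.ofReal
notation "hfw" => (1 / (2:ℝ))
notation "tw" => (2:ℝ)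
notation "pz" => by positivity
notation "nz" => by norm_num
notation "fz" => by fun_prop
notation "lz" => by linarith
notation "fall" => Filter.Eventually.of_forall
notation "VC" => (V2 → ℂ)
notation "WC" => (ℝ × V2 → ℂ)
notation "EN" => ENNReal
notation "mrn" => ENNReal.mul_rpow_of_nonneg
notation "oM" => ENNReal.ofReal_mul
notation "rle" => ENNReal.rpow_le_rpow
notation "tle" => ENNReal.tsum_le_tsum
notation "eRm" => ENNReal.rpow_mul
notation "oLe" => ENNReal.ofReal_le_ofReal
notation "rnt" => ENNReal.rpow_ne_top_of_nonneg
notation "mnt" => ENNReal.mul_ne_top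
notation "eR2" => ENNReal.rpow_two
notation "eR1" => ENNReal.rpow_one
notation "eRa" => ENNReal.rpow_add_of_nonneg
notation "mlr" => mul_le_mul_of_nonneg_left
notation "nrn" => Real.norm_of_nonneg
notation "MLR" => mul_le_mul_right
notation "MLL" => mul_le_mul_left

abbrev Lowz (M : V2 → ℂ) : Prop := ∀ ζ, ‖ζ‖ ≤ 1 / 2 → M ζ = 0

abbrev Hiwz (M : V2 → ℂ) : Prop := ∀ ζ, 2 ≤ ‖ζ‖ → M ζ = 0

lemma vdc1 {φ φ1 φ2 : ℝ → ℝ} {a b δ : ℝ} (hab : a ≤ b)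
    (h0 : ∀ x, HasDerivAt φ (φ1 x) x) (h1 : ∀ x, HasDerivAt φ1 (φ2 x) x)
    (hc : Continuous φ2) (h2 : ∀ x ∈ Set.Icc a b, 0 ≤ φ2 x) (hδ : 0 < δ) (ha : δ ≤ φ1 a) :
    ‖∫ x in a..b, Complex.exp (Complex.I * (φ x : ℂ))‖ ≤ 2 / δ := by
  have hmono : ∀ x ∈ Set.Icc a b, φ1 a ≤ φ1 x := by
    have hm : MonotoneOn φ1 (Set.Icc a b) := by
      apply monotoneOn_of_deriv_nonneg (convex_Icc a b)
      · exact fun x _ => (h1 x).continuousAt.continuousWithinAt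
      · exact fun x _ => (h1 x).differentiableAt.differentiableWithinAt
      · intro x hx
        rw [(h1 x).deriv]; exact h2 x (interior_subset hx)
    intro x hx
    exact hm (Set.left_mem_Icc.2 hab) hx hx.1
  have hpos : ∀ x ∈ Set.uIcc a b, 0 < φ1 x := by
    intro x hx
    rw [Set.uIcc_of_le hab] at hx
    linarith [hmono x hx]
  have c0 : Continuous φ := continuous_iff_continuousAt.2 fun x => (h0 x).continuousAt
  have c1 : Continuous φ1 := continuous_iff_continuousAt.2 fun x => (h1 x).continuousAt
  set E : ℝ → ℂ := fun x => Complex.exp (Complex.I * (φ x : ℂ)) with hE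
  have cE : Continuous E := by fun_prop
  have hEn : ∀ x, ‖E x‖ = 1 := fun x => by
    simp only [hE]; rw [mul_comm]; exact Complex.norm_exp_ofReal_mul_I _
  let F : ℝ → ℂ := fun x => -Complex.I * E x * ((φ1 x)⁻¹ : ℝ)
  have hF : ∀ x ∈ Set.uIcc a b, HasDerivAt F
      (E x - (-Complex.I * E x * ((φ2 x / φ1 x ^ 2 : ℝ) : ℂ))) x := by
    intro x hx
    have hp := (hpos x hx).ne'
    have e1 : HasDerivAt E (E x * (Complex.I * (φ1 x : ℂ))) x :=
      (((h0 x).ofReal_comp).const_mul Complex.I).cexp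
    have e2 : HasDerivAt (fun y => (((φ1 y)⁻¹ : ℝ) : ℂ)) ((-(φ2 x) / φ1 x ^ 2 : ℝ) : ℂ) x :=
      ((h1 x).inv hp).ofReal_comp
    have e3 := (e1.const_mul (-Complex.I)).mul e2
    refine e3.congr_deriv ?_
    have hI : Complex.I * Complex.I = -1 := Complex.I_mul_I
    have hp' : (φ1 x : ℂ) ≠ 0 := by exact_mod_cast hp
    push_cast
    field_simp
    linear_combination (-E x * φ1 x ^ 2) * hI
  have hcont : ContinuousOn (fun x => ((φ2 x / φ1 x ^ 2 : ℝ))) (Set.uIcc a b) :=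
    hc.continuousOn.div (c1.continuousOn.pow 2) fun x hx => by have := hpos x hx; positivity
  have hcontC : ContinuousOn (fun x => -Complex.I * E x * ((φ2 x / φ1 x ^ 2 : ℝ) : ℂ))
      (Set.uIcc a b) :=
    (cE.continuousOn.const_smul (-Complex.I)).mul
      (Complex.continuous_ofReal.comp_continuousOn hcont)
  have hint := intervalIntegral.integral_eq_sub_of_hasDerivAt hF
    ((cE.continuousOn.sub hcontC).intervalIntegrable)
  rw [intervalIntegral.integral_sub cE.continuousOn.intervalIntegrable
    hcontC.intervalIntegrable] at hint
  have hG : ∀ x ∈ Set.uIcc a b, HasDerivAt (fun y => -(φ1 y)⁻¹) (φ2 x / φ1 x ^ 2) x := by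
    intro x hx
    refine ((h1 x).inv (hpos x hx).ne').neg.congr_deriv ?_
    ring
  have hint2 := intervalIntegral.integral_eq_sub_of_hasDerivAt hG hcont.intervalIntegrable
  have hb2 : ‖∫ x in a..b, -Complex.I * E x * ((φ2 x / φ1 x ^ 2 : ℝ) : ℂ)‖
      ≤ ∫ x in a..b, φ2 x / φ1 x ^ 2 := by
    refine intervalIntegral.norm_integral_le_of_norm_le hab ?_ hcont.intervalIntegrable
    refine fall fun x hx => ?_
    have hx' : x ∈ Set.Icc a b := Set.Ioc_subset_Icc_self hx
    rw [norm_mul, norm_mul, hEn, norm_neg, Complex.norm_I, one_mul, one_mul, Complex.norm_real,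
      nrn]
    exact div_nonneg (h2 x hx') (sq_nonneg _)
  have hFn : ∀ x ∈ Set.uIcc a b, ‖F x‖ = (φ1 x)⁻¹ := by
    intro x hx
    simp only [F]
    rw [norm_mul, norm_mul, hEn, norm_neg, Complex.norm_I, one_mul, one_mul, Complex.norm_real,
      nrn (inv_nonneg.2 (hpos x hx).le)]
  have key : (∫ x in a..b, E x) = F b - F a +
      ∫ x in a..b, -Complex.I * E x * ((φ2 x / φ1 x ^ 2 : ℝ) : ℂ) := by
    rw [← hint]; ring
  rw [key]
  have n1 := norm_add_le (F b - F a) (∫ x in a..b, -Complex.I * E x * ((φ2 x / φ1 x ^ 2 : ℝ) : ℂ))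
  have n2 := norm_sub_le (F b) (F a)
  rw [hFn b Set.right_mem_uIcc, hFn a Set.left_mem_uIcc] at n2
  have : (φ1 a)⁻¹ ≤ δ⁻¹ := inv_anti₀ hδ ha
  rw [div_eq_mul_inv]
  linarith

lemma exp_phase_trivial (φ : ℝ → ℝ) {a b : ℝ} (hab : a ≤ b) :
    ‖∫ x in a..b, Complex.exp (Complex.I * (φ x : ℂ))‖ ≤ b - a := by
  have := intervalIntegral.norm_integral_le_of_norm_le_const (a := a) (b := b) (C := 1)
    (f := fun x => Complex.exp (Complex.I * (φ x : ℂ))) fun x _ => by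
      rw [mul_comm]; exact (Complex.norm_exp_ofReal_mul_I _).le
  rwa [abs_of_nonneg lz, one_mul] at this

lemma vdc2 {φ φ1 φ2 : ℝ → ℝ} {a b l : ℝ} (hab : a ≤ b)
    (h0 : ∀ x, HasDerivAt φ (φ1 x) x) (h1 : ∀ x, HasDerivAt φ1 (φ2 x) x)
    (hc : Continuous φ2) (hl : 0 < l) (h2 : ∀ x ∈ Set.Icc a b, l ≤ φ2 x) (ha : 0 ≤ φ1 a) :
    ‖∫ x in a..b, Complex.exp (Complex.I * (φ x : ℂ))‖ ≤ 3 / √l := by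
  have hs : 0 < √l := Real.sqrt_pos.2 hl
  have hss : √l * √l = l := Real.mul_self_sqrt hl.le
  have c0 : Continuous φ := continuous_iff_continuousAt.2 fun x => (h0 x).continuousAt
  by_cases hb : b ≤ a + 1 / √l
  · refine (exp_phase_trivial φ hab).trans ?_
    have : (1:ℝ) / √l ≤ 3 / √l := by gcongr; norm_num
    linarith
  push Not at hb
  set h := 1 / √l with hh
  have hp : 0 < h := by positivity
  have cE : Continuous (fun x => Complex.exp (Complex.I * (φ x : ℂ))) := by fun_prop
  rw [← intervalIntegral.integral_add_adjacent_intervals (b := a + h)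
    (cE.intervalIntegrable _ _) (cE.intervalIntegrable _ _)]
  have hgrow : l * (a + h - a) ≤ φ1 (a + h) - φ1 a := by
    apply Convex.mul_sub_le_image_sub_of_le_deriv (convex_Icc a b)
      (fun x _ => (h1 x).continuousAt.continuousWithinAt)
      (fun x _ => (h1 x).differentiableAt.differentiableWithinAt)
      (fun x hx => by rw [(h1 x).deriv]; exact h2 x (interior_subset hx))
    · exact Set.left_mem_Icc.2 hab
    · constructor <;> linarith
    · linarith
  have e1 := exp_phase_trivial φ (a := a) (b := a + h) lz
  have hlh : l * h = √l := by rw [hh]; field_simp; nlinarith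
  have e2 := vdc1 (a := a + h) (b := b) (δ := √l) hb.le h0 h1 hc
    (fun x hx => hl.le.trans (h2 x ⟨by linarith [hx.1], hx.2⟩)) hs (by nlinarith)
  have : (3:ℝ) / √l = h + 2 / √l := by rw [hh]; ring
  refine (norm_add_le _ _).trans ?_
  linarith

lemma vdc2' {φ φ1 φ2 : ℝ → ℝ} {a b l : ℝ} (hab : a ≤ b)
    (h0 : ∀ x, HasDerivAt φ (φ1 x) x) (h1 : ∀ x, HasDerivAt φ1 (φ2 x) x)
    (hc : Continuous φ2) (hl : 0 < l) (h2 : ∀ x ∈ Set.Icc a b, l ≤ φ2 x) (hb : φ1 b ≤ 0) :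
    ‖∫ x in a..b, Complex.exp (Complex.I * (φ x : ℂ))‖ ≤ 3 / √l := by
  have hneg : ∀ x : ℝ, HasDerivAt (fun y : ℝ => -y) (-1) x := fun x => hasDerivAt_neg x
  have := vdc2 (φ := fun x => φ (-x)) (φ1 := fun x => -φ1 (-x)) (φ2 := fun x => φ2 (-x))
    (a := -b) (b := -a) (l := l) lz
    (fun x => ((h0 (-x)).comp x (hneg x)).congr_deriv (by ring))
    (fun x => (((h1 (-x)).comp x (hneg x)).neg).congr_deriv (by ring))
    fz hl (fun x hx => h2 _ ⟨by linarith [hx.2], by linarith [hx.1]⟩)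
    (by simpa using hb)
  rwa [intervalIntegral.integral_comp_neg (fun x => Complex.exp (Complex.I * (φ x : ℂ))),
    neg_neg, neg_neg] at this

lemma vdc3 {φ φ1 φ2 : ℝ → ℝ} {a b l : ℝ} (hab : a ≤ b)
    (h0 : ∀ x, HasDerivAt φ (φ1 x) x) (h1 : ∀ x, HasDerivAt φ1 (φ2 x) x)
    (hc : Continuous φ2) (hl : 0 < l) (h2 : ∀ x ∈ Set.Icc a b, l ≤ φ2 x) :
    ‖∫ x in a..b, Complex.exp (Complex.I * (φ x : ℂ))‖ ≤ 6 / √l := by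
  have hs : 0 < √l := Real.sqrt_pos.2 hl
  have h36 : (3:ℝ) / √l ≤ 6 / √l := by gcongr; norm_num
  by_cases ha : 0 ≤ φ1 a
  · exact (vdc2 hab h0 h1 hc hl h2 ha).trans h36
  by_cases hb : φ1 b ≤ 0
  · exact (vdc2' hab h0 h1 hc hl h2 hb).trans h36
  push Not at ha hb
  have c0 : Continuous φ := continuous_iff_continuousAt.2 fun x => (h0 x).continuousAt
  have c1 : Continuous φ1 := continuous_iff_continuousAt.2 fun x => (h1 x).continuousAt
  obtain ⟨c, hcm, hc0⟩ := intermediate_value_Icc hab c1.continuousOn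
    (show (0:ℝ) ∈ Set.Icc (φ1 a) (φ1 b) from ⟨ha.le, hb.le⟩)
  have cE : Continuous (fun x => Complex.exp (Complex.I * (φ x : ℂ))) := by fun_prop
  rw [← intervalIntegral.integral_add_adjacent_intervals (b := c)
    (cE.intervalIntegrable _ _) (cE.intervalIntegrable _ _)]
  have e1 := vdc2' hcm.1 h0 h1 hc hl (fun x hx => h2 x ⟨hx.1, hx.2.trans hcm.2⟩) hc0.le
  have e2 := vdc2 hcm.2 h0 h1 hc hl (fun x hx => h2 x ⟨hcm.1.trans hx.1, hx.2⟩) hc0.ge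
  refine (norm_add_le _ _).trans ?_
  have : (6:ℝ) / √l = 3 / √l + 3 / √l := by ring
  linarith

lemma vdc_wave {r t x z a b N c : ℝ} (hab : a ≤ b) (hr : c * N ≤ |r|) (hc : 0 < c) (hN : 0 < N)
    (ht : t ≠ 0) (hb : ∀ y ∈ Set.Icc a b, √(r ^ 2 + y ^ 2) ≤ 4 * N) :
    ‖∫ y in a..b, Complex.exp (Complex.I * ((t * √(r ^ 2 + y ^ 2) + x * y + z : ℝ) : ℂ))‖
      ≤ 6 / √(|t| * (c ^ 2 / (64 * N))) := by
  have hr0 : 0 < |r| := lt_of_lt_of_le pz hr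
  have hr2 : 0 < r ^ 2 := by rw [← sq_abs]; positivity
  have hpos : ∀ y : ℝ, 0 < r ^ 2 + y ^ 2 := fun y => by positivity
  -- general positive t
  have main : ∀ t x z : ℝ, 0 < t →
      ‖∫ y in a..b, Complex.exp (Complex.I * ((t * √(r ^ 2 + y ^ 2) + x * y + z : ℝ) : ℂ))‖
      ≤ 6 / √(t * (c ^ 2 / (64 * N))) := by
    intro t x z ht
    have hsq : ∀ y : ℝ, HasDerivAt (fun y => √(r ^ 2 + y ^ 2)) (y / √(r ^ 2 + y ^ 2)) y := by
      intro y
      have h1 : HasDerivAt (fun y : ℝ => r ^ 2 + y ^ 2) (2 * y) y := by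
        simpa using ((hasDerivAt_id y).pow 2).const_add (r ^ 2)
      refine (h1.sqrt (hpos y).ne').congr_deriv ?_
      have := (Real.sqrt_pos.2 (hpos y)).ne'
      field_simp
    refine vdc3 (φ := fun y => t * √(r ^ 2 + y ^ 2) + x * y + z)
      (φ1 := fun y => t * (y / √(r ^ 2 + y ^ 2)) + x)
      (φ2 := fun y => t * (r ^ 2 / √(r ^ 2 + y ^ 2) ^ 3)) hab ?_ ?_ ?_ pz ?_
    · intro y
      refine ((((hsq y).const_mul t).add ((hasDerivAt_id y).const_mul x)).add_const z).congr_deriv ?_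
      simp
    · intro y
      have hs := (Real.sqrt_pos.2 (hpos y)).ne'
      refine ((((hasDerivAt_id y).div (hsq y) hs).const_mul t).add_const x).congr_deriv ?_
      have h3 : √(r ^ 2 + y ^ 2) ^ 2 = r ^ 2 + y ^ 2 := Real.sq_sqrt (hpos y).le
      simp only [id]
      field_simp
      linear_combination h3
    · refine continuous_const.mul (continuous_const.div fz fun y => ?_)
      have := Real.sqrt_pos.2 (hpos y)
      positivity
    · intro y hy
      have hs := Real.sqrt_pos.2 (hpos y)
      have h4 := hb y hy
      refine mlr ?_ ht.le
      calc c ^ 2 / (64 * N) = (c * N) ^ 2 / (4 * N) ^ 3 := by field_simp; norm_num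
        _ ≤ r ^ 2 / √(r ^ 2 + y ^ 2) ^ 3 := by
          have h5 : (c * N) ^ 2 ≤ r ^ 2 := by rw [← sq_abs r]; gcongr
          gcongr
  rcases lt_or_gt_of_ne ht with h | h
  · have := main (-t) (-x) (-z) lz
    rw [abs_of_neg h]
    refine le_trans (le_of_eq ?_) this
    rw [← RCLike.norm_conj, intervalIntegral.integral_of_le hab, ← integral_conj,
      ← intervalIntegral.integral_of_le hab]
    congr 1
    apply intervalIntegral.integral_congr
    intro y _
    simp only [← Complex.exp_conj, map_mul, Complex.conj_I, Complex.conj_ofReal]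
    congr 1; push_cast; ring
  · rw [abs_of_pos h]; exact main t x z h

lemma lint_scale (c : ℝ) (hc : 0 < c) (f : V2 → EN) :
    ∫⁻ x : V2, f (c • x) = eO ((c ^ 2)⁻¹) * ∫⁻ x : V2, f x := by
  have h := (Homeomorph.smulOfNeZero c hc.ne' (α := V2)).measurableEmbedding.lintegral_map
    (μ := (volume : Measure V2)) f
  have h2 : Measure.map (⇑(Homeomorph.smulOfNeZero c hc.ne' (α := V2))) volume =
      eO ((c ^ 2)⁻¹) • (volume : Measure V2) := by
    have := Measure.map_addHaar_smul (volume : Measure V2) hc.ne'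
    simp only [finrank_euclideanSpace, Fintype.card_fin] at this
    rw [abs_of_pos pz] at this
    exact this
  rw [h2, lintegral_smul_measure] at h
  exact h.symm

def c0R : EN := ∫⁻ y : V2, (Metric.ball (0 : V2) 1).indicator (fun y => ‖y‖ₑ⁻¹) y

lemma c0R_ne_top : c0R ≠ ⊤ := by
  have h : IntegrableOn (fun y : V2 => ‖y‖⁻¹) (Metric.ball 0 1) := by
    rw [integrableOn_fun_norm_addHaar (volume : Measure V2) (f := fun y => y⁻¹)]
    simp only [finrank_euclideanSpace, Fintype.card_fin]
    have : IntegrableOn (fun _ : ℝ => (1:ℝ)) (Set.Ioo 0 1) := by simp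
    refine this.congr_fun (fun y hy => ?_) measurableSet_Ioo
    have : y ≠ 0 := hy.1.ne'
    simp [this]
  unfold c0R
  rw [lintegral_indicator measurableSet_ball]
  have h2 := h.hasFiniteIntegral
  unfold HasFiniteIntegral at h2
  have h3 : (∫⁻ y in Metric.ball (0:V2) 1, ‖y‖ₑ⁻¹) = ∫⁻ y in Metric.ball (0:V2) 1, ‖‖y‖⁻¹‖ₑ := by
    apply lintegral_congr_ae
    have h4 : ∀ᵐ y : V2 ∂(volume.restrict (Metric.ball (0:V2) 1)), y ≠ 0 := by
      apply ae_restrict_of_ae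
      simp [ae_iff]
    filter_upwards [h4] with y hy
    rw [enorm_inv (by simpa using hy), enorm_norm]
  rw [h3]; exact h2.ne

lemma near_scale (R : ℝ) (hR : 0 < R) :
    ∫⁻ y : V2, (Metric.ball (0 : V2) R).indicator (fun y => ‖y‖ₑ⁻¹) y =
      eO R * c0R := by
  have h := lint_scale R hR (fun y => (Metric.ball (0 : V2) R).indicator (fun y => ‖y‖ₑ⁻¹) y)
  have h2 : ∀ x : V2, (Metric.ball (0 : V2) R).indicator (fun y => ‖y‖ₑ⁻¹) (R • x) =
      eO R⁻¹ * (Metric.ball (0 : V2) 1).indicator (fun y => ‖y‖ₑ⁻¹) x := by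
    intro x
    have e : R • x ∈ Metric.ball (0:V2) R ↔ x ∈ Metric.ball (0:V2) 1 := by
      simp [norm_smul, abs_of_pos hR]
      constructor
      · intro h; nlinarith
      · intro h; nlinarith
    by_cases hx : x ∈ Metric.ball (0:V2) 1
    · rw [Set.indicator_of_mem (e.2 hx), Set.indicator_of_mem hx, enorm_smul,
        ENNReal.mul_inv (by simp [hR.ne']) (by simp), ENNReal.ofReal_inv_of_pos hR]
      rw [Real.enorm_eq_ofReal hR.le]
    · rw [Set.indicator_of_notMem (fun h => hx (e.1 h)), Set.indicator_of_notMem hx, mul_zero]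
  simp only [h2] at h
  rw [lintegral_const_mul'' _ (by fun_prop (disch := exact measurableSet_ball))] at h
  have h3 : eO (R ^ 2) * (eO (R ^ 2)⁻¹ *
    ∫⁻ y : V2, (Metric.ball (0 : V2) R).indicator (fun y => ‖y‖ₑ⁻¹) y) =
     ∫⁻ y : V2, (Metric.ball (0 : V2) R).indicator (fun y => ‖y‖ₑ⁻¹) y := by
    rw [← mul_assoc, ← oM pz, mul_inv_cancel₀ pz]; simp
  rw [← h3, ← h, ← mul_assoc, ← oM pz]
  congr 2; field_simp

def c1R (m : ℝ) : EN :=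
  ∫⁻ y : V2, (Metric.ball (0 : V2) 1)ᶜ.indicator (fun y => ‖y‖ₑ⁻¹ ^ m) y

lemma c1R_ne_top (m : ℝ) (hm : 2 < m) : c1R m ≠ ⊤ := by
  have h := finite_integral_one_add_norm (E := V2) (μ := volume) (r := m) (by simpa using hm)
  have h2 : c1R m ≤ ∫⁻ x : V2, eO (2 ^ m) * eO ((1 + ‖x‖) ^ (-m)) := by
    apply lintegral_mono
    intro x
    by_cases hx : x ∈ (Metric.ball (0:V2) 1)ᶜ
    · rw [Set.indicator_of_mem hx]
      show _ ≤ eO (2 ^ m) * eO ((1 + ‖x‖) ^ (-m))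
      rw [← oM pz]
      have h1 : 1 ≤ ‖x‖ := by simpa using hx
      have h0 : 0 < ‖x‖ := by linarith
      have e : ‖x‖ₑ⁻¹ ^ m = eO (‖x‖⁻¹ ^ m) := by
        rw [← ENNReal.ofReal_rpow_of_pos pz, ENNReal.ofReal_inv_of_pos h0, ofReal_norm]
      simp only [e]
      apply oLe
      rw [Real.rpow_neg pz, ← Real.inv_rpow pz,
        ← Real.mul_rpow pz pz]
      apply Real.rpow_le_rpow pz _ lz
      rw [← div_eq_mul_inv, inv_eq_one_div, div_le_div_iff₀ h0 pz]
      linarith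
    · rw [Set.indicator_of_notMem hx]; positivity
  refine (h2.trans_lt ?_).ne
  rw [lintegral_const_mul' _ _ (by simp)]
  exact ENNReal.mul_lt_top (by simp) h

lemma far_scale (m : ℝ) (R : ℝ) (hm : 0 ≤ m) (hR : 0 < R) :
    ∫⁻ y : V2, (Metric.ball (0 : V2) R)ᶜ.indicator (fun y => ‖y‖ₑ⁻¹ ^ m) y =
      eO (R ^ (2 - m)) * c1R m := by
  have h := lint_scale R hR (fun y => (Metric.ball (0 : V2) R)ᶜ.indicator (fun y => ‖y‖ₑ⁻¹ ^ m) y)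
  have h2 : ∀ x : V2, (Metric.ball (0 : V2) R)ᶜ.indicator (fun y => ‖y‖ₑ⁻¹ ^ m) (R • x) =
      eO (R ^ (-m)) * (Metric.ball (0 : V2) 1)ᶜ.indicator (fun y => ‖y‖ₑ⁻¹ ^ m) x := by
    intro x
    have e : R • x ∈ (Metric.ball (0:V2) R)ᶜ ↔ x ∈ (Metric.ball (0:V2) 1)ᶜ := by
      simp [norm_smul, abs_of_pos hR]
      constructor
      · intro h; nlinarith
      · intro h; nlinarith
    by_cases hx : x ∈ (Metric.ball (0:V2) 1)ᶜ
    · rw [Set.indicator_of_mem (e.2 hx), Set.indicator_of_mem hx, enorm_smul,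
        ENNReal.mul_inv (by simp [hR.ne']) (by simp), mrn _ _ hm,
        Real.rpow_neg hR.le, ← Real.inv_rpow hR.le, ← ENNReal.ofReal_rpow_of_pos pz,
        ENNReal.ofReal_inv_of_pos hR, Real.enorm_eq_ofReal hR.le]
    · rw [Set.indicator_of_notMem (fun h => hx (e.1 h)), Set.indicator_of_notMem hx, mul_zero]
  simp only [h2] at h
  rw [lintegral_const_mul'' _
    (by fun_prop (disch := exact measurableSet_ball.compl))] at h
  have h3 : eO (R ^ 2) * (eO (R ^ 2)⁻¹ *
    ∫⁻ y : V2, (Metric.ball (0 : V2) R)ᶜ.indicator (fun y => ‖y‖ₑ⁻¹ ^ m) y) =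
     ∫⁻ y : V2, (Metric.ball (0 : V2) R)ᶜ.indicator (fun y => ‖y‖ₑ⁻¹ ^ m) y := by
    rw [← mul_assoc, ← oM pz, mul_inv_cancel₀ pz]; simp
  rw [← h3, ← h, ← mul_assoc, ← oM pz]
  congr 2
  rw [← Real.rpow_natCast R 2, ← Real.rpow_add hR]; congr 1

def RT (F : V2 → EN) (x : V2) : EN := ∫⁻ y : V2, ‖y‖ₑ⁻¹ * F (x - y)

lemma RT_meas {F : V2 → EN} (hF : Measurable F) : Measurable (RT F) := by
  unfold RT
  apply Measurable.lintegral_prod_right' (f := fun p : V2 × V2 => ‖p.2‖ₑ⁻¹ * F (p.1 - p.2))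
  fun_prop

lemma RT_weak (q : ℝ) (hq : 2 < q) : ∃ c : ℝ, 0 < c ∧ ∀ F : V2 → EN, Measurable F →
    ∫⁻ x, F x ^ (2 * q / (q + 2)) ≤ 1 → ∀ l : ℝ, 0 < l →
    volume {x | eO (3 * l) < RT F x} ≤ eO (c * l ^ (1 + q / 2))⁻¹ *
      ∫⁻ x, {x | eO (c * l ^ (1 + q / 2)) < F x}.indicator F x := by
  set r := 2 * q / (q + 2) with hr
  set r' := 2 * q / (q - 2) with hr'
  have hq2 : 0 < q - 2 := by linarith
  have hr'2 : 2 < r' := by rw [hr', lt_div_iff₀ hq2]; linarith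
  have hconj : r'.HolderConjugate r := by
    rw [Real.holderConjugate_iff]
    refine ⟨by linarith, ?_⟩
    rw [hr, hr']; field_simp; ring
  set K1 := ((c1R r') ^ (1 / r')).toReal + 1 with hK1
  set K0 := c0R.toReal + 1 with hK0
  have K1pos : 0 < K1 := by positivity
  have K0pos : 0 < K0 := by positivity
  have hc0 : c0R ≤ eO K0 := by
    rw [← ENNReal.ofReal_toReal c0R_ne_top]
    exact oLe lz
  have hc1 : (c1R r') ^ (1 / r') ≤ eO K1 := by
    rw [← ENNReal.ofReal_toReal (a := (c1R r') ^ (1 / r'))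
      (rnt pz (c1R_ne_top _ hr'2))]
    exact oLe lz
  refine ⟨1 / (K0 * K1 ^ (q / 2)), by positivity, ?_⟩
  intro F hF hF1 l hl
  set R := (K1 / l) ^ (q / 2) with hR
  have Rpos : 0 < R := by positivity
  set h := 1 / (K0 * K1 ^ (q / 2)) * l ^ (1 + q / 2) with hh
  have hh2 : h = l / (K0 * R) := by
    rw [hh, hR, Real.div_rpow K1pos.le hl.le, Real.rpow_add hl, Real.rpow_one]
    have := Real.rpow_pos_of_pos hl (q / 2)
    have := Real.rpow_pos_of_pos K1pos (q / 2)
    field_simp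
  have hpos : 0 < h := by rw [hh2]; positivity
  set B := Metric.ball (0 : V2) R with hB
  set S := {x | eO h < F x} with hS
  have hSm : MeasurableSet S := measurableSet_lt measurable_const hF
  have hBm : MeasurableSet B := measurableSet_ball
  set k : V2 → EN := fun y => ‖y‖ₑ⁻¹ with hk
  have hkm : Measurable k := by fun_prop
  have kB : Measurable (B.indicator k) := hkm.indicator hBm
  have kBc : Measurable (Bᶜ.indicator k) := hkm.indicator hBm.compl
  have FS : Measurable (S.indicator F) := hF.indicator hSm
  set G := fun x => ∫⁻ y, B.indicator k y * S.indicator F (x - y) with hG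
  have hGm : Measurable G := by
    apply Measurable.lintegral_prod_right'
      (f := fun p : V2 × V2 => B.indicator k p.2 * S.indicator F (p.1 - p.2))
    fun_prop
  have far : ∀ x, ∫⁻ y, Bᶜ.indicator k y * F (x - y) ≤ eO l := by
    intro x
    have := ENNReal.lintegral_mul_le_Lp_mul_Lq volume hconj (f := Bᶜ.indicator k)
      (g := fun y => F (x - y)) kBc.aemeasurable fz
    refine this.trans ?_
    have e1 : ∫⁻ y, Bᶜ.indicator k y ^ r' = eO (R ^ (2 - r')) * c1R r' := by
      rw [← far_scale r' R lz Rpos]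
      apply lintegral_congr
      intro y
      by_cases hy : y ∈ Bᶜ
      · rw [Set.indicator_of_mem hy, Set.indicator_of_mem hy]
      · rw [Set.indicator_of_notMem hy, Set.indicator_of_notMem hy, ENNReal.zero_rpow_of_pos]
        linarith
    have e2 : ∫⁻ y, F (x - y) ^ r ≤ 1 := by
      rw [lintegral_sub_left_eq_self (fun y => F y ^ r) x]; exact hF1
    rw [e1, mrn _ _ pz]
    have e3 : (∫⁻ y, F (x - y) ^ r) ^ (1 / r) ≤ 1 :=
      ENNReal.rpow_le_one e2 (by rw [hr]; positivity)
    have e4 : eO (R ^ (2 - r')) ^ (1 / r') = eO (R ^ (-2 / q)) := by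
      rw [ENNReal.ofReal_rpow_of_pos pz, ← Real.rpow_mul Rpos.le]
      congr 2
      rw [hr']; field_simp; ring
    have e5 : R ^ (-2 / q) * K1 = l := by
      rw [hR, ← Real.rpow_mul pz, show q / 2 * (-2 / q) = -1 by field_simp,
        Real.rpow_neg_one]
      field_simp
    rw [e4]
    calc _ ≤ eO (R ^ (-2 / q)) * eO K1 * 1 := by gcongr
      _ = _ := by rw [← oM pz, e5, mul_one]
  have near : ∀ x, ∫⁻ y, B.indicator k y * Sᶜ.indicator F (x - y) ≤ eO l := by
    intro x
    calc _ ≤ ∫⁻ y, B.indicator k y * eO h := by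
          apply lintegral_mono
          intro y
          dsimp only
          gcongr
          by_cases hy : x - y ∈ Sᶜ
          · rw [Set.indicator_of_mem hy]
            simpa [hS] using hy
          · rw [Set.indicator_of_notMem hy]; positivity
      _ = eO R * c0R * eO h := by
          rw [lintegral_mul_const _ kB, ← near_scale R Rpos]
      _ ≤ eO R * eO K0 * eO h := by gcongr
      _ = eO l := by
          rw [← oM pz, ← oM pz, hh2]
          congr 1; field_simp
  have split : ∀ x, RT F x ≤ eO (2 * l) + G x := by
    intro x
    have : RT F x = (∫⁻ y, Bᶜ.indicator k y * F (x - y)) +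
        ((∫⁻ y, B.indicator k y * Sᶜ.indicator F (x - y)) + G x) := by
      rw [hG, ← lintegral_add_right _ fz, ← lintegral_add_right]
      · unfold RT
        apply lintegral_congr
        intro y
        by_cases hy : y ∈ B <;> by_cases hx : x - y ∈ S <;> simp [hy, hx, hk]
      · have : Measurable (Sᶜ.indicator F) := hF.indicator hSm.compl
        fun_prop
    rw [this, two_mul, ENNReal.ofReal_add hl.le hl.le, add_assoc]
    gcongr
    · exact far x
    · exact near x
  have sub : {x | eO (3 * l) < RT F x} ⊆ {x | eO l ≤ G x} := by
    intro x hx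
    by_contra hc
    simp only [Set.mem_ofPred_eq, not_le] at hx hc
    have := (split x).trans (add_le_add_right hc.le _)
    rw [← ENNReal.ofReal_add pz pz] at this
    rw [show 2 * l + l = 3 * l by ring] at this
    exact absurd hx (not_lt.2 this)
  refine (measure_mono sub).trans ?_
  refine (meas_ge_le_lintegral_div hGm.aemeasurable (by simpa using hl) (by simp)).trans ?_
  have tot : ∫⁻ x, G x = eO R * c0R * ∫⁻ x, S.indicator F x := by
    rw [hG, lintegral_lintegral_swap]
    · rw [← near_scale R Rpos, ← lintegral_mul_const _ kB]
      apply lintegral_congr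
      intro y
      rw [lintegral_const_mul _ fz, lintegral_sub_right_eq_self]
    · exact Measurable.aemeasurable fz
  rw [tot, ENNReal.div_eq_inv_mul, ← mul_assoc]
  gcongr
  calc _ ≤ (eO l)⁻¹ * (eO R * eO K0) := by gcongr
    _ = _ := by
      rw [← ENNReal.ofReal_inv_of_pos hl, ← oM pz,
        ← oM pz, hh2]
      congr 1; field_simp

lemma RT_fin (q : ℝ) (hq : 2 < q) : ∃ C : EN, C ≠ ⊤ ∧ ∀ F : V2 → EN, Measurable F →
    (∀ x, F x ≠ ⊤) → (∀ x, RT F x ≠ ⊤) →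
    ∫⁻ x, F x ^ (2 * q / (q + 2)) ≤ 1 → ∫⁻ x, RT F x ^ q ≤ C := by
  obtain ⟨c, hc, hw⟩ := RT_weak q hq
  set r := 2 * q / (q + 2) with hr
  set e := 1 + q / 2 with he
  have he0 : 0 < e := by positivity
  set K := q * (c⁻¹ * ((c⁻¹ ^ (r - 1)) / (q / 2 - 1))) with hK
  refine ⟨eO (3 ^ q) * eO K, by finiteness, ?_⟩
  intro F hF hFt hT hF1
  have hRm := RT_meas hF
  set f : V2 → ℝ := fun x => (RT F x).toReal / 3 with hf
  have hfm : Measurable f := by fun_prop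
  have hlc := lintegral_rpow_eq_lintegral_meas_lt_mul (volume : Measure V2) (f := f) (p := q)
    (fall fun x => by positivity) hfm.aemeasurable lz
  have e1 : ∫⁻ x, RT F x ^ q = eO (3 ^ q) * ∫⁻ x, eO (f x ^ q) := by
    rw [← lintegral_const_mul _ fz]
    apply lintegral_congr
    intro x
    rw [← oM pz, ← Real.mul_rpow pz pz,
      ← ENNReal.ofReal_rpow_of_nonneg pz lz]
    congr 1
    rw [hf]; simp only
    rw [mul_div_cancel₀ _ nz, ENNReal.ofReal_toReal (hT x)]
  rw [e1, hlc]
  gcongr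
  have e2 : ∀ l ∈ Set.Ioi (0:ℝ), volume {a | l < f a} * eO (l ^ (q - 1)) ≤
      ∫⁻ x, eO (c⁻¹ * l ^ (q / 2 - 2)) *
        {x | eO (c * l ^ e) < F x}.indicator F x := by
    intro l hl
    have hl : 0 < l := hl
    have hsub : {a | l < f a} = {x | eO (3 * l) < RT F x} := by
      ext x
      simp only [hf, Set.mem_ofPred_eq]
      rw [ENNReal.ofReal_lt_iff_lt_toReal pz (hT x), lt_div_iff₀ nz,
        mul_comm]
    rw [hsub, lintegral_const_mul]
    · refine (MLL (hw F hF hF1 l hl) _).trans_eq ?_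
      rw [mul_right_comm, ← oM pz]
      congr 2
      rw [mul_inv, mul_assoc, ← Real.rpow_neg hl.le, ← Real.rpow_add hl]
      congr 2; rw [he]; ring
    · exact hF.indicator (measurableSet_lt measurable_const hF)
  have hmeas : Measurable (fun z : ℝ × V2 => eO (c⁻¹ * z.1 ^ (q / 2 - 2)) *
        {x | eO (c * z.1 ^ e) < F x}.indicator F z.2) := by
    have : (fun z : ℝ × V2 => {x | eO (c * z.1 ^ e) < F x}.indicator F z.2) =
      {z : ℝ × V2 | eO (c * z.1 ^ e) < F z.2}.indicator (fun z => F z.2) := by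
      ext z; simp [Set.indicator]
    apply Measurable.mul fz
    rw [this]
    exact Measurable.indicator fz (measurableSet_lt fz fz)
  calc eO q * ∫⁻ l in Set.Ioi 0, volume {a | l < f a} * eO (l ^ (q - 1))
      ≤ eO q * ∫⁻ l in Set.Ioi 0, ∫⁻ x, eO (c⁻¹ * l ^ (q / 2 - 2)) *
        {x | eO (c * l ^ e) < F x}.indicator F x := by
        exact MLR (setLIntegral_mono' measurableSet_Ioi e2) _
    _ = eO q * ∫⁻ x, ∫⁻ l in Set.Ioi 0, eO (c⁻¹ * l ^ (q / 2 - 2)) *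
        {x | eO (c * l ^ e) < F x}.indicator F x := by
        rw [lintegral_lintegral_swap]
        exact hmeas.aemeasurable
    _ ≤ eO q * ∫⁻ x, eO (c⁻¹ * ((c⁻¹ ^ (r - 1)) / (q / 2 - 1))) * F x ^ r := by
        gcongr with x
        set y := (F x).toReal with hy
        have hFy : F x = eO y := (ENNReal.ofReal_toReal (hFt x)).symm
        set b := (y / c) ^ (1 / e) with hb
        have hy0 : 0 ≤ y := ENNReal.toReal_nonneg
        have hb0 : 0 ≤ b := by positivity
        have i1 : ∀ l ∈ Set.Ioi (0:ℝ), eO (c⁻¹ * l ^ (q / 2 - 2)) *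
          {x | eO (c * l ^ e) < F x}.indicator F x ≤
            (Set.Ioc 0 b).indicator (fun l => eO (c⁻¹ * y * l ^ (q / 2 - 2))) l := by
          intro l hl
          have hl : 0 < l := hl
          by_cases hm : eO (c * l ^ e) < F x
          · have hm2 : x ∈ {x | eO (c * l ^ e) < F x} := hm
            rw [Set.indicator_of_mem hm2, Set.indicator_of_mem, hFy,
              ← oM pz]
            · apply le_of_eq; congr 1; ring
            · refine ⟨hl, ?_⟩
              rw [hFy, ENNReal.ofReal_lt_ofReal_iff_of_nonneg pz] at hm
              have : l ^ e ≤ y / c := by rw [le_div_iff₀ hc]; linarith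
              calc l = (l ^ e) ^ (1 / e) := by
                    rw [← Real.rpow_mul hl.le, mul_one_div_cancel he0.ne', Real.rpow_one]
                _ ≤ _ := Real.rpow_le_rpow pz this pz
          · have hm2 : x ∉ {x | eO (c * l ^ e) < F x} := hm
            rw [Set.indicator_of_notMem hm2, mul_zero]; positivity
        refine (setLIntegral_mono' measurableSet_Ioi i1).trans ?_
        rw [setLIntegral_indicator measurableSet_Ioc,
          Set.inter_eq_left.2 (fun l hl => hl.1)]
        have hint : IntegrableOn (fun l => c⁻¹ * y * l ^ (q / 2 - 2)) (Set.Ioc 0 b) := by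
          have := intervalIntegral.intervalIntegrable_rpow' (a := 0) (b := b)
            (r := q / 2 - 2) lz
          rw [intervalIntegrable_iff_integrableOn_Ioc_of_le hb0] at this
          exact this.const_mul _
        rw [← ofReal_integral_eq_lintegral_ofReal hint
          (by
            rw [Filter.EventuallyLE, ae_restrict_iff' measurableSet_Ioc]
            exact fall fun l hl => by
              have := hl.1
              simp only [Pi.zero_apply]
              positivity)]
        rw [← intervalIntegral.integral_of_le hb0, intervalIntegral.integral_const_mul,
          integral_rpow (Or.inl lz), Real.zero_rpow lz, hFy,
          ENNReal.ofReal_rpow_of_nonneg hy0 pz, ← oM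
            (by have : 0 < q / 2 - 1 := by linarith
                positivity)]
        apply le_of_eq
        congr 1
        have h1 : q / 2 - 2 + 1 = q / 2 - 1 := by ring
        rw [h1, sub_zero, hb, ← Real.rpow_mul pz]
        have h2 : 1 / e * (q / 2 - 1) = r - 1 := by
          rw [he, hr]; field_simp; ring
        rw [h2, div_eq_mul_inv y c, Real.mul_rpow hy0 pz]
        have h3 : y ^ r = y * y ^ (r - 1) := by
          rcases hy0.eq_or_lt with h | h
          · rw [← h, Real.zero_rpow pz]; simp
          · rw [← Real.rpow_one_add' hy0 (by rw [add_sub_cancel]; positivity)]; congr 1; ring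
        rw [h3]; ring
    _ ≤ eO q * (eO (c⁻¹ * ((c⁻¹ ^ (r - 1)) / (q / 2 - 1))) * 1) := by
        rw [lintegral_const_mul _ fz]
        gcongr
    _ = eO K := by
        rw [mul_one, ← oM lz]

lemma hls (q : ℝ) (hq : 2 < q) : ∃ C : EN, C ≠ ⊤ ∧ ∀ F : V2 → EN, Measurable F →
    (∫⁻ x, RT F x ^ q) ^ (1 / q) ≤ C * (∫⁻ x, F x ^ (2 * q / (q + 2))) ^ (1 / (2 * q / (q + 2))) := by
  obtain ⟨C, hC, h⟩ := RT_fin q hq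
  set r := 2 * q / (q + 2) with hr
  have hr0 : 0 < r := by positivity
  -- remove the finiteness
  have h2 : ∀ F : V2 → EN, Measurable F → ∫⁻ x, F x ^ r ≤ 1 → ∫⁻ x, RT F x ^ q ≤ C := by
    intro F hF hF1
    set Fn : ℕ → V2 → EN := fun n x => (Metric.ball (0:V2) n).indicator (fun x => min (F x) n) x
      with hFn
    have Fnm : ∀ n, Measurable (Fn n) := fun n =>
      Measurable.indicator fz measurableSet_ball
    have Fnle : ∀ n x, Fn n x ≤ F x := by
      intro n x
      exact (Set.indicator_le_self' (fun _ _ => zero_le) x).trans (min_le_left _ _)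
    have Fnle2 : ∀ n x, Fn n x ≤ n := by
      intro n x
      exact (Set.indicator_le_self' (fun _ _ => zero_le) x).trans (min_le_right _ _)
    have Fnmono : ∀ x, Monotone (fun n => Fn n x) := by
      intro x m n hmn
      have hmn' : (m:ℝ) ≤ n := by exact_mod_cast hmn
      have hmn2 : (m:EN) ≤ n := by exact_mod_cast hmn
      simp only [hFn]
      by_cases hx : x ∈ Metric.ball (0:V2) m
      · rw [Set.indicator_of_mem hx, Set.indicator_of_mem (Metric.ball_subset_ball hmn' hx)]
        exact min_le_min le_rfl hmn2
      · rw [Set.indicator_of_notMem hx]; exact zero_le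
    have Fnsup : ∀ x, ⨆ n, Fn n x = F x := by
      intro x
      refine le_antisymm (iSup_le fun n => Fnle n x) ?_
      refine le_of_forall_lt fun b hb => ?_
      obtain ⟨n, hn⟩ := ENNReal.exists_nat_gt (ne_top_of_lt hb)
      obtain ⟨m, hm⟩ := exists_nat_gt ‖x‖
      refine lt_of_lt_of_le ?_ (le_iSup _ (max n m))
      simp only [hFn]
      rw [Set.indicator_of_mem]
      · refine lt_min hb (hn.trans_le ?_)
        exact_mod_cast le_max_left _ _
      · simp only [mem_ball_zero_iff]
        exact hm.trans_le (by exact_mod_cast le_max_right _ _)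
    have step : ∀ n, ∫⁻ x, RT (Fn n) x ^ q ≤ C := by
      intro n
      refine h _ (Fnm n) (fun x => ((Fnle2 n x).trans_lt (by simp)).ne) ?_ ?_
      · intro x
        have : RT (Fn n) x ≤ ∫⁻ y, (Metric.ball (0:V2) 1).indicator (fun y => ‖y‖ₑ⁻¹) y * n +
            Fn n (x - y) := by
          apply lintegral_mono
          intro y
          dsimp only
          by_cases hy : y ∈ Metric.ball (0:V2) 1
          · rw [Set.indicator_of_mem hy]
            exact le_add_right (by gcongr; exact Fnle2 _ _)
          · rw [Set.indicator_of_notMem hy, zero_mul, zero_add]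
            have : ‖y‖ₑ⁻¹ ≤ 1 := by
              rw [ENNReal.inv_le_one, ← ofReal_norm, ENNReal.one_le_ofReal]
              simpa using hy
            calc _ ≤ 1 * Fn n (x - y) := by gcongr
              _ = _ := one_mul _
        refine (this.trans_lt ?_).ne
        have := Fnm n
        rw [lintegral_add_right _ fz, lintegral_sub_left_eq_self (Fn n) x,
          lintegral_mul_const' _ _ (by simp)]
        refine ENNReal.add_lt_top.2 ⟨ENNReal.mul_lt_top (lt_top_iff_ne_top.2 c0R_ne_top) (by simp), ?_⟩
        calc ∫⁻ y, Fn n y ≤ ∫⁻ y, (Metric.ball (0:V2) n).indicator (fun _ => (n : EN)) y := by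
              apply lintegral_mono
              intro y
              exact Set.indicator_le_indicator (min_le_right _ _)
          _ < ⊤ := by
              rw [lintegral_indicator measurableSet_ball, setLIntegral_const]
              exact ENNReal.mul_lt_top (by simp) measure_ball_lt_top
      · refine (lintegral_mono fun x => ?_).trans hF1
        exact rle (Fnle n x) hr0.le
    have sup : ∀ x, RT F x ^ q = ⨆ n, RT (Fn n) x ^ q := by
      intro x
      have : RT F x = ⨆ n, RT (Fn n) x := by
        unfold RT
        rw [← lintegral_iSup]
        · apply lintegral_congr
          intro y
          rw [← ENNReal.mul_iSup, Fnsup]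
        · intro n; have := Fnm n; fun_prop
        · intro m n hmn y
          dsimp only
          gcongr
          exact Fnmono _ hmn
      rw [this]
      exact (ENNReal.orderIsoRpow q lz).map_iSup _
    calc ∫⁻ x, RT F x ^ q = ∫⁻ x, ⨆ n, RT (Fn n) x ^ q := lintegral_congr sup
      _ = ⨆ n, ∫⁻ x, RT (Fn n) x ^ q := by
        apply lintegral_iSup
        · intro n; have := RT_meas (Fnm n); fun_prop
        · intro m n hmn x
          apply rle _ lz
          unfold RT
          gcongr
          exact Fnmono _ hmn
      _ ≤ C := iSup_le step
  refine ⟨C ^ (1 / q) + 1, by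
    have : 0 ≤ 1 / q := by positivity
    finiteness, ?_⟩
  intro F hF
  set N := ∫⁻ x, F x ^ r with hN
  by_cases hNt : N = ⊤
  · rw [hNt, ENNReal.top_rpow_of_pos pz, ENNReal.mul_top (by simp)]; exact le_top
  by_cases hN0 : N = 0
  · have : F =ᵐ[volume] 0 := ENNReal.ae_eq_zero_of_lintegral_rpow_eq_zero hr0.le hF.aemeasurable hN0
    have hz : ∀ x, RT F x = 0 := by
      intro x
      unfold RT
      rw [lintegral_eq_zero_iff fz]
      have h3 := (quasiMeasurePreserving_sub_left volume x).ae this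
      filter_upwards [h3] with y hy
      simp at hy ⊢
      exact hy
    simp only [hz]
    rw [ENNReal.zero_rpow_of_pos lz, lintegral_zero, ENNReal.zero_rpow_of_pos pz]
    exact zero_le
  set c := N ^ (1 / r) with hc
  have hc0 : c ≠ 0 := by
    rw [hc]; exact fun h => hN0 ((ENNReal.rpow_eq_zero_iff_of_pos pz).1 h)
  have hct : c ≠ ⊤ := rnt pz hNt
  have key := h2 (fun x => c⁻¹ * F x) fz (by
    simp_rw [mrn _ _ hr0.le]
    rw [lintegral_const_mul _ fz, ENNReal.inv_rpow, hc, ← eRm,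
      one_div_mul_cancel hr0.ne', eR1, ← hN, ENNReal.inv_mul_cancel hN0 hNt])
  have e1 : ∀ x, RT (fun x => c⁻¹ * F x) x = c⁻¹ * RT F x := by
    intro x
    unfold RT
    rw [← lintegral_const_mul _ fz]
    apply lintegral_congr; intro y; ring
  have hRm := RT_meas hF
  simp_rw [e1, mrn _ _ (show 0 ≤ q by linarith)] at key
  rw [lintegral_const_mul _ fz] at key
  have key2 := rle key (show 0 ≤ 1 / q by positivity)
  rw [mrn _ _ pz, ← eRm,
    mul_one_div_cancel lz, eR1, ENNReal.inv_mul_le_iff hc0 hct] at key2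
  refine key2.trans ?_
  rw [mul_comm]; gcongr; exact le_self_add

lemma hls2 (q : ℝ) (hq : 2 < q) : ∃ C : EN, C ≠ ⊤ ∧ ∀ F G : V2 → EN, Measurable F →
    Measurable G → (∫⁻ x, RT (fun y => F y * G y) x ^ q) ^ (1 / q) ≤
      C * ((∫⁻ x, F x ^ q) ^ (1 / q) * (∫⁻ x, G x ^ tw) ^ hfw) := by
  obtain ⟨C, hC, h⟩ := hls q hq
  refine ⟨C, hC, fun F G hF hG => (h _ (hF.mul hG)).trans ?_⟩
  gcongr
  refine ENNReal.lintegral_Lp_mul_le_Lq_mul_Lr pz ?_ ?_ volume hF.aemeasurable hG.aemeasurable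
  · rw [div_lt_iff₀ pz]; nlinarith
  · field_simp; ring

def ph (r : ℝ) : ℂ := Complex.exp (Complex.I * (r : ℂ))

lemma ph_norm (r : ℝ) : ‖ph r‖ = 1 := Complex.norm_exp_I_mul_ofReal r
lemma ph_enorm (r : ℝ) : ‖ph r‖ₑ = 1 := by rw [← ofReal_norm, ph_norm]; simp
lemma ph_add (r s : ℝ) : ph (r + s) = ph r * ph s := by
  unfold ph; rw [← Complex.exp_add]; congr 1; push_cast; ring
lemma ph_zero : ph 0 = 1 := by simp [ph]
lemma ph_conj (r : ℝ) : (starRingEnd ℂ) (ph r) = ph (-r) := by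
  unfold ph; rw [← Complex.exp_conj]; simp
@[fun_prop] lemma ph_cont : Continuous ph := by unfold ph; fun_prop
@[fun_prop] lemma ph_meas : Measurable ph := ph_cont.measurable

def J (G : VC) (x : V2) : ℂ := ∫ ξ : V2, ph ⟪x, ξ⟫ * G ξ

lemma phmul_integrable {Ω : Type*} [MeasurableSpace Ω] {μ : Measure Ω} {w : Ω → ℝ} {g : Ω → ℂ}
    (hw : AEStronglyMeasurable w μ) (hg : Integrable g μ) : Integrable (fun ω => ph (w ω) * g ω) μ :=
  hg.bdd_mul (c := 1) (ph_cont.comp_aestronglyMeasurable hw)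
    (fall fun ω => (ph_norm _).le)

lemma J_enorm_le (G : VC) (x : V2) : ‖J G x‖ₑ ≤ ∫⁻ ξ, ‖G ξ‖ₑ := by
  refine (enorm_integral_le_lintegral_enorm _).trans_eq ?_
  apply lintegral_congr; intro ξ; rw [enorm_mul, ph_enorm, one_mul]

lemma J_cont {G : VC} (hG : Integrable G) : Continuous (J G) := by
  apply continuous_of_dominated (bound := fun ξ => ‖G ξ‖)
  · intro x; exact (phmul_integrable fz hG).aestronglyMeasurable
  · intro x; exact fall fun ξ => by rw [norm_mul, ph_norm, one_mul]
  · exact hG.norm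
  · exact fall fun ξ => by fun_prop

def Ck (κ : VC) (k : ℤ) (H : VC) (x : V2) : ℂ :=
  ∫ z : V2, κ z * H (x - (tw ^ (-k)) • z)

structure IsKer (κ M : VC) : Prop where
  cont : Continuous κ
  dec : ∃ C : ℝ, ∀ z, ‖κ z‖ * (1 + ‖z‖) ^ (4:ℝ) ≤ C
  ft : ∀ ξ, ∫ z : V2, ph (-⟪z, ξ⟫) * κ z = M ξ

variable {κ M : VC}

lemma IsKer.dec' (h : IsKer κ M) :
    ∃ C : ℝ, 0 < C ∧ ∀ z, ‖κ z‖ ≤ C * (1 + ‖z‖) ^ (-(4:ℝ)) := by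
  obtain ⟨C, hC⟩ := h.dec
  refine ⟨max C 1, by positivity, fun z => ?_⟩
  have := hC z
  rw [Real.rpow_neg pz, ← div_eq_mul_inv, le_div_iff₀ pz]
  exact this.trans (le_max_left _ _)

lemma IsKer.integrable (h : IsKer κ M) : Integrable κ := by
  obtain ⟨C, hC, h2⟩ := h.dec'
  have h3 := (integrable_one_add_norm (E := V2) (μ := volume) (r := 4) nz).const_mul C
  exact h3.mono' h.cont.aestronglyMeasurable (fall h2)

lemma Ck_gen {Ω : Type*} [MeasurableSpace Ω] {μ : Measure Ω} [SFinite μ] {w : Ω → V2} {g : Ω → ℂ}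
    (hw : Measurable w) (hg : Integrable g μ) (h : IsKer κ M) (k : ℤ) (x : V2) :
    Ck κ k (fun x => ∫ ω, ph ⟪x, w ω⟫ * g ω ∂μ) x =
      ∫ ω, ph ⟪x, w ω⟫ * (M (tw ^ (-k) • w ω) * g ω) ∂μ := by
  unfold Ck
  have e1 : ∀ z, κ z * (∫ ω, ph ⟪x - tw ^ (-k) • z, w ω⟫ * g ω ∂μ) =
      ∫ ω, ph ⟪x - tw ^ (-k) • z, w ω⟫ * (κ z * g ω) ∂μ := by
    intro z
    rw [← integral_const_mul]; congr 1; ext ω; ring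
  simp_rw [e1]
  rw [integral_integral_swap]
  · congr 1; ext ω
    rw [← h.ft, ← integral_mul_const, ← integral_const_mul]
    congr 1; ext z
    rw [inner_sub_left, sub_eq_add_neg, ph_add, real_inner_smul_left, real_inner_smul_right]
    ring
  · exact phmul_integrable (μ := volume.prod μ)
      (w := fun z : V2 × Ω => ⟪x - tw ^ (-k) • z.1, w z.2⟫)
      (g := fun z : V2 × Ω => κ z.1 * g z.2)
      (by apply Measurable.aestronglyMeasurable; fun_prop) (h.integrable.mul_prod hg)

lemma Ck_J {G : VC} (hG : Integrable G) (h : IsKer κ M) (k : ℤ) (x : V2) :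
    Ck κ k (J G) x = J (fun ξ => M (tw ^ (-k) • ξ) * G ξ) x :=
  Ck_gen (w := id) measurable_id hG h k x

lemma JJ {G1 G2 : VC} (x : V2) :
    J G1 x * J G2 x = ∫ z : V2 × V2, ph ⟪x, z.1 + z.2⟫ * (G1 z.1 * G2 z.2) := by
  unfold J
  rw [← integral_prod_mul]
  congr 1; ext z
  rw [inner_add_right, ph_add]; ring

lemma Ck_JJ {G1 G2 : VC} (h1 : Integrable G1) (h2 : Integrable G2) {κ M : VC}
    (h : IsKer κ M) (k : ℤ) (x : V2) :
    Ck κ k (fun x => J G1 x * J G2 x) x =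
      ∫ z : V2 × V2, ph ⟪x, z.1 + z.2⟫ * (M (tw ^ (-k) • (z.1 + z.2)) * (G1 z.1 * G2 z.2)) := by
  have := Ck_gen (μ := (volume : Measure (V2 × V2))) (w := fun z => z.1 + z.2)
    (g := fun z => G1 z.1 * G2 z.2) fz (h1.mul_prod h2) h k x
  simp only [← JJ] at this
  exact this

lemma IsKer.M_cont (h : IsKer κ M) : Continuous M := by
  have : M = fun ξ => ∫ z : V2, ph (-⟪z, ξ⟫) * κ z := by ext ξ; exact (h.ft ξ).symm
  rw [this]
  apply continuous_of_dominated (bound := fun z => ‖κ z‖)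
  · intro x; exact (phmul_integrable fz h.integrable).aestronglyMeasurable
  · intro x; exact fall fun ξ => by rw [norm_mul, ph_norm, one_mul]
  · exact h.integrable.norm
  · exact fall fun ξ => by fun_prop

lemma IsKer.M_bdd (h : IsKer κ M) (ξ : V2) : ‖M ξ‖ ≤ ∫ z, ‖κ z‖ := by
  rw [← h.ft]
  refine (norm_integral_le_integral_norm _).trans_eq ?_
  congr 1; ext z; rw [norm_mul, ph_norm, one_mul]

lemma Ck_JJ_zero {G1 G2 : VC} (h1 : Integrable G1) (h2 : Integrable G2) {κ M : VC}
    (h : IsKer κ M) (k : ℤ)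
    (hz : ∀ ξ η, G1 ξ ≠ 0 → G2 η ≠ 0 → M (tw ^ (-k) • (ξ + η)) = 0) (x : V2) :
    Ck κ k (fun x => J G1 x * J G2 x) x = 0 := by
  rw [Ck_JJ h1 h2 h]
  rw [integral_eq_zero_of_ae]
  refine fall fun z => ?_
  simp only [Pi.zero_apply]
  by_cases a : G1 z.1 = 0
  · simp [a]
  by_cases b : G2 z.2 = 0
  · simp [b]
  rw [hz _ _ a b]; simp

lemma Ck_JJ_decomp {ι ι' : Type*} [Countable ι] [Countable ι'] {E : ι → Set V2} {E' : ι' → Set V2}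
    (hE : ∀ i, MeasurableSet (E i)) (hE' : ∀ i, MeasurableSet (E' i))
    (dE : Pairwise (Function.onFun Disjoint E)) (dE' : Pairwise (Function.onFun Disjoint E'))
    (cE : ∀ᵐ ξ : V2, ξ ∈ ⋃ i, E i) (cE' : ∀ᵐ ξ : V2, ξ ∈ ⋃ i, E' i)
    {G1 G2 : VC} (h1 : Integrable G1) (h2 : Integrable G2) {κ M : VC}
    (h : IsKer κ M) (k : ℤ) (x : V2) :
    ‖Ck κ k (fun x => J G1 x * J G2 x) x‖ₑ ≤ ∑' ij : ι × ι',
      ‖Ck κ k (fun x => J ((E ij.1).indicator G1) x * J ((E' ij.2).indicator G2) x) x‖ₑ := by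
  set Φ : V2 × V2 → ℂ := fun z =>
    ph ⟪x, z.1 + z.2⟫ * (M (tw ^ (-k) • (z.1 + z.2)) * (G1 z.1 * G2 z.2)) with hΦ
  have hΦi : Integrable Φ := by
    apply phmul_integrable fz
    have := h.M_cont
    exact (h1.mul_prod h2).bdd_mul (c := ∫ z, ‖κ z‖)
      (Continuous.aestronglyMeasurable fz)
      (fall fun z => h.M_bdd _)
  set S : ι × ι' → Set (V2 × V2) := fun ij => E ij.1 ×ˢ E' ij.2 with hS
  have hSm : ∀ ij, MeasurableSet (S ij) := fun ij => (hE _).prod (hE' _)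
  have hSd : Pairwise (Function.onFun Disjoint S) := by
    intro ij ij' hne
    rw [Function.onFun, Set.disjoint_prod]
    by_cases e : ij.1 = ij'.1
    · right; exact dE' fun e2 => hne (Prod.ext e e2)
    · left; exact dE e
  have hSc : (⋃ ij, S ij) =ᵐ[volume] (Set.univ : Set (V2 × V2)) := by
    have a1 : ∀ᵐ z : V2 × V2, z.1 ∈ ⋃ i, E i :=
      Measure.quasiMeasurePreserving_fst.ae cE
    have a2 : ∀ᵐ z : V2 × V2, z.2 ∈ ⋃ i, E' i :=
      Measure.quasiMeasurePreserving_snd.ae cE'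
    rw [Filter.eventuallyEq_univ]
    filter_upwards [a1, a2] with z z1 z2
    obtain ⟨i, hi⟩ := Set.mem_iUnion.1 z1
    obtain ⟨j, hj⟩ := Set.mem_iUnion.1 z2
    exact Set.mem_iUnion.2 ⟨(i, j), hi, hj⟩
  have e1 : Ck κ k (fun x => J G1 x * J G2 x) x = ∑' ij, ∫ z in S ij, Φ z := by
    rw [Ck_JJ h1 h2 h, ← integral_iUnion hSm hSd hΦi.integrableOn, setIntegral_congr_set hSc,
      setIntegral_univ]
  have e2 : ∀ ij : ι × ι', Ck κ k (fun x => J ((E ij.1).indicator G1) x *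
      J ((E' ij.2).indicator G2) x) x = ∫ z in S ij, Φ z := by
    intro ij
    rw [Ck_JJ (h1.indicator (hE _)) (h2.indicator (hE' _)) h, ← integral_indicator (hSm ij)]
    congr 1; ext z
    by_cases z1 : z.1 ∈ E ij.1 <;> by_cases z2 : z.2 ∈ E' ij.2 <;>
      simp [Set.indicator, hS, z1, z2, hΦ]
  rw [e1]
  simp_rw [e2]
  exact enorm_tsum_le_tsum_enorm

lemma young1 {q : ℝ} (hq : 1 < q) {k F : V2 → EN} (hk : Measurable k) (hF : Measurable F)
    {T : V2 → V2} (hT : Measurable T) :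
    (∫⁻ x, (∫⁻ z, k z * F (x - T z)) ^ q) ^ (1 / q) ≤ (∫⁻ z, k z) * (∫⁻ x, F x ^ q) ^ (1 / q) := by
  have hq0 : 0 < q := by linarith
  have hc : (q / (q - 1)).HolderConjugate q := (Real.HolderConjugate.conjExponent hq).symm
  set q' := q / (q - 1) with hq'
  have hq'0 : 0 < q' := hc.pos
  have pt : ∀ x, (∫⁻ z, k z * F (x - T z)) ^ q ≤
      (∫⁻ z, k z) ^ (q / q') * ∫⁻ z, k z * F (x - T z) ^ q := by
    intro x
    have h1 := ENNReal.lintegral_mul_le_Lp_mul_Lq volume hc (f := fun z => k z ^ (1 / q'))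
      (g := fun z => k z ^ (1 / q) * F (x - T z)) fz fz
    have e1 : ∀ z, ((fun z => k z ^ (1 / q')) * fun z => k z ^ (1 / q) * F (x - T z)) z =
        k z * F (x - T z) := by
      intro z
      simp only [Pi.mul_apply]
      rw [← mul_assoc, ← eRa _ _ pz pz]
      have : 1 / q' + 1 / q = 1 := by
        rw [one_div, one_div]; exact hc.inv_add_inv_eq_one
      rw [this, eR1]
    simp_rw [e1] at h1
    have e2 : ∀ z, (k z ^ (1 / q')) ^ q' = k z := by
      intro z; rw [← eRm, one_div_mul_cancel hq'0.ne', eR1]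
    have e3 : ∀ z, (k z ^ (1 / q) * F (x - T z)) ^ q = k z * F (x - T z) ^ q := by
      intro z
      rw [mrn _ _ hq0.le, ← eRm, one_div_mul_cancel hq0.ne',
        eR1]
    simp_rw [e2, e3] at h1
    have h2 := rle h1 hq0.le
    rw [mrn _ _ hq0.le, ← eRm, ← eRm,
      one_div_mul_cancel hq0.ne', eR1] at h2
    rwa [show 1 / q' * q = q / q' by ring] at h2
  have tot : ∫⁻ x, (∫⁻ z, k z * F (x - T z)) ^ q ≤
      (∫⁻ z, k z) ^ (q / q') * ((∫⁻ z, k z) * ∫⁻ x, F x ^ q) := by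
    refine (lintegral_mono pt).trans ?_
    have hm : Measurable (fun p : V2 × V2 => k p.2 * F (p.1 - T p.2) ^ q) := by fun_prop
    rw [lintegral_const_mul _ hm.lintegral_prod_right', lintegral_lintegral_swap hm.aemeasurable]
    gcongr
    rw [← lintegral_mul_const _ hk]
    apply le_of_eq
    apply lintegral_congr
    intro z
    dsimp only
    rw [lintegral_const_mul _ fz, lintegral_sub_right_eq_self (fun x => F x ^ q)]
  refine (rle tot pz).trans_eq ?_
  rw [← mul_assoc, mrn _ _ pz]
  congr 1
  nth_rewrite 2 [← eR1 (∫⁻ z, k z)]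
  rw [← eRa _ _ pz pz, ← eRm]
  have : (q / q' + 1) * (1 / q) = 1 := by
    rw [hq']; field_simp; ring
  rw [this, eR1]

lemma Ck_enorm_le (κ : VC) (k : ℤ) (H : VC) (x : V2) :
    ‖Ck κ k H x‖ₑ ≤ ∫⁻ z, ‖κ z‖ₑ * ‖H (x - (tw ^ (-k)) • z)‖ₑ := by
  refine (enorm_integral_le_lintegral_enorm _).trans_eq ?_
  apply lintegral_congr; intro z; rw [enorm_mul]

lemma Ck_Lq {q : ℝ} (hq : 1 < q) (h : IsKer κ M) (k : ℤ) {H : VC}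
    (hH : Measurable H) :
    (∫⁻ x, ‖Ck κ k H x‖ₑ ^ q) ^ (1 / q) ≤ (∫⁻ z, ‖κ z‖ₑ) * (∫⁻ x, ‖H x‖ₑ ^ q) ^ (1 / q) := by
  refine le_trans ?_ (young1 hq (k := fun z => ‖κ z‖ₑ) (F := fun x => ‖H x‖ₑ)
    h.cont.measurable.enorm hH.enorm (T := fun z => (tw ^ (-k)) • z) fz)
  gcongr with x
  exact Ck_enorm_le κ k H x

lemma l2dual {Ω T : Type*} [MeasurableSpace Ω] [MeasurableSpace T] {μ : Measure Ω} {ν : Measure T}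
    [SFinite μ] [SFinite ν] {w : Ω → T → ℝ} (hw : Measurable (Function.uncurry w))
    {W : Ω → ℝ} (hW0 : ∀ ω, 0 ≤ W ω) (hW : Integrable W μ) {G : T → ℂ} (hG : Integrable G ν) :
    ∫⁻ ω, eO (W ω) * ‖∫ t, ph (w ω t) * G t ∂ν‖ₑ ^ 2 ∂μ ≤
      ∫⁻ z : T × T, ‖G z.1‖ₑ * ‖G z.2‖ₑ * ‖∫ ω, ph (w ω z.1 - w ω z.2) * (W ω : ℂ) ∂μ‖ₑ
        ∂(ν.prod ν) := by
  set H : Ω → ℂ := fun ω => ∫ t, ph (w ω t) * G t ∂ν with hH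
  have hHm : AEStronglyMeasurable H μ := by
    have : AEStronglyMeasurable (fun z : Ω × T => ph (w z.1 z.2) * G z.2) (μ.prod ν) := by
      refine AEStronglyMeasurable.mul ?_ hG.aestronglyMeasurable.comp_snd
      exact (ph_meas.comp hw).aestronglyMeasurable
    exact this.integral_prod_right'
  have hHb : ∀ ω, ‖H ω‖ ≤ ∫ t, ‖G t‖ ∂ν := by
    intro ω
    refine (norm_integral_le_integral_norm _).trans_eq ?_
    congr 1; ext t; rw [norm_mul, ph_norm, one_mul]
  have hint : Integrable (fun ω => ‖H ω‖ ^ 2 * W ω) μ := by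
    refine hW.bdd_mul (c := (∫ t, ‖G t‖ ∂ν) ^ 2) (hHm.norm.pow 2) ?_
    refine fall fun ω => ?_
    rw [norm_pow, norm_norm]
    exact pow_le_pow_left₀ (norm_nonneg _) (hHb ω) 2
  have e1 : ∫⁻ ω, eO (W ω) * ‖H ω‖ₑ ^ 2 ∂μ = eO (∫ ω, ‖H ω‖ ^ 2 * W ω ∂μ) := by
    rw [ofReal_integral_eq_lintegral_ofReal hint
      (fall fun ω => mul_nonneg pz (hW0 ω))]
    apply lintegral_congr; intro ω
    rw [oM pz, ENNReal.ofReal_pow pz, ofReal_norm, mul_comm]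
  have e2 : eO (∫ ω, ‖H ω‖ ^ 2 * W ω ∂μ) = ‖∫ ω, (((‖H ω‖ ^ 2 * W ω : ℝ)) : ℂ) ∂μ‖ₑ := by
    rw [integral_complex_ofReal, ← ofReal_norm, Complex.norm_real, nrn]
    exact integral_nonneg fun ω => mul_nonneg pz (hW0 ω)
  have e3 : ∀ ω, (((‖H ω‖ ^ 2 * W ω : ℝ)) : ℂ) =
      ∫ z : T × T, ph (w ω z.1 - w ω z.2) * (W ω * (G z.1 * (starRingEnd ℂ) (G z.2))) ∂(ν.prod ν) := by
    intro ω
    have : (((‖H ω‖ ^ 2 * W ω : ℝ)) : ℂ) = W ω * (H ω * (starRingEnd ℂ) (H ω)) := by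
      rw [Complex.mul_conj, Complex.normSq_eq_norm_sq]; push_cast; ring
    rw [this, hH, ← integral_conj, ← integral_prod_mul, ← integral_const_mul]
    congr 1; ext z
    rw [map_mul, ph_conj, sub_eq_add_neg, ph_add]; ring
  rw [e1, e2]
  simp_rw [e3]
  rw [integral_integral_swap]
  · refine (enorm_integral_le_lintegral_enorm _).trans_eq ?_
    apply lintegral_congr; intro z
    have : ∫ ω, ph (w ω z.1 - w ω z.2) * (W ω * (G z.1 * (starRingEnd ℂ) (G z.2))) ∂μ =
       (G z.1 * (starRingEnd ℂ) (G z.2)) * ∫ ω, ph (w ω z.1 - w ω z.2) * (W ω : ℂ) ∂μ := by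
      rw [← integral_const_mul]; congr 1; ext ω; ring
    rw [this, enorm_mul, enorm_mul, RCLike.enorm_conj]
  · refine phmul_integrable (w := fun y : Ω × T × T => w y.1 y.2.1 - w y.1 y.2.2) ?_ ?_
    · apply Measurable.aestronglyMeasurable
      have m1 : Measurable (fun y : Ω × T × T => w y.1 y.2.1) :=
        hw.comp (measurable_fst.prodMk (measurable_fst.comp measurable_snd))
      have m2 : Measurable (fun y : Ω × T × T => w y.1 y.2.2) :=
        hw.comp (measurable_fst.prodMk (measurable_snd.comp measurable_snd))
      exact m1.sub m2
    · have hc : Integrable (fun t => (starRingEnd ℂ) (G t)) ν := by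
        refine (integrable_norm_iff ?_).1 (by simpa using hG.norm)
        exact (Complex.continuous_conj).comp_aestronglyMeasurable hG.aestronglyMeasurable
      exact (hW.ofReal (𝕜 := ℂ)).mul_prod (hG.mul_prod hc)

section Sec4
open scoped FourierTransform

lemma gauss_int (b : ℝ) (hb : 0 < b) (w : V2) :
    ∫ x : V2, ph ⟪x, w⟫ * ((Real.exp (-b * ‖x‖ ^ 2) : ℝ) : ℂ) =
      ((π / b * Real.exp (-(1 / (4 * b)) * ‖w‖ ^ 2) : ℝ) : ℂ) := by
  have h := GaussianFourier.integral_cexp_neg_mul_sq_norm_add (b := (b:ℂ)) (by simpa using hb)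
    Complex.I w
  have e : ∀ x : V2, ph ⟪x, w⟫ * ((Real.exp (-b * ‖x‖ ^ 2) : ℝ) : ℂ) =
      Complex.exp (-b * ‖x‖ ^ 2 + Complex.I * ⟪w, x⟫) := by
    intro x
    unfold ph
    rw [Complex.ofReal_exp, ← Complex.exp_add, real_inner_comm]
    congr 1; push_cast; ring
  simp_rw [e]
  rw [h]
  simp only [finrank_euclideanSpace, Fintype.card_fin, Nat.cast_ofNat]
  rw [div_self nz, Complex.cpow_one]
  push_cast
  congr 2
  rw [Complex.I_sq]; ring

lemma gauss_real (b : ℝ) (hb : 0 < b) :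
    Integrable (fun x : V2 => Real.exp (-b * ‖x‖ ^ 2)) ∧
    ∫ x : V2, Real.exp (-b * ‖x‖ ^ 2) = π / b := by
  have h := gauss_int b hb 0
  simp only [inner_zero_right, ph_zero, one_mul, norm_zero] at h
  rw [integral_complex_ofReal] at h
  norm_num at h
  have h2 : ((∫ x : V2, Real.exp (-b * ‖x‖ ^ 2) : ℝ) : ℂ) = ((π / b : ℝ) : ℂ) := by
    push_cast; simpa using h
  have h3 := Complex.ofReal_injective h2
  refine ⟨?_, h3⟩
  by_contra hc
  rw [integral_undef hc] at h3
  have : 0 < π / b := by positivity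
  linarith

lemma gauss_lint (b : ℝ) (hb : 0 < b) :
    ∫⁻ x : V2, eO (Real.exp (-b * ‖x‖ ^ 2)) = eO (π / b) := by
  obtain ⟨h1, h2⟩ := gauss_real b hb
  rw [← h2, ofReal_integral_eq_lintegral_ofReal h1 (fall fun x => by positivity)]

lemma plancherel {G : VC} (hG : Integrable G) :
    ∫⁻ x, ‖J G x‖ₑ ^ 2 ≤ eO (4 * π ^ 2) * ∫⁻ ξ, ‖G ξ‖ₑ ^ 2 := by
  have step : ∀ b : ℝ, 0 < b → ∫⁻ x : V2, eO (Real.exp (-b * ‖x‖ ^ 2)) * ‖J G x‖ₑ ^ 2 ≤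
      eO (4 * π ^ 2) * ∫⁻ ξ, ‖G ξ‖ₑ ^ 2 := by
    intro b hb
    have h := l2dual (μ := (volume : Measure V2)) (ν := (volume : Measure V2))
      (w := fun x ξ => ⟪x, ξ⟫) (by unfold Function.uncurry; fun_prop)
      (W := fun x => Real.exp (-b * ‖x‖ ^ 2))
      (fun x => by positivity) (gauss_real b hb).1 hG
    refine h.trans ?_
    set g : V2 → EN := fun ζ => eO (π / b * Real.exp (-(1 / (4 * b)) * ‖ζ‖ ^ 2)) with hg
    have gm : Measurable g := by fun_prop
    have gint : ∫⁻ ζ, g ζ = eO (4 * π ^ 2) := by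
      have : ∀ ζ, g ζ = eO (π / b) *
          eO (Real.exp (-(1 / (4 * b)) * ‖ζ‖ ^ 2)) := by
        intro ζ; rw [hg, ← oM pz]
      simp_rw [this]
      rw [lintegral_const_mul _ fz, gauss_lint _ pz,
        ← oM pz]
      congr 1; field_simp
    have gneg : ∀ ζ, g (-ζ) = g ζ := by intro ζ; simp [hg]
    have e1 : ∀ z : V2 × V2, ‖∫ x : V2, ph (⟪x, z.1⟫ - ⟪x, z.2⟫) *
        ((Real.exp (-b * ‖x‖ ^ 2) : ℝ) : ℂ)‖ₑ = g (z.1 - z.2) := by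
      intro z
      simp_rw [← inner_sub_right]
      rw [gauss_int b hb, ← ofReal_norm, Complex.norm_real, nrn pz]
    simp_rw [e1]
    have hGm := hG.aestronglyMeasurable.aemeasurable
    set Γ : V2 → EN := fun ξ => ‖G ξ‖ₑ with hΓ
    have Γm : AEMeasurable Γ volume := hGm.enorm
    have am : ∀ a c : EN, a * c ≤ (a ^ 2 + c ^ 2) * 2⁻¹ := by
      intro a c
      rw [← div_eq_mul_inv, ENNReal.le_div_iff_mul_le (by simp) (by simp)]
      rcases le_total a c with hac | hac
      · obtain ⟨d, rfl⟩ := exists_add_of_le hac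
        calc a * (a + d) * 2 ≤ a * (a + d) * 2 + d ^ 2 := le_self_add
          _ = _ := by ring
      · obtain ⟨d, rfl⟩ := exists_add_of_le hac
        calc (c + d) * c * 2 ≤ (c + d) * c * 2 + d ^ 2 := le_self_add
          _ = _ := by ring
    have m1 : AEMeasurable (fun z : V2 × V2 => Γ z.1 ^ 2 * g (z.1 - z.2)) (volume.prod volume) :=
      (Γm.comp_fst.pow_const 2).mul (Measurable.aemeasurable fz)
    have m2 : AEMeasurable (fun z : V2 × V2 => Γ z.2 ^ 2 * g (z.1 - z.2)) (volume.prod volume) :=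
      (Γm.comp_snd.pow_const 2).mul (Measurable.aemeasurable fz)
    have i1 : ∫⁻ z : V2 × V2, Γ z.1 ^ 2 * g (z.1 - z.2) ∂(volume.prod volume) =
        eO (4 * π ^ 2) * ∫⁻ ξ, Γ ξ ^ 2 := by
      rw [lintegral_prod _ m1, mul_comm, ← lintegral_mul_const'' _ (Γm.pow_const 2)]
      apply lintegral_congr; intro ξ
      dsimp only
      rw [lintegral_const_mul _ fz, lintegral_sub_left_eq_self, gint]
    have i2 : ∫⁻ z : V2 × V2, Γ z.2 ^ 2 * g (z.1 - z.2) ∂(volume.prod volume) =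
        eO (4 * π ^ 2) * ∫⁻ ξ, Γ ξ ^ 2 := by
      rw [lintegral_prod_symm _ m2, mul_comm, ← lintegral_mul_const'' _ (Γm.pow_const 2)]
      apply lintegral_congr; intro ξ
      dsimp only
      rw [lintegral_const_mul _ fz, lintegral_sub_right_eq_self, gint]
    calc ∫⁻ z : V2 × V2, Γ z.1 * Γ z.2 * g (z.1 - z.2) ∂(volume.prod volume)
        ≤ ∫⁻ z : V2 × V2, (Γ z.1 ^ 2 * g (z.1 - z.2) + Γ z.2 ^ 2 * g (z.1 - z.2)) * 2⁻¹
            ∂(volume.prod volume) := by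
          apply lintegral_mono; intro z
          dsimp only
          rw [← add_mul, mul_right_comm (Γ z.1 ^ 2 + Γ z.2 ^ 2)]
          exact MLL (am _ _) _
      _ = _ := by
          rw [lintegral_mul_const' _ _ (by simp), lintegral_add_left' m1, i1, i2, ← mul_two,
            mul_assoc, ENNReal.mul_inv_cancel (by simp) (by simp), mul_one]
  have hJm : Measurable (J G) := (J_cont hG).measurable
  have lim : ∀ x : V2, ‖J G x‖ₑ ^ 2 = Filter.liminf (fun n : ℕ =>
      eO (Real.exp (-(1 / ((n:ℝ) + 1)) * ‖x‖ ^ 2)) * ‖J G x‖ₑ ^ 2) Filter.atTop := by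
    intro x
    symm
    apply Filter.Tendsto.liminf_eq
    have h1 : Filter.Tendsto (fun n : ℕ => eO (Real.exp (-(1 / ((n:ℝ) + 1)) * ‖x‖ ^ 2)))
        Filter.atTop (nhds 1) := by
      rw [← ENNReal.ofReal_one]
      apply ENNReal.tendsto_ofReal
      have h2 := (tendsto_one_div_add_atTop_nhds_zero_nat (𝕜 := ℝ)).neg.mul_const (‖x‖ ^ 2)
      simp only [neg_zero, zero_mul] at h2
      simpa [Function.comp_def] using (Real.continuous_exp.tendsto 0).comp h2
    have := ENNReal.Tendsto.mul_const (b := ‖J G x‖ₑ ^ 2) h1 (Or.inl one_ne_zero)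
    simpa using this
  calc ∫⁻ x, ‖J G x‖ₑ ^ 2 = ∫⁻ x, Filter.liminf (fun n : ℕ =>
      eO (Real.exp (-(1 / ((n:ℝ) + 1)) * ‖x‖ ^ 2)) * ‖J G x‖ₑ ^ 2) Filter.atTop :=
        lintegral_congr lim
    _ ≤ Filter.liminf (fun n : ℕ => ∫⁻ x : V2,
      eO (Real.exp (-(1 / ((n:ℝ) + 1)) * ‖x‖ ^ 2)) * ‖J G x‖ₑ ^ 2) Filter.atTop :=
        lintegral_liminf_le fun n => by fun_prop
    _ ≤ _ := by
        refine Filter.liminf_le_of_le (by isBoundedDefault) ?_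
        intro b hb
        obtain ⟨n, hn⟩ := hb.exists
        exact hn.trans (step _ pz)

lemma fourierInv_J (G : VC) (x : V2) : 𝓕⁻ G x = J G ((2 * π) • x) := by
  rw [Real.fourierInv_eq']
  unfold J
  congr 1; ext ξ
  rw [smul_eq_mul, real_inner_smul_left, real_inner_comm]
  unfold ph
  congr 2; push_cast; ring

lemma fourier_ft2 (H : VC) (x : V2) : 𝓕 H x = ft2 H ((2 * π) • x) := by
  rw [Real.fourier_eq']
  unfold ft2
  congr 1; ext ξ
  rw [smul_eq_mul, real_inner_smul_right]
  congr 2; push_cast; ring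

def nft (H : VC) (ξ : V2) : ℂ := ((((2 * π) ^ 2)⁻¹ : ℝ) : ℂ) * ft2 H ξ

lemma nft_eq (H : SchwartzMap V2 ℂ) (ξ : V2) :
    nft H ξ = ((((2 * π) ^ 2)⁻¹ : ℝ) : ℂ) * (𝓕 H) ((2 * π)⁻¹ • ξ) := by
  rw [SchwartzMap.fourier_coe, fourier_ft2, smul_smul, mul_inv_cancel₀ pz, one_smul]
  rfl

lemma int_scale (c : ℝ) (hc : 0 < c) (f : VC) :
    ∫ x : V2, f (c • x) = (((c ^ 2)⁻¹ : ℝ) : ℂ) * ∫ x : V2, f x := by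
  have := Measure.integral_comp_smul (volume : Measure V2) f c
  simp only [finrank_euclideanSpace, Fintype.card_fin] at this
  rw [this, abs_of_pos pz]
  simp

lemma nft_integrable (H : SchwartzMap V2 ℂ) (N : ℕ) :
    Integrable (fun ξ => ((‖ξ‖ ^ N : ℝ) : ℂ) * nft H ξ) := by
  have h := (𝓕 H).integrable_pow_mul volume N
  have h2 : Integrable (fun ξ : V2 => ((‖ξ‖ ^ N : ℝ) : ℂ) * (𝓕 H) ξ) := by
    rw [← integrable_norm_iff (Continuous.aestronglyMeasurable fz)]
    simpa using h
  have h3 := h2.comp_smul (R := (2 * π)⁻¹) pz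
  refine (h3.const_mul ((((2 * π) ^ N : ℝ) : ℂ) * ((((2 * π) ^ 2)⁻¹ : ℝ) : ℂ))).congr ?_
  refine fall fun ξ => ?_
  dsimp only
  rw [nft_eq, norm_smul, nrn pz, mul_pow]
  have : (((2 * π) ^ N : ℝ) : ℂ) ≠ 0 := by exact_mod_cast pz
  push_cast at this ⊢
  rw [mul_pow (2 * (π:ℂ))⁻¹, inv_pow, ← mul_pow]
  field_simp

lemma nft_integrable0 (H : SchwartzMap V2 ℂ) : Integrable (nft H) := by
  simpa using nft_integrable H 0

lemma nft_cont (H : SchwartzMap V2 ℂ) : Continuous (nft H) := by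
  have : nft H = fun ξ => ((((2 * π) ^ 2)⁻¹ : ℝ) : ℂ) * (𝓕 H) ((2 * π)⁻¹ • ξ) := by
    ext ξ; exact nft_eq H ξ
  rw [this]; fun_prop

lemma J_nft (H : SchwartzMap V2 ℂ) (x : V2) : J (nft H) x = H x := by
  have h1 : (𝓕⁻ (𝓕 H)) x = H x := by simp
  rw [SchwartzMap.fourierInv_coe, fourierInv_J] at h1
  rw [← h1]
  unfold J
  simp_rw [nft_eq]
  have := int_scale (2 * π)⁻¹ pz
    (fun ξ => ph ⟪(2 * π) • x, ξ⟫ * (𝓕 H) ξ * ((((2 * π) ^ 2)⁻¹ : ℝ) : ℂ))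
  simp_rw [real_inner_smul_left, real_inner_smul_right] at this
  have e : ∀ ξ : V2, 2 * π * ((2 * π)⁻¹ * ⟪x, ξ⟫) = ⟪x, ξ⟫ := by
    intro ξ; field_simp
  simp_rw [e] at this
  calc _ = _ := by congr 1; ext ξ; ring
    _ = _ := this
    _ = _ := by
      rw [integral_mul_const, ← mul_assoc, mul_comm _ ((((2 * π) ^ 2)⁻¹ : ℝ) : ℂ), ← mul_assoc]
      simp_rw [real_inner_smul_left]
      rw [← Complex.ofReal_mul, inv_pow, inv_inv, inv_mul_cancel₀ pz]; simp

lemma exists_ker {M : VC} (h1 : HasCompactSupport M) (h2 : ContDiff ℝ (⊤ : ℕ∞) M) :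
    ∃ κ : V2 → ℂ, IsKer κ M := by
  set M' : SchwartzMap V2 ℂ := h1.toSchwartzMap h2 with hM'
  have hM'c : ∀ x, M' x = M x := fun x => rfl
  set m := 𝓕⁻ M' with hm
  refine ⟨fun z => ((((2 * π) ^ 2)⁻¹ : ℝ) : ℂ) * m ((2 * π)⁻¹ • z), by fun_prop, ?_, ?_⟩
  · obtain ⟨C, hC⟩ := m.decay 4 0
    obtain ⟨C0, hC0⟩ := m.decay 0 0
    simp only [norm_iteratedFDeriv_zero, pow_zero, one_mul] at hC hC0
    refine ⟨((2 * π) ^ 2)⁻¹ * (2 ^ 4 * (C0 + (2 * π) ^ 4 * C)), fun z => ?_⟩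
    rw [norm_mul, Complex.norm_real, nrn pz, mul_assoc]
    refine mlr ?_ pz
    have a1 := hC.2 ((2 * π)⁻¹ • z)
    have a2 := hC0.2 ((2 * π)⁻¹ • z)
    rw [norm_smul, nrn pz, mul_pow] at a1
    set v := ‖m ((2 * π)⁻¹ • z)‖
    have a3 : ‖z‖ ^ 4 * v ≤ (2 * π) ^ 4 * C := by
      have : ((2 * π)⁻¹ ^ 4 * ‖z‖ ^ 4 * v) * (2 * π) ^ 4 ≤ C * (2 * π) ^ 4 := by gcongr
      have e : ((2 * π)⁻¹ ^ 4 * ‖z‖ ^ 4 * v) * (2 * π) ^ 4 = ‖z‖ ^ 4 * v := by field_simp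
      linarith
    have hv : 0 ≤ v := norm_nonneg _
    have a4 : (1 + ‖z‖) ^ (4:ℝ) ≤ 2 ^ 4 * (1 + ‖z‖ ^ 4) := by
      have : (1 + ‖z‖) ^ (4:ℝ) = (1 + ‖z‖) ^ (4:ℕ) := by
        rw [← Real.rpow_natCast]; norm_num
      rw [this]
      rcases le_total 1 ‖z‖ with h | h
      · calc (1 + ‖z‖) ^ 4 ≤ (‖z‖ + ‖z‖) ^ 4 := by gcongr
          _ = 2 ^ 4 * ‖z‖ ^ 4 := by ring
          _ ≤ _ := by gcongr; linarith
      · calc (1 + ‖z‖) ^ 4 ≤ (1 + 1) ^ 4 := by gcongr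
          _ = 2 ^ 4 * 1 := by norm_num
          _ ≤ _ := by gcongr; linarith [show 0 ≤ ‖z‖ ^ 4 by positivity]
    calc v * (1 + ‖z‖) ^ (4:ℝ) ≤ v * (2 ^ 4 * (1 + ‖z‖ ^ 4)) := by gcongr
      _ = 2 ^ 4 * (v + ‖z‖ ^ 4 * v) := by ring
      _ ≤ _ := by gcongr
  · intro ξ
    have h3 : (𝓕 m) ξ = M ξ := by
      rw [hm]; simp [hM'c]
    rw [SchwartzMap.fourier_coe, fourier_ft2] at h3
    rw [← h3]
    have := int_scale (2 * π)⁻¹ pz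
      (fun z => ph (-⟪(2 * π) • z, ξ⟫) * (((((2 * π) ^ 2)⁻¹ : ℝ) : ℂ) * m z))
    have e : ∀ z : V2, (2 * π) • ((2 * π)⁻¹ • z) = z := by
      intro z; rw [smul_smul, mul_inv_cancel₀ pz, one_smul]
    simp_rw [e] at this
    rw [this, ← integral_const_mul]
    unfold ft2
    congr 1; ext z
    rw [real_inner_smul_left, real_inner_smul_right]
    have e2 : ((((((2 * π)⁻¹) ^ 2)⁻¹ : ℝ)) : ℂ) * ((((2 * π) ^ 2)⁻¹ : ℝ) : ℂ) = 1 := by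
      rw [← Complex.ofReal_mul, inv_pow, inv_inv, mul_inv_cancel₀ pz]; simp
    have e3 : ph (-(2 * π * ⟪z, ξ⟫)) = Complex.exp (-Complex.I * ((2 * π * ⟪z, ξ⟫ : ℝ) : ℂ)) := by
      unfold ph; congr 1; push_cast; ring
    rw [← e3]
    linear_combination (ph (-(2 * π * ⟪z, ξ⟫)) * m z) * e2

end Sec4

def Cube (c : Fin 2 → ℝ) (μ : ℝ) : Set V2 := {ξ | ∀ i, ξ i ∈ Set.Ico (c i) (c i + μ)}

lemma Cube_meas (c : Fin 2 → ℝ) (μ : ℝ) : MeasurableSet (Cube c μ) := by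
  have : Cube c μ = ⋂ i, (fun ξ : V2 => ξ i) ⁻¹' (Set.Ico (c i) (c i + μ)) := by
    ext ξ; simp [Cube]
  rw [this]
  exact MeasurableSet.iInter fun i => measurableSet_Ico.preimage fz

def e2 : V2 ≃ᵐ ℝ × ℝ :=
  (MeasurableEquiv.toLp 2 (Fin 2 → ℝ)).symm.trans MeasurableEquiv.finTwoArrow

lemma e2_mp : MeasurePreserving e2 volume (volume.prod volume) :=
  (volume_preserving_finTwoArrow ℝ).comp (EuclideanSpace.volume_preserving_symm_measurableEquiv_toLp (Fin 2))

lemma e2_apply (ξ : V2) : e2 ξ = (ξ 0, ξ 1) := rfl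

lemma Cube_e2 (c : Fin 2 → ℝ) (μ : ℝ) : Cube c μ = e2 ⁻¹' (Set.Ico (c 0) (c 0 + μ) ×ˢ Set.Ico (c 1) (c 1 + μ)) := by
  ext ξ
  simp [Cube, e2_apply, Fin.forall_fin_two]

lemma Cube_vol (c : Fin 2 → ℝ) (μ : ℝ) : volume (Cube c μ) = eO μ * eO μ := by
  rw [Cube_e2, e2_mp.measure_preimage_equiv, Measure.prod_prod]
  simp

lemma cube_int (c : Fin 2 → ℝ) (μ : ℝ) (f : ℝ × ℝ → ℂ) (hf : Continuous f) :
    ∫ ξ in Cube c μ, f (ξ 0, ξ 1) = ∫ r in Set.Ico (c 0) (c 0 + μ), ∫ y in Set.Ico (c 1) (c 1 + μ), f (r, y) ∧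
    ∫ ξ in Cube c μ, f (ξ 0, ξ 1) = ∫ y in Set.Ico (c 1) (c 1 + μ), ∫ r in Set.Ico (c 0) (c 0 + μ), f (r, y) := by
  have h := e2_mp.setIntegral_preimage_emb e2.measurableEmbedding f (Set.Ico (c 0) (c 0 + μ) ×ˢ Set.Ico (c 1) (c 1 + μ))
  rw [← Cube_e2] at h
  simp only [e2_apply] at h
  have hi : IntegrableOn f (Set.Ico (c 0) (c 0 + μ) ×ˢ Set.Ico (c 1) (c 1 + μ)) (volume.prod volume) :=
    (hf.continuousOn.integrableOn_compact (isCompact_Icc.prod isCompact_Icc)).mono_set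
      (Set.prod_mono Set.Ico_subset_Icc_self Set.Ico_subset_Icc_self)
  have h1 := setIntegral_prod f hi
  refine ⟨h.trans h1, (h.trans h1).trans ?_⟩
  rw [integral_integral_swap]
  rw [Measure.prod_restrict]; exact hi

lemma cube_ker {c : Fin 2 → ℝ} {μ N t : ℝ} (x : V2) (hμ : 0 ≤ μ) (hN : 0 < N) (ht : t ≠ 0)
    (j : Fin 2) (hj : ∀ r ∈ Set.Icc (c j) (c j + μ), N / 2 ≤ |r|)
    (hn : ∀ r ∈ Set.Icc (c 0) (c 0 + μ), ∀ y ∈ Set.Icc (c 1) (c 1 + μ), √(r ^ 2 + y ^ 2) ≤ 4 * N) :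
    ‖∫ ξ in Cube c μ, ph (⟪x, ξ⟫ + t * ‖ξ‖)‖ ≤ 96 * μ * √(N / |t|) := by
  have e : ∀ ξ : V2, ph (⟪x, ξ⟫ + t * ‖ξ‖) =
      (fun z : ℝ × ℝ => ph (x 0 * z.1 + x 1 * z.2 + t * √(z.1 ^ 2 + z.2 ^ 2))) (ξ 0, ξ 1) := by
    intro ξ
    rw [EuclideanSpace.norm_eq, PiLp.inner_apply]
    simp only [Fin.sum_univ_two, RCLike.inner_apply, Real.norm_eq_abs, sq_abs]
    simp [mul_comm]
  simp_rw [e]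
  have hc : Continuous (fun z : ℝ × ℝ => ph (x 0 * z.1 + x 1 * z.2 + t * √(z.1 ^ 2 + z.2 ^ 2))) := by
    apply ph_cont.comp; fun_prop
  obtain ⟨h0, h1⟩ := cube_int c μ _ hc
  have hb : 6 / √(|t| * ((1 / 2) ^ 2 / (64 * N))) = 96 * √(N / |t|) := by
    have : |t| * ((1 / 2) ^ 2 / (64 * N)) = (N / |t|)⁻¹ / 16 ^ 2 := by
      field_simp; norm_num
    rw [this, Real.sqrt_div pz, Real.sqrt_inv, Real.sqrt_sq nz]
    field_simp; norm_num
  have key : ∀ F : ℝ → ℝ → ℂ, ∀ a b : ℝ, (∀ r ∈ Set.Ico a (a + μ), ‖∫ y in b..(b + μ), F r y‖ ≤ 96 * √(N / |t|)) →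
      ‖∫ r in Set.Ico a (a + μ), ∫ y in Set.Ico b (b + μ), F r y‖ ≤ 96 * μ * √(N / |t|) := by
    intro F a b hF
    have := norm_setIntegral_le_of_norm_le_const (μ := volume) (s := Set.Ico a (a + μ)) (by simp)
      (f := fun r => ∫ y in Set.Ico b (b + μ), F r y) (C := 96 * √(N / |t|)) (fun r hr => by
        rw [integral_Ico_eq_integral_Ioc, ← intervalIntegral.integral_of_le lz]
        exact hF r hr)
    refine this.trans_eq ?_
    simp [measureReal_def, hμ]; ring
  rcases Fin.exists_fin_two.mp ⟨j, rfl⟩ with rfl | rfl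
  · rw [h0]
    apply key
    intro r hr
    have hr' := Set.Ico_subset_Icc_self hr
    have := vdc_wave (r := r) (t := t) (x := x 1) (z := x 0 * r) (a := c 1) (b := c 1 + μ) (N := N)
      (c := 1 / 2) lz (by linarith [hj r hr']) nz hN ht (fun y hy => hn r hr' y hy)
    rw [hb] at this
    convert this using 4 with y
    unfold ph; congr 3; ring
  · rw [h1]
    apply key (fun y r => _)
    intro r hr
    have hr' := Set.Ico_subset_Icc_self hr
    have := vdc_wave (r := r) (t := t) (x := x 0) (z := x 1 * r) (a := c 0) (b := c 0 + μ) (N := N)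
      (c := 1 / 2) lz (by linarith [hj r hr']) nz hN ht
      (fun y hy => by rw [add_comm]; exact hn y hy r hr')
    rw [hb] at this
    convert this using 4 with y
    unfold ph; dsimp only; rw [add_comm (y ^ 2)]; congr 3; ring

lemma cube_ker' {c : Fin 2 → ℝ} {μ : ℝ} (hμ : 0 ≤ μ) (w : V2 → ℝ) :
    ‖∫ ξ in Cube c μ, ph (w ξ)‖ ≤ μ ^ 2 := by
  have := norm_setIntegral_le_of_norm_le_const (μ := volume) (s := Cube c μ) (f := fun ξ => ph (w ξ)) (C := 1)
    (by rw [Cube_vol]; finiteness) (fun r hr => (ph_norm _).le)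
  refine this.trans_eq ?_
  rw [measureReal_def, Cube_vol]; simp [hμ]; ring

lemma cube_geom {c : Fin 2 → ℝ} {μ N : ℝ} (hμ : 0 ≤ μ) (hN : 0 < N) (hμN : μ ≤ N / 8)
    {ξ : V2} (hξ : ξ ∈ Cube c μ) (h1 : N ≤ ‖ξ‖) (h2 : ‖ξ‖ ≤ 2 * N) :
    (∃ j, ∀ r ∈ Set.Icc (c j) (c j + μ), N / 2 ≤ |r|) ∧
    (∀ r ∈ Set.Icc (c 0) (c 0 + μ), ∀ y ∈ Set.Icc (c 1) (c 1 + μ), √(r ^ 2 + y ^ 2) ≤ 4 * N) := by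
  rw [EuclideanSpace.norm_eq] at h1 h2
  simp only [Fin.sum_univ_two, Real.norm_eq_abs, sq_abs] at h1 h2
  have hs := Real.sq_sqrt (show 0 ≤ ξ 0 ^ 2 + ξ 1 ^ 2 by positivity)
  have hs0 := Real.sqrt_nonneg (ξ 0 ^ 2 + ξ 1 ^ 2)
  have g1 : N ^ 2 ≤ ξ 0 ^ 2 + ξ 1 ^ 2 := by nlinarith
  have g2 : ξ 0 ^ 2 + ξ 1 ^ 2 ≤ 4 * N ^ 2 := by nlinarith
  have a0 := hξ 0
  have a1 := hξ 1
  constructor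
  · have : ∃ j, (5 / 8 * N) ≤ |ξ j| := by
      by_contra hc
      push Not at hc
      have b0 := hc 0
      have b1 := hc 1
      have := sq_abs (ξ 0)
      have := sq_abs (ξ 1)
      have := abs_nonneg (ξ 0)
      have := abs_nonneg (ξ 1)
      nlinarith
    obtain ⟨j, hj⟩ := this
    refine ⟨j, fun r hr => ?_⟩
    have aj := hξ j
    have h3 : |ξ j - r| ≤ μ := by
      rw [abs_le]; constructor <;> linarith [hr.1, hr.2, aj.1, aj.2]
    have := abs_sub_abs_le_abs_sub (ξ j) r
    linarith
  · intro r hr y hy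
    have b0 : |r - ξ 0| ≤ N / 8 := by
      rw [abs_le]; constructor <;> linarith [hr.1, hr.2, a0.1, a0.2]
    have b1 : |y - ξ 1| ≤ N / 8 := by
      rw [abs_le]; constructor <;> linarith [hy.1, hy.2, a1.1, a1.2]
    rw [Real.sqrt_le_left pz]
    have c0 : (r - ξ 0) ^ 2 ≤ (N / 8) ^ 2 := sq_le_sq' (by linarith [(abs_le.mp b0).1]) (by linarith [(abs_le.mp b0).2])
    have c1 : (y - ξ 1) ^ 2 ≤ (N / 8) ^ 2 := sq_le_sq' (by linarith [(abs_le.mp b1).1]) (by linarith [(abs_le.mp b1).2])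
    nlinarith [sq_nonneg (r - 2 * ξ 0), sq_nonneg (y - 2 * ξ 1)]

def Gt (U : WC) (t : ℝ) (ξ : V2) : ℂ := ∫ τ : ℝ, ph (t * τ) * U (τ, ξ)

def wE (s θ : ℝ) (U : WC) (E : Set V2) : EN :=
  ∫⁻ q in (Prod.snd ⁻¹' E : Set (ℝ × V2)), (eO (wgt s θ q.1 q.2) * ‖U q‖ₑ) ^ 2

lemma ph_meas' {Ω : Type*} [MeasurableSpace Ω] {w : Ω → ℝ} (hw : Measurable w) :
    Measurable (fun x => ph (w x)) := ph_cont.measurable.comp hw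

lemma Gt_int {U : WC} (hU : Integrable U) (t : ℝ) : Integrable (Gt U t) := by
  have h : Integrable (fun q : ℝ × V2 => ph (t * q.1) * U q) (volume.prod volume) :=
    phmul_integrable fz hU
  exact h.integral_prod_right

lemma uE_eq {U : WC} (hU : Integrable U) {E : Set V2} (hE : MeasurableSet E) (t : ℝ) (x : V2) :
    J (E.indicator (Gt U t)) x =
      ∫ q : ℝ × V2, ph (t * q.1 + ⟪x, q.2⟫) * (Prod.snd ⁻¹' E : Set (ℝ × V2)).indicator U q := by
  have h : Integrable (fun q : ℝ × V2 => ph (t * q.1 + ⟪x, q.2⟫) *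
      (Prod.snd ⁻¹' E : Set (ℝ × V2)).indicator U q) (volume.prod volume) :=
    phmul_integrable fz (hU.indicator (measurable_snd hE))
  have h2 := integral_prod_symm _ h
  refine Eq.trans ?_ h2.symm
  unfold J
  congr 1; ext ξ
  by_cases hξ : ξ ∈ E
  · simp only [Set.indicator, Set.mem_preimage, hξ, if_true]
    unfold Gt
    rw [← integral_const_mul]
    congr 1; ext τ
    rw [ph_add]; ring
  · simp [Set.indicator, Set.mem_preimage, hξ]

lemma uE_cont {U : WC} (hU : Integrable U) {E : Set V2} (hE : MeasurableSet E) :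
    Continuous (fun z : ℝ × V2 => J (E.indicator (Gt U z.1)) z.2) := by
  simp_rw [uE_eq hU hE]
  have hi := hU.indicator (measurable_snd hE)
  refine continuous_of_dominated (bound := fun q => ‖(Prod.snd ⁻¹' E : Set (ℝ × V2)).indicator U q‖) ?_ ?_ hi.norm ?_
  · intro z; exact (phmul_integrable fz hi).aestronglyMeasurable
  · intro z; refine fall fun q => ?_
    rw [norm_mul, ph_norm, one_mul]
  · refine fall fun q => ?_
    refine Continuous.mul (ph_cont.comp fz) continuous_const

def cθ (θ : ℝ) : ℝ := ∫ τ : ℝ, (1 + |τ|) ^ (-(2 * θ))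

lemma cθ_int {θ : ℝ} (hθ : 1 / 2 < θ) : Integrable (fun τ : ℝ => (1 + |τ|) ^ (-(2 * θ))) := by
  have := integrable_one_add_norm (E := ℝ) (μ := volume) (r := 2 * θ) (by simp; linarith)
  simpa using this

lemma cθ_nonneg (θ : ℝ) : 0 ≤ cθ θ := integral_nonneg fun τ => by positivity

lemma wave_wt (θ : ℝ) (τ r : ℝ) (hr : 0 ≤ r) :
    (1 + |(|τ| - r)|) ^ (-(2 * θ)) ≤ (1 + |τ - r|) ^ (-(2 * θ)) + (1 + |τ + r|) ^ (-(2 * θ)) := by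
  rcases le_total 0 τ with h | h
  · rw [abs_of_nonneg h]
    have : 0 ≤ (1 + |τ + r|) ^ (-(2 * θ)) := by positivity
    linarith
  · rw [abs_of_nonpos h]
    have : 0 ≤ (1 + |τ - r|) ^ (-(2 * θ)) := by positivity
    have e : |-τ - r| = |τ + r| := by rw [← abs_neg]; congr 1; ring
    rw [e]; linarith

lemma wave_lint {θ : ℝ} (hθ : 1 / 2 < θ) (r : ℝ) (hr : 0 ≤ r) :
    ∫⁻ τ : ℝ, eO ((1 + |(|τ| - r)|) ^ (-(2 * θ))) ≤ eO (2 * cθ θ) := by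
  have h0 : ∫⁻ τ : ℝ, eO ((1 + |τ|) ^ (-(2 * θ))) = eO (cθ θ) := by
    rw [cθ, ofReal_integral_eq_lintegral_ofReal (cθ_int hθ) (fall fun x => by positivity)]
  calc _ ≤ ∫⁻ τ : ℝ, (eO ((1 + |τ - r|) ^ (-(2 * θ))) + eO ((1 + |τ + r|) ^ (-(2 * θ)))) := by
        apply lintegral_mono; intro τ
        dsimp only
        rw [← ENNReal.ofReal_add pz pz]
        exact oLe (wave_wt θ τ r hr)
    _ = eO (cθ θ) + eO (cθ θ) := by
        rw [lintegral_add_left fz]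
        rw [lintegral_sub_right_eq_self (fun τ => eO ((1 + |τ|) ^ (-(2 * θ)))) r,
          lintegral_add_right_eq_self (fun τ => eO ((1 + |τ|) ^ (-(2 * θ)))) r, h0]
    _ = _ := by rw [← ENNReal.ofReal_add (cθ_nonneg θ) (cθ_nonneg θ), two_mul]

lemma CS_lint {Ω : Type*} [MeasurableSpace Ω] {μ : Measure Ω} {f g : Ω → EN} (hf : AEMeasurable f μ)
    (hg : AEMeasurable g μ) : (∫⁻ x, f x * g x ∂μ) ^ 2 ≤ (∫⁻ x, f x ^ 2 ∂μ) * ∫⁻ x, g x ^ 2 ∂μ := by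
  have h := ENNReal.lintegral_mul_le_Lp_mul_Lq μ Real.HolderConjugate.two_two hf hg
  simp only [Pi.mul_apply, eR2] at h
  calc _ ≤ ((∫⁻ x, f x ^ 2 ∂μ) ^ hfw * (∫⁻ x, g x ^ 2 ∂μ) ^ hfw) ^ 2 := pow_le_pow_left' h 2
    _ = _ := by
      rw [mul_pow, ← eR2, ← eR2, ← eRm, ← eRm]
      norm_num

lemma Gt_pt {s θ : ℝ} (hθ : 1 / 2 < θ) {U : WC} (hU : Measurable U) (t : ℝ) (ξ : V2) :
    eO ((1 + ‖ξ‖ ^ 2) ^ s) * ‖Gt U t ξ‖ₑ ^ 2 ≤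
      eO (2 * cθ θ) * ∫⁻ τ : ℝ, (eO (wgt s θ τ ξ) * ‖U (τ, ξ)‖ₑ) ^ 2 := by
  have hUξ : Measurable fun τ : ℝ => U (τ, ξ) := hU.comp fz
  have h1 : ‖Gt U t ξ‖ₑ ≤ ∫⁻ τ : ℝ, ‖U (τ, ξ)‖ₑ := by
    refine (enorm_integral_le_lintegral_enorm _).trans_eq ?_
    congr 1; ext τ; rw [enorm_mul, ph_enorm, one_mul]
  have hw : Measurable fun τ : ℝ => wgt s θ τ ξ := by unfold wgt; fun_prop
  have hp : ∀ τ, (0:ℝ) < 1 + |(|τ| - ‖ξ‖)| := fun τ => by positivity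
  have h2 : eO ((1 + ‖ξ‖ ^ 2) ^ (s / 2)) * ∫⁻ τ : ℝ, ‖U (τ, ξ)‖ₑ =
      ∫⁻ τ : ℝ, eO ((1 + |(|τ| - ‖ξ‖)|) ^ (-θ)) * (eO (wgt s θ τ ξ) * ‖U (τ, ξ)‖ₑ) := by
    rw [← lintegral_const_mul _ fz]
    congr 1; ext τ
    rw [← mul_assoc, ← oM (Real.rpow_nonneg (hp τ).le _)]
    congr 2
    unfold wgt
    rw [mul_left_comm, ← Real.rpow_add (hp τ)]; simp
  have h3 := CS_lint (μ := volume) (f := fun τ : ℝ => eO ((1 + |(|τ| - ‖ξ‖)|) ^ (-θ)))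
    (g := fun τ => eO (wgt s θ τ ξ) * ‖U (τ, ξ)‖ₑ) (Measurable.aemeasurable fz) (Measurable.aemeasurable fz)
  have h4 : eO ((1 + ‖ξ‖ ^ 2) ^ s) = eO ((1 + ‖ξ‖ ^ 2) ^ (s / 2)) ^ 2 := by
    rw [← ENNReal.ofReal_pow pz, ← Real.rpow_natCast ((1 + ‖ξ‖ ^ 2) ^ (s / 2)), ← Real.rpow_mul pz]
    norm_num
  rw [h4, ← mul_pow]
  calc _ ≤ (eO ((1 + ‖ξ‖ ^ 2) ^ (s / 2)) * ∫⁻ τ : ℝ, ‖U (τ, ξ)‖ₑ) ^ 2 :=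
        pow_le_pow_left' (MLR h1 _) 2
    _ ≤ _ := by rw [h2]
    _ ≤ _ := h3
    _ ≤ _ := by
      refine MLL ?_ _
      refine le_trans (le_of_eq ?_) (wave_lint hθ ‖ξ‖ (norm_nonneg _))
      congr 1; ext τ
      rw [← ENNReal.ofReal_pow (Real.rpow_nonneg (hp τ).le _), ← Real.rpow_natCast, ← Real.rpow_mul (hp τ).le]
      congr 2; push_cast; ring

lemma wE_eq (s θ : ℝ) {U : WC} (hU : Measurable U) {E : Set V2} (hE : MeasurableSet E) :
    wE s θ U E = ∫⁻ ξ in E, ∫⁻ τ : ℝ, (eO (wgt s θ τ ξ) * ‖U (τ, ξ)‖ₑ) ^ 2 := by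
  have hw : Measurable fun q : ℝ × V2 => wgt s θ q.1 q.2 := by unfold wgt; fun_prop
  unfold wE
  have : (Prod.snd ⁻¹' E : Set (ℝ × V2)) = Set.univ ×ˢ E := by ext; simp
  rw [this, Measure.volume_eq_prod, ← Measure.prod_restrict, lintegral_prod_symm _ (Measurable.aemeasurable fz)]
  simp

lemma Gt_L2 {s θ : ℝ} (hθ : 1 / 2 < θ) {U : WC} (hU : Measurable U) (t : ℝ) {E : Set V2} (hE : MeasurableSet E) :
    ∫⁻ ξ in E, eO ((1 + ‖ξ‖ ^ 2) ^ s) * ‖Gt U t ξ‖ₑ ^ 2 ≤ eO (2 * cθ θ) * wE s θ U E := by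
  rw [wE_eq s θ hU hE]
  have hw : Measurable fun q : V2 × ℝ => wgt s θ q.2 q.1 := by unfold wgt; fun_prop
  rw [← lintegral_const_mul' _ _ (by finiteness)]
  exact lintegral_mono fun ξ => Gt_pt hθ hU t ξ

lemma uE_L2 {s θ : ℝ} (hθ : 1 / 2 < θ) {U : WC} (hU : Measurable U) (hUi : Integrable U) (t : ℝ) {E : Set V2}
    (hE : MeasurableSet E) {ρ : ℝ} (hρ : ∀ ξ ∈ E, 1 ≤ ρ * (1 + ‖ξ‖ ^ 2) ^ s) :
    ∫⁻ x, ‖J (E.indicator (Gt U t)) x‖ₑ ^ 2 ≤ eO (4 * π ^ 2 * (2 * cθ θ)) * (eO ρ * wE s θ U E) := by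
  refine (plancherel ((Gt_int hUi t).indicator hE)).trans ?_
  rw [ENNReal.ofReal_mul (p := 4 * π ^ 2) pz, mul_assoc]
  refine MLR ?_ _
  have h : ∫⁻ ξ, ‖E.indicator (Gt U t) ξ‖ₑ ^ 2 ≤ ∫⁻ ξ in E, eO ρ * (eO ((1 + ‖ξ‖ ^ 2) ^ s) * ‖Gt U t ξ‖ₑ ^ 2) := by
    rw [← lintegral_indicator hE]
    apply lintegral_mono; intro ξ
    by_cases hξ : ξ ∈ E
    · simp only [Set.indicator, hξ, if_true]
      rw [← mul_assoc, ← ENNReal.ofReal_mul' pz]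
      have h1 : 1 ≤ eO (ρ * (1 + ‖ξ‖ ^ 2) ^ s) := by
        rw [← ENNReal.ofReal_one]
        exact oLe (hρ ξ hξ)
      calc ‖Gt U t ξ‖ₑ ^ 2 = 1 * ‖Gt U t ξ‖ₑ ^ 2 := (one_mul _).symm
        _ ≤ _ := MLL h1 _
    · simp [Set.indicator, hξ]
  refine h.trans ?_
  rw [lintegral_const_mul' _ _ (by finiteness), mul_left_comm]
  exact MLR (Gt_L2 hθ hU t hE) _

def Wk (θ : ℝ) (c : Fin 2 → ℝ) (μ σ : ℝ) (q : ℝ × V2) : ℝ :=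
  (Cube c μ).indicator (fun ξ => (1 + |q.1 - σ * ‖ξ‖|) ^ (-(2 * θ))) q.2

lemma Wk_meas (θ : ℝ) (c : Fin 2 → ℝ) (μ σ : ℝ) : Measurable (Wk θ c μ σ) := by
  have : Wk θ c μ σ = (Prod.snd ⁻¹' (Cube c μ) : Set (ℝ × V2)).indicator
      (fun q => (1 + |q.1 - σ * ‖q.2‖|) ^ (-(2 * θ))) := by
    ext q; by_cases hq : q.2 ∈ Cube c μ <;> simp [Wk, hq]
  rw [this]
  exact Measurable.indicator fz (measurable_snd (Cube_meas c μ))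

lemma Wk_nonneg (θ : ℝ) (c : Fin 2 → ℝ) (μ σ : ℝ) (q : ℝ × V2) : 0 ≤ Wk θ c μ σ q := by
  unfold Wk
  exact Set.indicator_nonneg (fun _ _ => by positivity) _

lemma Wk_int {θ : ℝ} (hθ : 1 / 2 < θ) (c : Fin 2 → ℝ) (μ σ : ℝ) : Integrable (Wk θ c μ σ) (volume.prod volume) := by
  rw [integrable_prod_iff' (Wk_meas θ c μ σ).aestronglyMeasurable]
  have e : ∀ ξ : V2, (fun τ => Wk θ c μ σ (τ, ξ)) =
      fun τ => (Cube c μ).indicator (fun _ => (1:ℝ)) ξ * (1 + |τ - σ * ‖ξ‖|) ^ (-(2 * θ)) := by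
    intro ξ; ext τ
    by_cases h : ξ ∈ Cube c μ <;> simp [Wk, h]
  constructor
  · refine fall fun ξ => ?_
    rw [e]
    exact ((cθ_int hθ).comp_sub_right (σ * ‖ξ‖)).const_mul _
  · have e2 : (fun ξ => ∫ τ, ‖Wk θ c μ σ (τ, ξ)‖) = fun ξ => (Cube c μ).indicator (fun _ => cθ θ) ξ := by
      ext ξ
      simp_rw [nrn (Wk_nonneg θ c μ σ _)]
      rw [e, integral_const_mul, integral_sub_right_eq_self (fun τ : ℝ => (1 + |τ|) ^ (-(2 * θ)))]
      by_cases h : ξ ∈ Cube c μ <;> simp [h, cθ]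
    rw [e2, integrable_indicator_iff (Cube_meas c μ)]
    exact integrableOn_const (by rw [Cube_vol]; finiteness) (by finiteness)

lemma Wk_ker {θ : ℝ} (hθ : 1 / 2 < θ) {c : Fin 2 → ℝ} {μ N t σ : ℝ} (hσ : |σ| = 1) (x : V2) (hμ : 0 < μ) (hN : 0 < N)
    (j : Fin 2) (hj : ∀ r ∈ Set.Icc (c j) (c j + μ), N / 2 ≤ |r|)
    (hn : ∀ r ∈ Set.Icc (c 0) (c 0 + μ), ∀ y ∈ Set.Icc (c 1) (c 1 + μ), √(r ^ 2 + y ^ 2) ≤ 4 * N) :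
    ‖∫ q : ℝ × V2, ph (t * q.1 + ⟪x, q.2⟫) * (Wk θ c μ σ q : ℂ)‖ ≤
      cθ θ * (200 * μ ^ 2 * (1 + |t| * (μ ^ 2 / N)) ^ (-(1 / 2 : ℝ))) := by
  have hi : Integrable (fun q : ℝ × V2 => ph (t * q.1 + ⟪x, q.2⟫) * (Wk θ c μ σ q : ℂ)) (volume.prod volume) :=
    phmul_integrable fz (Wk_int hθ c μ σ).ofReal
  have h1 : ∫ q : ℝ × V2, ph (t * q.1 + ⟪x, q.2⟫) * (Wk θ c μ σ q : ℂ) =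
      (∫ τ : ℝ, ph (t * τ) * (((1 + |τ|) ^ (-(2 * θ)) : ℝ) : ℂ)) * ∫ ξ in Cube c μ, ph (⟪x, ξ⟫ + (t * σ) * ‖ξ‖) := by
    refine (integral_prod_symm _ hi).trans ?_
    rw [← integral_const_mul, ← integral_indicator (Cube_meas c μ)]
    congr 1; ext ξ
    by_cases h : ξ ∈ Cube c μ
    · simp only [Wk, h, Set.indicator_of_mem]
      rw [← integral_mul_const]
      rw [← integral_sub_right_eq_self (fun τ => ph (t * τ) * (((1 + |τ|) ^ (-(2 * θ)) : ℝ) : ℂ) * ph (⟪x, ξ⟫ + (t * σ) * ‖ξ‖)) (σ * ‖ξ‖)]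
      congr 1; ext τ
      rw [mul_right_comm, ← ph_add]
      congr 2; ring
    · simp [Wk, h]
  rw [h1, norm_mul]
  have h2 : ‖∫ τ : ℝ, ph (t * τ) * (((1 + |τ|) ^ (-(2 * θ)) : ℝ) : ℂ)‖ ≤ cθ θ := by
    refine (norm_integral_le_integral_norm _).trans_eq ?_
    unfold cθ
    congr 1; ext τ
    rw [norm_mul, ph_norm, one_mul, Complex.norm_real, nrn pz]
  refine mul_le_mul h2 ?_ (norm_nonneg _) (cθ_nonneg θ)
  have h3 := cube_ker' (c := c) hμ.le (fun ξ => ⟪x, ξ⟫ + (t * σ) * ‖ξ‖)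
  set y := |t| * (μ ^ 2 / N) with hy
  have hy0 : 0 ≤ y := by positivity
  have e1 : (1 + y) ^ (-(1 / 2 : ℝ)) = (√(1 + y))⁻¹ := by
    rw [Real.rpow_neg pz, Real.sqrt_eq_rpow]
  rw [e1, ← div_eq_mul_inv, le_div_iff₀ pz]
  rcases le_total y 1 with hy1 | hy1
  · have : √(1 + y) ≤ 2 := by rw [Real.sqrt_le_left nz]; linarith
    calc _ ≤ μ ^ 2 * 2 := by gcongr
      _ ≤ _ := by nlinarith [sq_nonneg μ]
  · have ht : t ≠ 0 := by rintro rfl; simp at hy; linarith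
    have ht0 : 0 < |t| := abs_pos.mpr ht
    have h4 := cube_ker (c := c) (t := t * σ) x hμ.le hN (by
      intro h; rcases mul_eq_zero.mp h with h | h
      · exact ht h
      · rw [h] at hσ; simp at hσ) j hj hn
    rw [abs_mul, hσ, mul_one] at h4
    have h5 : √(1 + y) ≤ √2 * √y := by
      rw [← Real.sqrt_mul nz]; apply Real.sqrt_le_sqrt; linarith
    have h6 : √y * √(N / |t|) = μ := by
      rw [← Real.sqrt_mul hy0, hy]
      have : |t| * (μ ^ 2 / N) * (N / |t|) = μ ^ 2 := by field_simp
      rw [this, Real.sqrt_sq hμ.le]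
    have h7 : √2 ≤ 2 := by rw [Real.sqrt_le_left nz]; norm_num
    calc _ ≤ (96 * μ * √(N / |t|)) * (√2 * √y) := by gcongr
      _ = 96 * μ * √2 * (√y * √(N / |t|)) := by ring
      _ = 96 * √2 * μ ^ 2 := by rw [h6]; ring
      _ ≤ _ := by nlinarith [sq_nonneg μ]

lemma young3 {P : ℝ} (hP : 2 < P) {h k : ℝ → EN} (hh : Measurable h) (hk : Measurable k) :
    ∫⁻ z : ℝ × ℝ, h z.1 ^ (1 - 1 / P) * h z.2 ^ (1 - 1 / P) * k (z.1 - z.2) ^ (2 / P) ∂(volume.prod volume) ≤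
      (∫⁻ t, h t) ^ (2 - 2 / P) * (∫⁻ t, k t) ^ (2 / P) := by
  have hP0 : 0 < P := by linarith
  have hP1 : 1 / P < 1 / 2 := by rw [one_div_lt_one_div hP0 nz]; exact hP
  have hP2 : 0 < 1 / P := by positivity
  have e2 : 2 / P = 1 / P + 1 / P := by ring
  set F : Fin 3 → (ℝ × ℝ) → EN := ![fun z => h z.1 * h z.2, fun z => h z.1 * k (z.1 - z.2), fun z => h z.2 * k (z.1 - z.2)] with hF
  set r : Fin 3 → ℝ := ![1 - 2 / P, 1 / P, 1 / P] with hr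
  have H := ENNReal.lintegral_prod_norm_pow_le (μ := (volume : Measure ℝ).prod volume) (f := F) (p := r) Finset.univ
    (by intro i _; fin_cases i <;> simp [hF] <;> exact Measurable.aemeasurable fz)
    (by simp [hr, Fin.sum_univ_three]; ring)
    (by intro i _; fin_cases i <;> simp [hr] <;> first | positivity | linarith)
  simp only [Fin.prod_univ_three, hF, hr, Matrix.cons_val_zero, Matrix.cons_val_one, Matrix.cons_val] at H
  set I := ∫⁻ t, h t with hI
  set K := ∫⁻ t, k t with hK
  have i0 : ∫⁻ z : ℝ × ℝ, h z.1 * h z.2 ∂(volume.prod volume) = I * I := by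
    rw [lintegral_prod_mul hh.aemeasurable hh.aemeasurable]
  have i1 : ∫⁻ z : ℝ × ℝ, h z.1 * k (z.1 - z.2) ∂(volume.prod volume) = I * K := by
    rw [lintegral_prod _ (Measurable.aemeasurable fz), hI, ← lintegral_mul_const _ hh]
    apply lintegral_congr; intro t; dsimp only
    rw [lintegral_const_mul _ fz, lintegral_sub_left_eq_self]
  have i2 : ∫⁻ z : ℝ × ℝ, h z.2 * k (z.1 - z.2) ∂(volume.prod volume) = I * K := by
    rw [lintegral_prod_symm _ (Measurable.aemeasurable fz), hI, ← lintegral_mul_const _ hh]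
    apply lintegral_congr; intro t; dsimp only
    rw [lintegral_const_mul _ fz, lintegral_sub_right_eq_self]
  rw [i0, i1, i2] at H
  have n1 : 0 ≤ 1 - 2 / P := by rw [e2]; linarith
  have expand : ∀ A B D E : EN, (A * B) ^ (1 - 2 / P) * (A * D) ^ (1 / P) * (B * E) ^ (1 / P) =
      A ^ (1 - 1 / P) * B ^ (1 - 1 / P) * (D ^ (1 / P) * E ^ (1 / P)) := by
    intro A B D E
    rw [mrn _ _ n1, mrn _ _ hP2.le, mrn _ _ hP2.le]
    have : 1 - 1 / P = (1 - 2 / P) + 1 / P := by ring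
    rw [this, eRa _ _ n1 hP2.le, eRa _ _ n1 hP2.le]
    ring
  have sq : ∀ A : EN, A ^ (1 / P) * A ^ (1 / P) = A ^ (2 / P) := by
    intro A; rw [e2, eRa _ _ hP2.le hP2.le]
  rw [expand, sq, ← eRa _ _ lz lz] at H
  have e4 : 1 - 1 / P + (1 - 1 / P) = 2 - 2 / P := by ring
  rw [e4] at H
  refine le_trans (le_of_eq ?_) H
  apply lintegral_congr; intro z
  rw [expand, sq]

lemma K_calc {P : ℝ} (hP : 4 < P) {a b : ℝ} (ha : 0 ≤ a) (hb : 0 < b) :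
    (∫⁻ t : ℝ, (eO (a * (1 + |t| * b) ^ (-(1 / 2 : ℝ)))) ^ (P / 2)) ^ (2 / P) =
      eO (a * (b⁻¹) ^ (2 / P)) * (∫⁻ t : ℝ, eO ((1 + |t|) ^ (-(P / 4)))) ^ (2 / P) := by
  have hP0 : 0 < P := by linarith
  have e : ∀ t : ℝ, (eO (a * (1 + |t| * b) ^ (-(1 / 2 : ℝ)))) ^ (P / 2) =
      eO (a ^ (P / 2)) * eO ((1 + |b * t|) ^ (-(P / 4))) := by
    intro t
    rw [ENNReal.ofReal_rpow_of_nonneg pz pz, ← oM pz,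
      Real.mul_rpow ha pz, ← Real.rpow_mul pz, abs_mul, abs_of_pos hb, mul_comm |t| b]
    congr 3; ring
  simp_rw [e]
  rw [lintegral_const_mul _ fz]
  have h2 : ∫⁻ t : ℝ, eO ((1 + |b * t|) ^ (-(P / 4))) =
      eO b⁻¹ * ∫⁻ t : ℝ, eO ((1 + |t|) ^ (-(P / 4))) := by
    have h3 := Real.map_volume_mul_left hb.ne'
    have h4 : ∫⁻ t : ℝ, eO ((1 + |b * t|) ^ (-(P / 4))) =
      ∫⁻ y, eO ((1 + |y|) ^ (-(P / 4))) ∂(Measure.map (b * ·) volume) := by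
      rw [lintegral_map fz fz]
    rw [h4, h3, lintegral_smul_measure, abs_of_pos pz]; rfl
  rw [h2, ← mul_assoc, mrn _ _ pz, ← oM pz,
    ENNReal.ofReal_rpow_of_nonneg pz pz, Real.mul_rpow pz pz,
    ← Real.rpow_mul ha]
  congr 3
  have : P / 2 * (2 / P) = 1 := by field_simp
  rw [this, Real.rpow_one]

lemma tts0 {s θ P : ℝ} (hθ : 1 / 2 < θ) (hP : 4 < P) {U : WC} (hU : Measurable U) (hUi : Integrable U)
    {E : Set V2} (hE : MeasurableSet E) {c : Fin 2 → ℝ} {μ N ρ : ℝ} (hμ : 0 < μ) (hN : 0 < N) (hρ0 : 0 ≤ ρ)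
    (hEc : E ⊆ Cube c μ) (j : Fin 2) (hj : ∀ r ∈ Set.Icc (c j) (c j + μ), N / 2 ≤ |r|)
    (hn : ∀ r ∈ Set.Icc (c 0) (c 0 + μ), ∀ y ∈ Set.Icc (c 1) (c 1 + μ), √(r ^ 2 + y ^ 2) ≤ 4 * N)
    (hρ : ∀ ξ ∈ E, 1 ≤ ρ * (1 + ‖ξ‖ ^ 2) ^ s) {g : ℝ → ℂ} (hg : Integrable g) {X : ℝ → V2} (hX : Measurable X) :
    ‖∫ t, g t * J (E.indicator (Gt U t)) (X t)‖ₑ ^ 2 ≤ wE s θ U E *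
      ∫⁻ z : ℝ × ℝ, ‖g z.1‖ₑ * ‖g z.2‖ₑ * eO (400 * ρ * cθ θ * μ ^ 2 *
        (1 + |z.1 - z.2| * (μ ^ 2 / N)) ^ (-(1 / 2 : ℝ))) ∂(volume.prod volume) := by
  set UE : ℝ × V2 → ℂ := (Prod.snd ⁻¹' E : Set (ℝ × V2)).indicator U with hUE
  have hUEi : Integrable UE := hUi.indicator (measurable_snd hE)
  have hUEm : Measurable UE := hU.indicator (measurable_snd hE)
  set gh : ℝ × V2 → ℂ := fun q => ∫ t, ph (t * q.1 + ⟪X t, q.2⟫) * g t with hgh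
  have fub : ∫ t, g t * J (E.indicator (Gt U t)) (X t) = ∫ q, UE q * gh q := by
    simp_rw [uE_eq hUi hE, ← integral_const_mul]
    rw [integral_integral_swap]
    · congr 1; ext q
      rw [hgh, ← integral_const_mul]
      congr 1; ext t; ring
    · have hi : Integrable (fun z : ℝ × (ℝ × V2) => g z.1 * UE z.2) (volume.prod volume) := hg.mul_prod hUEi
      have := phmul_integrable (w := fun z : ℝ × (ℝ × V2) => z.1 * z.2.1 + ⟪X z.1, z.2.2⟫) fz hi
      refine this.congr (fall fun z => ?_)
      simp only [Function.uncurry]; ring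
  set W : ℝ × V2 → ℝ := fun q => ρ * (Wk θ c μ 1 q + Wk θ c μ (-1) q) with hW
  have hWm : Measurable W := by have := Wk_meas θ c μ 1; have := Wk_meas θ c μ (-1); fun_prop
  have hW0 : ∀ q, 0 ≤ W q := fun q => mul_nonneg hρ0 (add_nonneg (Wk_nonneg _ _ _ _ _) (Wk_nonneg _ _ _ _ _))
  have hWi : Integrable W (volume.prod volume) := ((Wk_int hθ c μ 1).add (Wk_int hθ c μ (-1))).const_mul ρ
  have hwm : Measurable fun q : ℝ × V2 => wgt s θ q.1 q.2 := by unfold wgt; fun_prop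
  have key : ∀ q : ℝ × V2, q.2 ∈ E → 1 ≤ wgt s θ q.1 q.2 * √(W q) := by
    intro q hq
    have hqc := hEc hq
    have b0 : (0:ℝ) < 1 + |(|q.1| - ‖q.2‖)| := by positivity
    have h1 : ρ * (1 + |(|q.1| - ‖q.2‖)|) ^ (-(2 * θ)) ≤ W q := by
      simp only [hW, Wk, hqc, Set.indicator_of_mem]
      refine mlr ?_ hρ0
      have := wave_wt θ q.1 ‖q.2‖ (norm_nonneg _)
      simpa using this
    have h2 : 1 ≤ wgt s θ q.1 q.2 ^ 2 * W q := by
      have e : wgt s θ q.1 q.2 ^ 2 = (1 + ‖q.2‖ ^ 2) ^ s * (1 + |(|q.1| - ‖q.2‖)|) ^ (2 * θ) := by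
        unfold wgt
        rw [mul_pow, ← Real.rpow_mul_natCast pz, ← Real.rpow_mul_natCast pz]
        congr 2 <;> push_cast <;> ring
      calc 1 ≤ ρ * (1 + ‖q.2‖ ^ 2) ^ s := hρ _ hq
        _ = wgt s θ q.1 q.2 ^ 2 * (ρ * (1 + |(|q.1| - ‖q.2‖)|) ^ (-(2 * θ))) := by
          rw [e, Real.rpow_neg b0.le]
          have : (1 + |(|q.1| - ‖q.2‖)|) ^ (2 * θ) ≠ 0 := by positivity
          field_simp
        _ ≤ _ := by gcongr
    have h3 : 0 ≤ wgt s θ q.1 q.2 := by unfold wgt; positivity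
    have h4 := Real.sq_sqrt (hW0 q)
    have h5 := Real.sqrt_nonneg (W q)
    have : (1:ℝ) ≤ (wgt s θ q.1 q.2 * √(W q)) ^ 2 := by rw [mul_pow, h4]; exact h2
    nlinarith [mul_nonneg h3 h5]
  have hghm : AEMeasurable gh volume := by
    have : AEStronglyMeasurable (fun z : (ℝ × V2) × ℝ => ph (z.2 * z.1.1 + ⟪X z.2, z.1.2⟫) * g z.2) (volume.prod volume) := by
      refine AEStronglyMeasurable.mul ?_ hg.aestronglyMeasurable.comp_snd
      exact (ph_meas.comp fz).aestronglyMeasurable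
    exact this.integral_prod_right'.aemeasurable
  have s1 : ‖∫ q, UE q * gh q‖ₑ ≤ ∫⁻ q in (Prod.snd ⁻¹' E : Set (ℝ × V2)),
      (eO (wgt s θ q.1 q.2) * ‖U q‖ₑ) * (eO (√(W q)) * ‖gh q‖ₑ) := by
    refine (enorm_integral_le_lintegral_enorm _).trans ?_
    rw [← lintegral_indicator (measurable_snd hE)]
    apply lintegral_mono; intro q
    by_cases hq : q ∈ (Prod.snd ⁻¹' E : Set (ℝ × V2))
    · simp only [hUE, hq, Set.indicator_of_mem]
      have h1 : 1 ≤ eO (wgt s θ q.1 q.2) * eO (√(W q)) := by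
        rw [← ENNReal.ofReal_mul' (Real.sqrt_nonneg _), ← ENNReal.ofReal_one]
        exact oLe (key q hq)
      calc ‖U q * gh q‖ₑ = 1 * (‖U q‖ₑ * ‖gh q‖ₑ) := by rw [enorm_mul, one_mul]
        _ ≤ (eO (wgt s θ q.1 q.2) * eO (√(W q))) * (‖U q‖ₑ * ‖gh q‖ₑ) := MLL h1 _
        _ = _ := by ring
    · simp [hUE, hq]
  rw [fub]
  refine (pow_le_pow_left' s1 2).trans ((CS_lint (Measurable.aemeasurable fz) ?_).trans ?_)
  · exact (Measurable.aemeasurable fz).mul hghm.enorm.restrict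
  refine mul_le_mul' le_rfl ?_
  refine (setLIntegral_le_lintegral _ _).trans ?_
  have s2 : ∀ q, (eO (√(W q)) * ‖gh q‖ₑ) ^ 2 = eO (W q) * ‖gh q‖ₑ ^ 2 := by
    intro q
    rw [mul_pow, ← ENNReal.ofReal_pow (Real.sqrt_nonneg _), Real.sq_sqrt (hW0 q)]
  simp_rw [s2]
  have s3 := l2dual (μ := (volume : Measure (ℝ × V2))) (ν := (volume : Measure ℝ))
    (w := fun q t => t * q.1 + ⟪X t, q.2⟫) (by unfold Function.uncurry; fun_prop) hW0 hWi hg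
  refine s3.trans ?_
  apply lintegral_mono; intro z
  refine mul_le_mul' le_rfl ?_
  have e3 : ∀ q : ℝ × V2, (z.1 * q.1 + ⟪X z.1, q.2⟫) - (z.2 * q.1 + ⟪X z.2, q.2⟫) =
      (z.1 - z.2) * q.1 + ⟪X z.1 - X z.2, q.2⟫ := by
    intro q; rw [inner_sub_left]; ring
  simp_rw [e3]
  rw [← ofReal_norm]
  apply oLe
  have k1 := Wk_ker (t := z.1 - z.2) (σ := 1) hθ (by simp) (X z.1 - X z.2) hμ hN j hj hn
  have k2 := Wk_ker (t := z.1 - z.2) (σ := -1) hθ (by simp) (X z.1 - X z.2) hμ hN j hj hn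
  have e4 : ∫ q : ℝ × V2, ph ((z.1 - z.2) * q.1 + ⟪X z.1 - X z.2, q.2⟫) * ((W q : ℝ) : ℂ) =
      (ρ : ℂ) * ((∫ q : ℝ × V2, ph ((z.1 - z.2) * q.1 + ⟪X z.1 - X z.2, q.2⟫) * (Wk θ c μ 1 q : ℂ)) +
      ∫ q : ℝ × V2, ph ((z.1 - z.2) * q.1 + ⟪X z.1 - X z.2, q.2⟫) * (Wk θ c μ (-1) q : ℂ)) := by
    rw [← integral_add, ← integral_const_mul]
    · congr 1; ext q; simp only [hW]; push_cast; ring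
    · exact phmul_integrable fz (Wk_int hθ c μ 1).ofReal
    · exact phmul_integrable fz (Wk_int hθ c μ (-1)).ofReal
  rw [e4, norm_mul, Complex.norm_real, nrn hρ0]
  calc _ ≤ ρ * (_ + _) := mlr ((norm_add_le _ _).trans (add_le_add k1 k2)) hρ0
    _ = _ := by ring

def cP (P : ℝ) : EN := ∫⁻ t : ℝ, eO ((1 + |t|) ^ (-(P / 4)))

lemma cP_ne_top {P : ℝ} (hP : 4 < P) : cP P ≠ ⊤ := by
  have := integrable_one_add_norm (E := ℝ) (μ := volume) (r := P / 4) (by simp; linarith)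
  have h := this.lintegral_lt_top
  simp only [Real.norm_eq_abs] at h
  exact h.ne

lemma tts_dual {P : ℝ} (hP : 4 < P) {v : ℝ → ℂ} (hvm : Measurable v) {B : ℝ} (hvb : ∀ t, ‖v t‖ ≤ B) (hB0 : 0 ≤ B)
    {W D : EN} {K b : ℝ} (hK : 0 ≤ K) (hb : 0 < b)
    (hD : D = W * (eO (K * (b⁻¹) ^ (2 / P)) * cP P ^ (2 / P)))
    (tt : ∀ g : ℝ → ℂ, Integrable g → ‖∫ t, g t * v t‖ₑ ^ 2 ≤ W *
      ∫⁻ z : ℝ × ℝ, ‖g z.1‖ₑ * ‖g z.2‖ₑ * eO (K *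
        (1 + |z.1 - z.2| * b) ^ (-(1 / 2 : ℝ))) ∂(volume.prod volume)) :
    (∫⁻ t, ‖v t‖ₑ ^ P) ^ (2 / P) ≤ D := by
  have hP0 : 0 < P := by linarith
  have main : ∀ R : ℕ, (∫⁻ t in Set.Icc (-(R:ℝ)) R, ‖v t‖ₑ ^ P) ^ (2 / P) ≤ D := by
    intro R
    set S := Set.Icc (-(R:ℝ)) R with hS
    have Sm : MeasurableSet S := measurableSet_Icc
    have Sf : volume S ≠ ⊤ := by simp [hS]
    set g : ℝ → ℂ := S.indicator fun t => ((‖v t‖ ^ (P - 2) : ℝ) : ℂ) * (starRingEnd ℂ) (v t) with hg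
    set h : ℝ → EN := S.indicator fun t => ‖v t‖ₑ ^ P with hh
    have hgm : Measurable g := Measurable.indicator (by
      have : Measurable fun t => (starRingEnd ℂ) (v t) := Complex.continuous_conj.measurable.comp hvm
      fun_prop) Sm
    have hhm : Measurable h := Measurable.indicator fz Sm
    have hgi : Integrable g := by
      rw [hg, integrable_indicator_iff Sm]
      refine Measure.integrableOn_of_bounded (M := B ^ (P - 2) * B) Sf ?_ ?_
      · have : Measurable fun t => (starRingEnd ℂ) (v t) := Complex.continuous_conj.measurable.comp hvm
        exact Measurable.aestronglyMeasurable fz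
      · refine fall fun t => ?_
        rw [norm_mul, Complex.norm_real, nrn pz, RCLike.norm_conj]
        exact mul_le_mul (Real.rpow_le_rpow (norm_nonneg _) (hvb t) lz) (hvb t) (norm_nonneg _) pz
    have hge : ∀ t, ‖g t‖ₑ = h t ^ (1 - 1 / P) := by
      intro t
      have p1 : 0 < 1 - 1 / P := by
        have : 1 / P < 1 := by rw [div_lt_one hP0]; linarith
        linarith
      by_cases ht : t ∈ S
      · simp only [hg, hh, ht, Set.indicator_of_mem]
        rw [← eRm, ← ofReal_norm, norm_mul, Complex.norm_real, nrn pz,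
          RCLike.norm_conj, ← ofReal_norm, ENNReal.ofReal_rpow_of_nonneg (norm_nonneg _) pz]
        congr 1
        have : P * (1 - 1 / P) = (P - 2) + 1 := by field_simp; ring
        rw [this, Real.rpow_add_of_nonneg (norm_nonneg _) lz nz, Real.rpow_one]
      · rw [hg, hh, Set.indicator_of_notMem ht, Set.indicator_of_notMem ht, ENNReal.zero_rpow_of_pos p1, enorm_zero]
    have hI : ‖∫ t, g t * v t‖ₑ = ∫⁻ t, h t := by
      have e : ∀ t, g t * v t = ((S.indicator (fun t => ‖v t‖ ^ P) t : ℝ) : ℂ) := by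
        intro t
        by_cases ht : t ∈ S
        · simp only [hg, ht, Set.indicator_of_mem]
          rw [mul_assoc, Complex.conj_mul']
          have : ‖v t‖ ^ P = ‖v t‖ ^ (P - 2) * ‖v t‖ ^ 2 := by
            rw [← Real.rpow_natCast, ← Real.rpow_add_of_nonneg (norm_nonneg _) lz nz]
            congr 1; push_cast; ring
          rw [this]; push_cast; ring
        · simp [hg, ht]
      have n0 : ∀ t, 0 ≤ S.indicator (fun t => ‖v t‖ ^ P) t := fun t => Set.indicator_nonneg (fun _ _ => by positivity) _
      simp_rw [e]
      rw [integral_complex_ofReal, ← ofReal_norm, Complex.norm_real, nrn (integral_nonneg n0)]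
      rw [ofReal_integral_eq_lintegral_ofReal]
      · apply lintegral_congr; intro t
        by_cases ht : t ∈ S
        · simp only [hh, ht, Set.indicator_of_mem]
          rw [← ENNReal.ofReal_rpow_of_nonneg (norm_nonneg _) hP0.le, ofReal_norm]
        · simp [hh, ht]
      · rw [integrable_indicator_iff Sm]
        refine Measure.integrableOn_of_bounded (M := B ^ P) Sf (Measurable.aestronglyMeasurable fz) ?_
        refine fall fun t => ?_
        rw [nrn pz]
        exact Real.rpow_le_rpow (norm_nonneg _) (hvb t) lz
      · exact fall n0
    have hIf : ∫⁻ t, h t ≠ ⊤ := by rw [← hI]; finiteness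
    have t0 := tt g hgi
    rw [hI] at t0
    have t1 := young3 (P := P) lz hhm (k := fun t => (eO (K *
        (1 + |t| * b) ^ (-(1 / 2 : ℝ)))) ^ (P / 2)) fz
    rw [K_calc hP hK hb] at t1
    have t2 : ∀ t, ((eO (K *
        (1 + |t| * b) ^ (-(1 / 2 : ℝ)))) ^ (P / 2)) ^ (2 / P) = eO (K *
        (1 + |t| * b) ^ (-(1 / 2 : ℝ))) := by
      intro t
      rw [← eRm]
      have : P / 2 * (2 / P) = 1 := by field_simp
      rw [this, eR1]
    simp_rw [t2] at t1
    simp_rw [hge] at t0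
    have t3 := t0.trans (MLR t1 _)
    set I := ∫⁻ t, h t with hIdef
    rw [← lintegral_indicator Sm]
    change I ^ (2 / P) ≤ D
    rcases eq_or_ne I 0 with h0 | h0
    · rw [h0, ENNReal.zero_rpow_of_pos pz]; exact zero_le
    · have t4 : I ^ (2 - 2 / P) * I ^ (2 / P) ≤ I ^ (2 - 2 / P) * D := by
        rw [← ENNReal.rpow_add _ _ h0 hIf]
        have : 2 - 2 / P + 2 / P = 2 := by ring
        rw [this, eR2]
        refine t3.trans_eq ?_
        rw [hD]; unfold cP; ring
      rwa [ENNReal.mul_le_mul_iff_right] at t4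
      · simp [h0, hIf]
      · exact ENNReal.rpow_ne_top_of_ne_zero h0 hIf
  have un : ∫⁻ t, ‖v t‖ₑ ^ P = ⨆ R : ℕ, ∫⁻ t in Set.Icc (-(R:ℝ)) R, ‖v t‖ₑ ^ P := by
    rw [← setLIntegral_iUnion_of_directed]
    · have : (⋃ R : ℕ, Set.Icc (-(R:ℝ)) R) = Set.univ := by
        ext t; simp only [Set.mem_iUnion, Set.mem_univ, iff_true]
        obtain ⟨n, hn⟩ := exists_nat_ge |t|
        exact ⟨n, abs_le.mp hn⟩
      rw [this, setLIntegral_univ]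
    · refine Monotone.directed_le (f := fun R : ℕ => Set.Icc (-(R:ℝ)) R) ?_
      intro a b hab
      have : (a:ℝ) ≤ b := by exact_mod_cast hab
      exact Set.Icc_subset_Icc lz this
  rw [un]
  have := (ENNReal.orderIsoRpow (2 / P) pz).map_iSup (fun R : ℕ => ∫⁻ t in Set.Icc (-(R:ℝ)) R, ‖v t‖ₑ ^ P)
  simp only [ENNReal.orderIsoRpow_apply] at this
  rw [this]
  exact iSup_le main

lemma tts1 {s θ P : ℝ} (hθ : 1 / 2 < θ) (hP : 4 < P) {U : WC} (hU : Measurable U) (hUi : Integrable U)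
    {E : Set V2} (hE : MeasurableSet E) {c : Fin 2 → ℝ} {μ N ρ : ℝ} (hμ : 0 < μ) (hN : 0 < N) (hρ0 : 0 ≤ ρ)
    (hEc : E ⊆ Cube c μ) (j : Fin 2) (hj : ∀ r ∈ Set.Icc (c j) (c j + μ), N / 2 ≤ |r|)
    (hn : ∀ r ∈ Set.Icc (c 0) (c 0 + μ), ∀ y ∈ Set.Icc (c 1) (c 1 + μ), √(r ^ 2 + y ^ 2) ≤ 4 * N)
    (hρ : ∀ ξ ∈ E, 1 ≤ ρ * (1 + ‖ξ‖ ^ 2) ^ s) {X : ℝ → V2} (hX : Measurable X) :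
    (∫⁻ t, ‖J (E.indicator (Gt U t)) (X t)‖ₑ ^ P) ^ (2 / P) ≤ wE s θ U E *
      (eO (400 * ρ * cθ θ * μ ^ 2 * (N / μ ^ 2) ^ (2 / P)) * cP P ^ (2 / P)) := by
  have c0 := cθ_nonneg θ
  have hvm : Measurable fun t => J (E.indicator (Gt U t)) (X t) := by
    have h1 : Measurable fun t : ℝ => (t, X t) := by fun_prop
    have h0 := (uE_cont hUi hE).measurable
    have h2 := h0.comp h1
    simp only [Function.comp_def] at h2
    exact h2
  have hvb : ∀ t, ‖J (E.indicator (Gt U t)) (X t)‖ ≤ ∫ q : ℝ × V2, ‖(Prod.snd ⁻¹' E : Set (ℝ × V2)).indicator U q‖ := by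
    intro t
    rw [uE_eq hUi hE]
    refine (norm_integral_le_integral_norm _).trans_eq ?_
    refine integral_congr_ae (fall fun q => ?_)
    dsimp only
    rw [norm_mul, ph_norm, one_mul]
  have hK : 0 ≤ 400 * ρ * cθ θ * μ ^ 2 := by positivity
  have hb : 0 < μ ^ 2 / N := by positivity
  have e := tts_dual hP hvm hvb (integral_nonneg fun _ => norm_nonneg _) hK hb rfl
    (fun g hg => tts0 (s := s) hθ hP hU hUi hE hμ hN hρ0 hEc j hj hn hρ hg hX)
  rw [inv_div] at e
  exact e

lemma tts {s θ P : ℝ} (hθ : 1 / 2 < θ) (hP : 4 < P) {U : WC} (hU : Measurable U) (hUi : Integrable U)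
    {E : Set V2} (hE : MeasurableSet E) {c : Fin 2 → ℝ} {μ N ρ : ℝ} (hμ : 0 < μ) (hN : 0 < N) (hμN : μ ≤ N / 8) (hρ0 : 0 ≤ ρ)
    (hEc : E ⊆ Cube c μ) (hEN : ∀ ξ ∈ E, N ≤ ‖ξ‖ ∧ ‖ξ‖ ≤ 2 * N)
    (hρ : ∀ ξ ∈ E, 1 ≤ ρ * (1 + ‖ξ‖ ^ 2) ^ s) :
    (∫⁻ t, (⨆ x, ‖J (E.indicator (Gt U t)) x‖ₑ) ^ P) ^ (2 / P) ≤ 4 * (wE s θ U E *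
      (eO (400 * ρ * cθ θ * μ ^ 2 * (N / μ ^ 2) ^ (2 / P)) * cP P ^ (2 / P))) := by
  have hP0 : 0 < P := by linarith
  rcases E.eq_empty_or_nonempty with rfl | ⟨ξ0, hξ0⟩
  · have : ∀ t x, J ((∅ : Set V2).indicator (Gt U t)) x = 0 := by intro t x; simp [J]
    simp_rw [this]
    simp [hP0]
  obtain ⟨⟨j, hj⟩, hn⟩ := cube_geom hμ.le hN hμN (hEc hξ0) (hEN _ hξ0).1 (hEN _ hξ0).2
  set v : ℝ → V2 → ℂ := fun t x => J (E.indicator (Gt U t)) x with hv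
  have hvc := uE_cont hUi hE
  have vc : ∀ t, Continuous (v t) := fun t => J_cont ((Gt_int hUi t).indicator hE)
  set d := TopologicalSpace.denseSeq V2 with hd
  have sup_eq : ∀ t, (⨆ x, ‖v t x‖ₑ) = ⨆ n, ‖v t (d n)‖ₑ := by
    intro t
    refine le_antisymm (iSup_le fun x => ?_) (iSup_le fun n => le_iSup (fun x => ‖v t x‖ₑ) (d n))
    have hcl : IsClosed {x | ‖v t x‖ₑ ≤ ⨆ n, ‖v t (d n)‖ₑ} := isClosed_le (vc t).enorm continuous_const
    have := (TopologicalSpace.denseRange_denseSeq V2).closure_eq ▸ (closure_minimal (s := Set.range d) (by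
      rintro _ ⟨n, rfl⟩; exact le_iSup (fun n => ‖v t (d n)‖ₑ) n) hcl)
    exact this (Set.mem_univ x)
  have hm : ∀ n, Measurable fun t => ‖v t (d n)‖ₑ := fun n =>
    (hvc.measurable.comp (measurable_id.prodMk measurable_const)).enorm
  have hsm : Measurable fun t => ⨆ n, ‖v t (d n)‖ₑ := Measurable.iSup hm
  have hex : ∀ t, ∃ n, (⨆ n, ‖v t (d n)‖ₑ) ≤ 2 * ‖v t (d n)‖ₑ := by
    intro t
    set S := ⨆ n, ‖v t (d n)‖ₑ with hS
    have hSf : S ≠ ⊤ := by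
      refine ne_top_of_le_ne_top (b := ∫⁻ ξ, ‖E.indicator (Gt U t) ξ‖ₑ) ?_ (iSup_le fun n => J_enorm_le _ _)
      exact ((Gt_int hUi t).indicator hE).2.ne
    by_contra hc
    push Not at hc
    have h1 : S ≤ S / 2 := iSup_le fun n => by
      rw [ENNReal.le_div_iff_mul_le (by simp) (by simp), mul_comm]; exact (hc n).le
    have h0 : S ≠ 0 := fun h => by have := hc 0; rw [h] at this; simp at this
    exact absurd h1 (not_le.mpr (ENNReal.half_lt_self h0 hSf))
  classical
  have hX : Measurable fun t => d (Nat.find (hex t)) :=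
    Measurable.find (f := fun n _ => d n) (fun n => measurable_const)
      (fun n => measurableSet_le hsm ((hm n).const_mul 2)) hex
  have key := tts1 hθ hP hU hUi hE hμ hN hρ0 hEc j hj hn hρ hX
  calc _ ≤ (∫⁻ t, (2 * ‖v t (d (Nat.find (hex t)))‖ₑ) ^ P) ^ (2 / P) := by
        refine rle (lintegral_mono fun t => rle ?_ hP0.le) pz
        rw [sup_eq]; exact Nat.find_spec (hex t)
    _ = 4 * (∫⁻ t, ‖v t (d (Nat.find (hex t)))‖ₑ ^ P) ^ (2 / P) := by
        simp_rw [mrn _ _ hP0.le]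
        rw [lintegral_const_mul' _ _ (by simp [hP0.le]), mrn _ _ pz, ← eRm]
        have : P * (2 / P) = 2 := by field_simp
        rw [this]; norm_num
    _ ≤ _ := MLR key _

open scoped FourierTransform in
lemma fourier_ftST (u : SchwartzMap (ℝ × V2) ℂ) : ∃ F : SchwartzMap (WithLp 2 (ℝ × V2)) ℂ,
    (∀ p, F p = u p.ofLp) ∧ ∀ w, (𝓕 F) w = ftST u (2 * π * w.ofLp.1) ((2 * π) • w.ofLp.2) := by
  refine ⟨SchwartzMap.compCLMOfContinuousLinearEquiv ℂ (WithLp.prodContinuousLinearEquiv 2 ℝ ℝ V2) u, fun p => rfl, fun w => ?_⟩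
  rw [SchwartzMap.fourier_coe, Real.fourier_eq']
  unfold ftST
  have := (WithLp.volume_preserving_ofLp ℝ V2).integral_comp (MeasurableEquiv.toLp 2 (ℝ × V2)).symm.measurableEmbedding
    (fun p : ℝ × V2 => Complex.exp (-Complex.I * ((p.1 * (2 * π * w.ofLp.1) + ⟪p.2, (2 * π) • w.ofLp.2⟫ : ℝ) : ℂ)) * u p)
  rw [← this]
  congr 1; ext v
  rw [smul_eq_mul, WithLp.prod_inner_apply, real_inner_smul_right]
  refine congrArg₂ (· * ·) (congrArg Complex.exp ?_) rfl
  simp only [RCLike.inner_apply, conj_trivial]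
  push_cast; ring

def Us (u : WC) (q : ℝ × V2) : ℂ := ((((2 * π) ^ 3)⁻¹ : ℝ) : ℂ) * ftST u q.1 q.2

lemma Us_facts (u : SchwartzMap (ℝ × V2) ℂ) : Continuous (Us u) ∧ Integrable (Us u) ∧
    ∀ t x, J (Gt (Us u) t) x = u (t, x) := by
  obtain ⟨F, hF, hF2⟩ := fourier_ftST u
  open scoped FourierTransform in
  set G := 𝓕 F with hG
  have e1 : ∀ q, Us u q = ((((2 * π) ^ 3)⁻¹ : ℝ) : ℂ) * G (WithLp.toLp 2 ((2 * π)⁻¹ • q)) := by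
    intro q
    rw [hF2]
    have h1 : 2 * π * ((2 * π)⁻¹ * q.1) = q.1 := by field_simp
    have h2 : (2 * π) • ((2 * π)⁻¹ • q.2) = q.2 := by rw [smul_smul, mul_inv_cancel₀ pz, one_smul]
    simp only [Prod.smul_fst, Prod.smul_snd, smul_eq_mul, h1, h2]
    rfl
  have e2 : Us u = fun q => ((((2 * π) ^ 3)⁻¹ : ℝ) : ℂ) * G (WithLp.toLp 2 ((2 * π)⁻¹ • q)) := funext e1
  have hfin : Module.finrank ℝ (ℝ × V2) = 3 := by simp
  haveI : (volume : Measure (ℝ × V2)).IsAddHaarMeasure := Measure.prod.instIsAddHaarMeasure volume volume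
  have hGi : Integrable (fun q : ℝ × V2 => G (WithLp.toLp 2 q)) :=
    (WithLp.volume_preserving_toLp ℝ V2).integrable_comp_of_integrable G.integrable
  have hi : Integrable (Us u) := by
    rw [e2]
    exact (hGi.comp_smul (R := (2 * π)⁻¹) pz).const_mul _
  refine ⟨?_, hi, fun t x => ?_⟩
  · rw [e2]
    have : Continuous fun q : ℝ × V2 => WithLp.toLp 2 ((2 * π)⁻¹ • q) := by fun_prop
    exact continuous_const.mul (G.continuous.comp this)
  · have h0 := uE_eq hi MeasurableSet.univ t x
    simp only [Set.indicator_univ, Set.preimage_univ] at h0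
    rw [h0]
    have hinv : F (WithLp.toLp 2 (t, x)) = u (t, x) := hF _
    rw [← hinv]
    open scoped FourierTransform in
    have h1 : (𝓕⁻ G) (WithLp.toLp 2 (t, x)) = F (WithLp.toLp 2 (t, x)) := by rw [hG]; simp
    rw [← h1, SchwartzMap.fourierInv_coe, Real.fourierInv_eq']
    have h2 := (WithLp.volume_preserving_toLp ℝ V2).integral_comp (MeasurableEquiv.toLp 2 (ℝ × V2)).measurableEmbedding
      (fun v : WithLp 2 (ℝ × V2) => Complex.exp (((2 * π * ⟪v, WithLp.toLp 2 (t, x)⟫ : ℝ) : ℂ) * Complex.I) • G v)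
    rw [← h2]
    have h3 := Measure.integral_comp_smul (volume : Measure (ℝ × V2))
      (fun q => Complex.exp (((2 * π * ⟪WithLp.toLp 2 q, WithLp.toLp 2 (t, x)⟫ : ℝ) : ℂ) * Complex.I) • G (WithLp.toLp 2 q)) (2 * π)⁻¹
    rw [hfin, inv_pow, inv_inv, abs_of_pos pz] at h3
    have h4 : (((((2 * π) ^ 3)⁻¹ : ℝ)) : ℂ) * (((2 * π) ^ 3 : ℝ) : ℂ) = 1 := by
      rw [← Complex.ofReal_mul, inv_mul_cancel₀ pz]; simp
    set I := ∫ q : ℝ × V2, Complex.exp (((2 * π * ⟪WithLp.toLp 2 q, WithLp.toLp 2 (t, x)⟫ : ℝ) : ℂ) * Complex.I) • G (WithLp.toLp 2 q) with hI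
    have h5 : I = ((((2 * π) ^ 3)⁻¹ : ℝ) : ℂ) * (((2 * π) ^ 3 : ℝ) • I) := by
      rw [Complex.real_smul, ← mul_assoc, h4, one_mul]
    rw [h5, ← h3, ← integral_const_mul]
    congr 1; ext q
    rw [e1, WithLp.prod_inner_apply]
    simp only [RCLike.inner_apply, conj_trivial, Prod.smul_fst, Prod.smul_snd, smul_eq_mul, real_inner_smul_left]
    unfold ph
    have h6 : ((t * q.1 + ⟪x, q.2⟫ : ℝ) : ℂ) = ((2 * π * (t * ((2 * π)⁻¹ * q.1) + (2 * π)⁻¹ * ⟪q.2, x⟫) : ℝ) : ℂ) := by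
      congr 1
      rw [real_inner_comm x]
      field_simp
    rw [h6]
    ring_nf

lemma wE_HN (s θ : ℝ) (u : WC) : wE s θ (Us u) Set.univ =
    eO ((((2 * π) ^ 3)⁻¹) ^ 2) * HN s θ u ^ 2 := by
  unfold wE HN
  rw [← eR2, ← eRm]
  norm_num only
  rw [eR1, ← lintegral_const_mul' _ _ (by simp), Set.preimage_univ, Measure.restrict_univ]
  congr 1; ext q
  unfold Us
  rw [enorm_mul, ← ofReal_norm, Complex.norm_real, nrn pz,
    ENNReal.ofReal_pow pz]
  simp only [enorm_eq_nnnorm]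
  ring

def chiB : ContDiffBump (0 : V2) := ⟨1, 2, by norm_num, by norm_num⟩
def chi (ζ : V2) : ℝ := chiB ζ
def psi (ζ : V2) : ℝ := chi ζ - chi (tw • ζ)

lemma chi_one {ζ : V2} (h : ‖ζ‖ ≤ 1) : chi ζ = 1 :=
  chiB.one_of_mem_closedBall (by simpa [chiB] using h)
lemma chi_zero {ζ : V2} (h : 2 ≤ ‖ζ‖) : chi ζ = 0 :=
  chiB.zero_of_le_dist (by simpa [chiB] using h)
lemma chi_nonneg (ζ : V2) : 0 ≤ chi ζ := chiB.nonneg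
lemma chi_le (ζ : V2) : chi ζ ≤ 1 := chiB.le_one
lemma chi_smooth : ContDiff ℝ (⊤ : ℕ∞) chi := chiB.contDiff
lemma chi_cont : Continuous chi := chi_smooth.continuous
lemma psi_smooth : ContDiff ℝ (⊤ : ℕ∞) psi :=
  chi_smooth.sub (chi_smooth.comp (contDiff_const_smul _))
lemma psi_cont : Continuous psi := psi_smooth.continuous
lemma psi_abs (ζ : V2) : |psi ζ| ≤ 1 := by
  unfold psi
  rw [abs_le]; constructor <;> linarith [chi_nonneg ζ, chi_le ζ, chi_nonneg (tw • ζ), chi_le (tw • ζ)]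
lemma psi_lo {ζ : V2} (h : ‖ζ‖ ≤ 1 / 2) : psi ζ = 0 := by
  unfold psi
  rw [chi_one lz, chi_one (by rw [norm_smul]; norm_num; linarith), sub_self]
lemma psi_hi {ζ : V2} (h : 2 ≤ ‖ζ‖) : psi ζ = 0 := by
  unfold psi
  rw [chi_zero h, chi_zero (by rw [norm_smul]; norm_num; linarith), sub_self]

lemma norm_sc (k : ℤ) (ξ : V2) : ‖(tw ^ (-k)) • ξ‖ = tw ^ (-k) * ‖ξ‖ := by
  rw [norm_smul, nrn pz]

lemma chi_ker : ∃ κ, IsKer κ (fun ζ => (chi ζ : ℂ)) := by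
  refine exists_ker ?_ (Complex.ofRealCLM.contDiff.comp chi_smooth)
  refine HasCompactSupport.intro (isCompact_closedBall (0:V2) 2) fun ζ hζ => ?_
  rw [mem_closedBall_zero_iff, not_le] at hζ
  rw [chi_zero hζ.le]; simp

lemma psi_ker {m : VC} (hm : ∀ ζ, ζ ≠ 0 → ContDiffAt ℝ (⊤ : ℕ∞) m ζ) :
    ∃ κ, IsKer κ (fun ζ => m ζ * (psi ζ : ℂ)) := by
  refine exists_ker ?_ ?_
  · refine HasCompactSupport.intro (isCompact_closedBall (0:V2) 2) fun ζ hζ => ?_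
    rw [mem_closedBall_zero_iff, not_le] at hζ
    rw [psi_hi hζ.le]; simp
  · rw [contDiff_iff_contDiffAt]
    intro ζ
    rcases eq_or_ne ζ 0 with rfl | h
    · have : (fun ζ => m ζ * (psi ζ : ℂ)) =ᶠ[nhds 0] fun _ => 0 := by
        filter_upwards [Metric.ball_mem_nhds (0:V2) (ε := 1 / 2) nz] with ζ hζ
        rw [mem_ball_zero_iff] at hζ
        rw [psi_lo hζ.le]; simp
      exact contDiffAt_const.congr_of_eventuallyEq this
    · exact (hm ζ h).mul (Complex.ofRealCLM.contDiff.comp psi_smooth).contDiffAt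

lemma bmul_int {G : VC} (hG : Integrable G) {m : V2 → ℝ} (hm : Continuous m) (hb : ∀ ξ, |m ξ| ≤ 1) :
    Integrable fun ξ => (m ξ : ℂ) * G ξ :=
  hG.bdd_mul (c := 1) (Continuous.aestronglyMeasurable fz)
    (fall fun ξ => by rw [Complex.norm_real]; exact hb ξ)

lemma J_sub {G1 G2 : VC} (h1 : Integrable G1) (h2 : Integrable G2) (x : V2) :
    J (fun ξ => G1 ξ - G2 ξ) x = J G1 x - J G2 x := by
  unfold J
  rw [← integral_sub (phmul_integrable (Continuous.aestronglyMeasurable fz) h1) (phmul_integrable (Continuous.aestronglyMeasurable fz) h2)]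
  congr 1; ext ξ; ring

lemma J_add {G1 G2 : VC} (h1 : Integrable G1) (h2 : Integrable G2) (x : V2) :
    J (fun ξ => G1 ξ + G2 ξ) x = J G1 x + J G2 x := by
  unfold J
  rw [← integral_add (phmul_integrable (Continuous.aestronglyMeasurable fz) h1) (phmul_integrable (Continuous.aestronglyMeasurable fz) h2)]
  congr 1; ext ξ; ring

lemma J_const_mul (c : ℂ) (G : VC) (x : V2) : J (fun ξ => c * G ξ) x = c * J G x := by
  unfold J
  rw [← integral_const_mul]
  congr 1; ext ξ; ring

lemma chik_int {G : VC} (hG : Integrable G) (k : ℤ) :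
    Integrable fun ξ => (chi (tw ^ (-k) • ξ) : ℂ) * G ξ :=
  bmul_int hG (m := fun ξ => chi (tw ^ (-k) • ξ)) (chi_cont.comp fz)
    (fun ξ => by rw [abs_of_nonneg (chi_nonneg _)]; exact chi_le _)

lemma psik_int {G : VC} (hG : Integrable G) (k : ℤ) :
    Integrable fun ξ => (psi (tw ^ (-k) • ξ) : ℂ) * G ξ :=
  bmul_int hG (m := fun ξ => psi (tw ^ (-k) • ξ)) (psi_cont.comp fz) (fun ξ => psi_abs _)

lemma two_zpow_neg_nat (x : ℝ) : Filter.Tendsto (fun n : ℕ => tw ^ (-(n:ℤ)) * x) Filter.atTop (nhds 0) := by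
  have h := (tendsto_pow_atTop_nhds_zero_of_lt_one (r := (1/2:ℝ)) nz nz).mul_const x
  rw [zero_mul] at h
  refine h.congr fun n => ?_
  rw [zpow_neg, zpow_natCast, one_div, inv_pow]

lemma LP_hi {G : VC} (hG : Integrable G) (K : ℤ) (x : V2) :
    ‖J G x - J (fun ξ => (chi (tw ^ (-K) • ξ) : ℂ) * G ξ) x‖ₑ ≤
      ∑' i : ℕ, ‖J (fun ξ => (psi (tw ^ (-(K + 1 + i)) • ξ) : ℂ) * G ξ) x‖ₑ := by
  set T : ℕ → ℂ := fun m => J (fun ξ => (chi (tw ^ (-(K + m)) • ξ) : ℂ) * G ξ) x with hT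
  have hstep : ∀ m : ℕ, J (fun ξ => (psi (tw ^ (-(K + 1 + m)) • ξ) : ℂ) * G ξ) x = T (m + 1) - T m := by
    intro m
    rw [hT]; dsimp only
    rw [← J_sub (chik_int hG _) (chik_int hG _)]
    congr 1; ext ξ
    have e1 : (K + 1 + m : ℤ) = K + ((m + 1 : ℕ) : ℤ) := by push_cast; ring
    unfold psi
    rw [smul_smul, e1]
    have e2 : tw * 2 ^ (-(K + ((m + 1 : ℕ) : ℤ))) = 2 ^ (-(K + m)) := by
      rw [← zpow_one_add₀ nz]; congr 1; push_cast; ring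
    rw [e2]; push_cast; ring
  have hsum : ∀ m : ℕ, ‖T m - T 0‖ₑ ≤ ∑' i : ℕ, ‖J (fun ξ => (psi (tw ^ (-(K + 1 + i)) • ξ) : ℂ) * G ξ) x‖ₑ := by
    intro m
    rw [← Finset.sum_range_sub]
    refine (enorm_sum_le _ _).trans ?_
    refine le_trans (le_of_eq ?_) (ENNReal.sum_le_tsum (Finset.range m))
    refine Finset.sum_congr rfl fun i _ => ?_
    rw [hstep]
  have hlim : Filter.Tendsto T Filter.atTop (nhds (J G x)) := by
    rw [hT]
    unfold J
    refine tendsto_integral_of_dominated_convergence (fun ξ => ‖G ξ‖) ?_ hG.norm ?_ ?_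
    · intro m
      exact (phmul_integrable (Continuous.aestronglyMeasurable fz) (chik_int hG _)).aestronglyMeasurable
    · intro m; refine fall fun ξ => ?_
      rw [norm_mul, norm_mul, ph_norm, one_mul, Complex.norm_real, nrn (chi_nonneg _)]
      exact mul_le_of_le_one_left (norm_nonneg _) (chi_le _)
    · refine fall fun ξ => ?_
      refine tendsto_const_nhds.congr' ?_
      have := (two_zpow_neg_nat (tw ^ (-K) * ‖ξ‖)).eventually (gt_mem_nhds zero_lt_one)
      filter_upwards [this] with m hm
      rw [chi_one, Complex.ofReal_one, one_mul]
      rw [norm_sc, neg_add, zpow_add₀ nz]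
      linarith [mul_assoc (tw ^ (-(m:ℤ))) (tw ^ (-K)) ‖ξ‖, mul_comm (tw ^ (-(m:ℤ))) (tw ^ (-K))]
  have h0 : T 0 = J (fun ξ => (chi (tw ^ (-K) • ξ) : ℂ) * G ξ) x := by simp [hT]
  rw [← h0]
  exact le_of_tendsto (hlim.sub_const (T 0)).enorm (fall hsum)

lemma LP_le {G : VC} (hG : Integrable G) (x : V2) :
    ‖J G x‖ₑ ≤ ∑' k : ℤ, ‖J (fun ξ => (psi (tw ^ (-k) • ξ) : ℂ) * G ξ) x‖ₑ := by
  set S := ∑' k : ℤ, ‖J (fun ξ => (psi (tw ^ (-k) • ξ) : ℂ) * G ξ) x‖ₑ with hS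
  have h1 : ∀ n : ℕ, ‖J G x - J (fun ξ => (chi (tw ^ (-(-(n:ℤ))) • ξ) : ℂ) * G ξ) x‖ₑ ≤ S := by
    intro n
    refine (LP_hi hG _ x).trans ?_
    exact ENNReal.tsum_comp_le_tsum_of_injective (f := fun i : ℕ => (-(n:ℤ) + 1 + i)) (by intro a b h; simpa using h)
      (fun k : ℤ => ‖J (fun ξ => (psi (tw ^ (-k) • ξ) : ℂ) * G ξ) x‖ₑ)
  have hlim : Filter.Tendsto (fun n : ℕ => J (fun ξ => (chi (tw ^ (-(-(n:ℤ))) • ξ) : ℂ) * G ξ) x)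
      Filter.atTop (nhds 0) := by
    unfold J
    have : (0:ℂ) = ∫ ξ : V2, (0:ℂ) := by simp
    rw [this]
    refine tendsto_integral_of_dominated_convergence (fun ξ => ‖G ξ‖) ?_ hG.norm ?_ ?_
    · intro m
      exact (phmul_integrable (Continuous.aestronglyMeasurable fz) (chik_int hG _)).aestronglyMeasurable
    · intro m; refine fall fun ξ => ?_
      rw [norm_mul, norm_mul, ph_norm, one_mul, Complex.norm_real, nrn (chi_nonneg _)]
      exact mul_le_of_le_one_left (norm_nonneg _) (chi_le _)
    · filter_upwards [Measure.ae_ne volume (0:V2)] with ξ hξ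
      have hp : 0 < ‖ξ‖ := norm_pos_iff.mpr hξ
      refine tendsto_const_nhds.congr' ?_
      have := (two_zpow_neg_nat 2).eventually (gt_mem_nhds hp)
      filter_upwards [this] with m hm
      rw [chi_zero, Complex.ofReal_zero, zero_mul, mul_zero]
      rw [norm_sc, neg_neg]
      rw [zpow_neg, inv_mul_lt_iff₀ pz] at hm
      exact hm.le
  have h2 := (hlim.const_sub (J G x)).enorm
  rw [sub_zero] at h2
  exact le_of_tendsto h2 (fall h1)

section Sec12
open scoped LineDeriv FourierTransform

lemma nft_deriv (H : SchwartzMap V2 ℂ) (j : Fin 2) (ξ : V2) :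
    nft (∂_{(EuclideanSpace.single j (1:ℝ) : V2)} H : SchwartzMap V2 ℂ) ξ = Complex.I * (ξ j : ℂ) * nft H ξ := by
  have : (inner ℝ · (EuclideanSpace.single j (1:ℝ) : V2)).HasTemperateGrowth := by fun_prop
  rw [nft_eq, nft_eq, SchwartzMap.fourier_lineDerivOp_eq]
  rw [smul_apply, SchwartzMap.smulLeftCLM_apply_apply this]
  simp only [real_inner_smul_left,
    EuclideanSpace.inner_single_right, one_mul, smul_eq_mul, Complex.real_smul, conj_trivial, PiLp.smul_apply]
  have h : (π : ℂ) ≠ 0 := by exact_mod_cast pi_ne_zero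
  push_cast
  field_simp

lemma nft_add (H1 H2 : SchwartzMap V2 ℂ) (ξ : V2) : nft (H1 + H2 : SchwartzMap V2 ℂ) ξ = nft H1 ξ + nft H2 ξ := by
  rw [nft_eq, nft_eq, nft_eq, FourierTransform.fourier_add, add_apply]; ring

lemma nft_neg (H : SchwartzMap V2 ℂ) (ξ : V2) : nft (-H : SchwartzMap V2 ℂ) ξ = - nft H ξ := by
  rw [nft_eq, nft_eq]
  have : 𝓕 (-H) = - 𝓕 H := by
    rw [← neg_one_smul ℂ H, FourierTransform.fourier_smul, neg_one_smul]
  rw [this, neg_apply]; ring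

def slice (u : SchwartzMap (ℝ × V2) ℂ) (t : ℝ) : SchwartzMap V2 ℂ :=
  SchwartzMap.compCLMOfAntilipschitz ℂ (K := 1) (g := fun x : V2 => (t, x))
    (by
      have : (fun x : V2 => (t, x)) = fun x => (t, (0:V2)) + ContinuousLinearMap.inr ℝ ℝ V2 x := by
        ext x <;> simp
      rw [this]
      exact (Function.HasTemperateGrowth.const _).add (ContinuousLinearMap.hasTemperateGrowth _))
    (AntilipschitzWith.of_le_mul_dist fun x y => by simp [Prod.dist_eq]) u

lemma slice_apply (u : SchwartzMap (ℝ × V2) ℂ) (t : ℝ) (x : V2) : slice u t x = u (t, x) := rfl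

def pdS (j : Fin 2) (u : SchwartzMap (ℝ × V2) ℂ) : SchwartzMap (ℝ × V2) ℂ :=
  ∂_{((0:ℝ), (EuclideanSpace.single j (1:ℝ) : V2))} u

lemma pdS_coe (j : Fin 2) (u : SchwartzMap (ℝ × V2) ℂ) : ⇑(pdS j u) = pdx j u := rfl

lemma slice_pdS (j : Fin 2) (u : SchwartzMap (ℝ × V2) ℂ) (t : ℝ) :
    slice (pdS j u) t = ∂_{(EuclideanSpace.single j (1:ℝ) : V2)} (slice u t) := by
  ext x
  rw [slice_apply, pdS_coe, SchwartzMap.lineDerivOp_apply_eq_fderiv]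
  unfold pdx
  have h1 : HasFDerivAt u (fderiv ℝ u (t, x)) (t, x) := u.differentiableAt.hasFDerivAt
  have h2 : HasFDerivAt (fun y : V2 => (t, y)) (ContinuousLinearMap.inr ℝ ℝ V2) x := hasFDerivAt_prodMk_right t x
  have h3 : HasFDerivAt (slice u t) _ x := h1.comp x h2
  rw [h3.fderiv]; rfl

def Mel (j : Fin 2) (b : ℝ) (ζ : V2) : ℂ := (-Complex.I * (ζ j : ℂ) * ((‖ζ‖ ^ (b - 2) : ℝ) : ℂ)) * (psi ζ : ℂ)

lemma Mel_ker (j : Fin 2) (b : ℝ) : ∃ κ, IsKer κ (Mel j b) := by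
  refine psi_ker (m := fun ζ => -Complex.I * (ζ j : ℂ) * ((‖ζ‖ ^ (b - 2) : ℝ) : ℂ)) fun ζ hζ => ?_
  have h1 : ContDiffAt ℝ (⊤ : ℕ∞) (fun ζ : V2 => ((ζ j : ℝ) : ℂ)) ζ :=
    (Complex.ofRealCLM.contDiff.comp (EuclideanSpace.proj (𝕜 := ℝ) j : V2 →L[ℝ] ℝ).contDiff).contDiffAt
  have h2 : ContDiffAt ℝ (⊤ : ℕ∞) (fun ζ : V2 => ((‖ζ‖ ^ (b - 2) : ℝ) : ℂ)) ζ :=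
    Complex.ofRealCLM.contDiff.contDiffAt.comp ζ ((contDiffAt_norm ℝ hζ).rpow_const_of_ne (norm_ne_zero_iff.mpr hζ))
  exact (contDiffAt_const.mul h1).mul h2

lemma pow_ker (a : ℝ) : ∃ κ, IsKer κ (fun ζ => ((‖ζ‖ ^ a : ℝ) : ℂ) * (psi ζ : ℂ)) := by
  refine psi_ker (m := fun ζ => ((‖ζ‖ ^ a : ℝ) : ℂ)) fun ζ hζ => ?_
  exact Complex.ofRealCLM.contDiff.contDiffAt.comp ζ ((contDiffAt_norm ℝ hζ).rpow_const_of_ne (norm_ne_zero_iff.mpr hζ))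

def Sb (κ : VC) (b : ℝ) (H : VC) (x : V2) : EN :=
  ∑' k : ℤ, eO (tw ^ ((k:ℝ) * (b - 1))) * ‖Ck κ k H x‖ₑ

lemma nft_pow_int (H : SchwartzMap V2 ℂ) {b : ℝ} (hb : 0 ≤ b) :
    Integrable fun ξ => ((‖ξ‖ ^ b : ℝ) : ℂ) * nft H ξ := by
  obtain ⟨N, hN⟩ := exists_nat_ge b
  have h1 := (nft_integrable0 H).norm.add (nft_integrable H N).norm
  refine h1.mono' ?_ ?_
  · have := nft_cont H
    have h2 : Continuous fun ξ : V2 => ‖ξ‖ ^ b := continuous_norm.rpow_const fun _ => Or.inr hb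
    exact Continuous.aestronglyMeasurable fz
  · refine fall fun ξ => ?_
    simp only [Pi.add_apply, norm_mul, Complex.norm_real]
    rw [nrn pz, nrn pz, ← one_add_mul]
    refine mul_le_mul_of_nonneg_right ?_ (norm_nonneg _)
    rcases le_total ‖ξ‖ 1 with h | h
    · have := Real.rpow_le_one (norm_nonneg ξ) h hb
      have : 0 ≤ ‖ξ‖ ^ N := by positivity
      linarith
    · have := Real.rpow_le_rpow_of_exponent_le h hN
      rw [Real.rpow_natCast] at this; linarith

lemma norm_sq2 (ξ : V2) : ‖ξ‖ ^ 2 = ξ 0 ^ 2 + ξ 1 ^ 2 := by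
  rw [EuclideanSpace.real_norm_sq_eq, Fin.sum_univ_two]

lemma Mel_scale (j : Fin 2) (b : ℝ) (k : ℤ) (ξ : V2) :
    Mel j b (tw ^ (-k) • ξ) = ((tw ^ (-((k:ℝ) * (b - 1))) : ℝ) : ℂ) *
      (-Complex.I * (ξ j : ℂ) * ((‖ξ‖ ^ (b - 2) : ℝ) : ℂ) * (psi (tw ^ (-k) • ξ) : ℂ)) := by
  unfold Mel
  rw [norm_sc, Real.mul_rpow pz (norm_nonneg _)]
  have e : (tw ^ (-k)) * (tw ^ (-k)) ^ (b - 2) = tw ^ (-((k:ℝ) * (b - 1))) := by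
    rw [← Real.rpow_intCast, ← Real.rpow_mul nz, ← Real.rpow_add nz]
    congr 1; push_cast; ring
  rw [← e]
  simp only [PiLp.smul_apply, smul_eq_mul]
  push_cast; ring

lemma ell_bound {b : ℝ} (hb : 0 ≤ b) {κ0 κ1 : VC} (h0 : IsKer κ0 (Mel 0 b)) (h1 : IsKer κ1 (Mel 1 b))
    (A Q1 Q2 Q3 Q4 : SchwartzMap V2 ℂ)
    (h : ∂_{(EuclideanSpace.single 0 (1:ℝ) : V2)} (∂_{(EuclideanSpace.single 0 (1:ℝ) : V2)} A) +
      ∂_{(EuclideanSpace.single 1 (1:ℝ) : V2)} (∂_{(EuclideanSpace.single 1 (1:ℝ) : V2)} A) =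
      -∂_{(EuclideanSpace.single 0 (1:ℝ) : V2)} Q1 + ∂_{(EuclideanSpace.single 1 (1:ℝ) : V2)} Q2 +
      ∂_{(EuclideanSpace.single 0 (1:ℝ) : V2)} Q3 + ∂_{(EuclideanSpace.single 1 (1:ℝ) : V2)} Q4) (x : V2) :
    ‖J (fun ξ => ((‖ξ‖ ^ b : ℝ) : ℂ) * nft A ξ) x‖ₑ ≤ Sb κ0 b Q1 x + Sb κ1 b Q2 x + Sb κ0 b Q3 x + Sb κ1 b Q4 x := by
  refine (LP_le (nft_pow_int A hb) x).trans ?_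
  unfold Sb
  rw [← ENNReal.tsum_add, ← ENNReal.tsum_add, ← ENNReal.tsum_add]
  refine tle fun k => ?_
  have hn : ∀ ξ, -((ξ 0 : ℂ) ^ 2 + (ξ 1 : ℂ) ^ 2) * nft A ξ = Complex.I * (-(ξ 0 : ℂ) * nft Q1 ξ + (ξ 1 : ℂ) * nft Q2 ξ +
      (ξ 0 : ℂ) * nft Q3 ξ + (ξ 1 : ℂ) * nft Q4 ξ) := by
    intro ξ
    have := congrArg (fun H : SchwartzMap V2 ℂ => nft H ξ) h
    simp only [nft_add, nft_neg, nft_deriv] at this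
    linear_combination this - ((ξ 0 : ℂ) ^ 2 + (ξ 1 : ℂ) ^ 2) * nft A ξ * Complex.I_sq
  have hc : ∀ (Q : SchwartzMap V2 ℂ) {κ M : VC}, IsKer κ M → Ck κ k Q x =
      J (fun ξ => M (tw ^ (-k) • ξ) * nft Q ξ) x := by
    intro Q κ M hκ
    rw [← Ck_J (nft_integrable0 Q) hκ]
    congr 1; ext y; rw [J_nft]
  have hi : ∀ (Q : SchwartzMap V2 ℂ) {κ M : VC}, IsKer κ M →
      Integrable (fun ξ => M (tw ^ (-k) • ξ) * nft Q ξ) := by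
    intro Q κ M hκ
    exact (nft_integrable0 Q).bdd_mul (c := ∫ z, ‖κ z‖) ((hκ.M_cont.comp fz).aestronglyMeasurable)
      (fall fun ξ => hκ.M_bdd _)
  have key : J (fun ξ => (psi (tw ^ (-k) • ξ) : ℂ) * (((‖ξ‖ ^ b : ℝ) : ℂ) * nft A ξ)) x =
      ((tw ^ ((k:ℝ) * (b - 1)) : ℝ) : ℂ) * (-Ck κ0 k Q1 x + Ck κ1 k Q2 x + Ck κ0 k Q3 x + Ck κ1 k Q4 x) := by
    have i1 : Integrable (fun ξ => -1 * (Mel 0 b (tw ^ (-k) • ξ) * nft Q1 ξ)) := (hi Q1 h0).const_mul _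
    have i2 : Integrable (fun ξ => -1 * (Mel 0 b (tw ^ (-k) • ξ) * nft Q1 ξ) + Mel 1 b (tw ^ (-k) • ξ) * nft Q2 ξ) :=
      i1.add (hi Q2 h1)
    have i3 : Integrable (fun ξ => -1 * (Mel 0 b (tw ^ (-k) • ξ) * nft Q1 ξ) + Mel 1 b (tw ^ (-k) • ξ) * nft Q2 ξ +
      Mel 0 b (tw ^ (-k) • ξ) * nft Q3 ξ) := i2.add (hi Q3 h0)
    rw [hc Q1 h0, hc Q2 h1, hc Q3 h0, hc Q4 h1, ← neg_one_mul (J _ x), ← J_const_mul, ← J_add i1 (hi Q2 h1),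
      ← J_add i2 (hi Q3 h0), ← J_add i3 (hi Q4 h1), ← J_const_mul]
    unfold J
    refine integral_congr_ae ?_
    filter_upwards [Measure.ae_ne volume (0:V2)] with ξ hξ
    have hp : 0 < ‖ξ‖ := norm_pos_iff.mpr hξ
    rw [Mel_scale 0 b k ξ, Mel_scale 1 b k ξ]
    have e1 : ((tw ^ ((k:ℝ) * (b - 1)) : ℝ) : ℂ) * ((tw ^ (-((k:ℝ) * (b - 1))) : ℝ) : ℂ) = 1 := by
      rw [← Complex.ofReal_mul, ← Real.rpow_add nz, add_neg_cancel, Real.rpow_zero, Complex.ofReal_one]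
    have e2 : ((‖ξ‖ ^ b : ℝ) : ℂ) = ((ξ 0 : ℂ) ^ 2 + (ξ 1 : ℂ) ^ 2) * ((‖ξ‖ ^ (b - 2) : ℝ) : ℂ) := by
      have : ‖ξ‖ ^ b = ‖ξ‖ ^ 2 * ‖ξ‖ ^ (b - 2) := by
        rw [← Real.rpow_natCast, ← Real.rpow_add hp]; congr 1; push_cast; ring
      rw [this, norm_sq2]; push_cast; ring
    rw [e2]
    set c1 := ((tw ^ ((k:ℝ) * (b - 1)) : ℝ) : ℂ)
    set c2 := ((tw ^ (-((k:ℝ) * (b - 1))) : ℝ) : ℂ)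
    set r := ((‖ξ‖ ^ (b - 2) : ℝ) : ℂ)
    set P := (psi (tw ^ (-k) • ξ) : ℂ)
    set φ := ph ⟪x, ξ⟫
    have hnξ := hn ξ
    linear_combination (-φ * P * r) * hnξ + (φ * P * r * Complex.I * (-(ξ 0 : ℂ) * nft Q1 ξ + (ξ 1 : ℂ) * nft Q2 ξ +
      (ξ 0 : ℂ) * nft Q3 ξ + (ξ 1 : ℂ) * nft Q4 ξ)) * e1
  rw [key, enorm_mul, ← ofReal_norm ((tw ^ ((k:ℝ) * (b - 1)) : ℝ) : ℂ), Complex.norm_real, nrn pz,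
    ← mul_add, ← mul_add, ← mul_add]
  refine MLR ?_ _
  refine (enorm_add_le _ _).trans (add_le_add ((enorm_add_le _ _).trans (add_le_add ((enorm_add_le _ _).trans ?_) le_rfl)) le_rfl)
  rw [enorm_neg]

end Sec12

def LQ {Ω : Type*} [MeasureSpace Ω] (q : ℝ) (f : Ω → EN) : EN := (∫⁻ x, f x ^ q) ^ (1 / q)

section
variable {Ω : Type*} [MeasureSpace Ω]

lemma LQ_mono {q : ℝ} (hq : 0 ≤ q) {f g : Ω → EN} (h : ∀ x, f x ≤ g x) : LQ q f ≤ LQ q g :=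
  rle (lintegral_mono fun x => rle (h x) hq) pz

lemma LQ_add {q : ℝ} (hq : 1 ≤ q) {f g : Ω → EN} (hf : Measurable f) (hg : Measurable g) :
    LQ q (fun x => f x + g x) ≤ LQ q f + LQ q g :=
  ENNReal.lintegral_Lp_add_le hf.aemeasurable hg.aemeasurable hq

lemma LQ_cmul {q : ℝ} (hq : 0 < q) (c : EN) {f : Ω → EN} (hf : Measurable f) :
    LQ q (fun x => c * f x) = c * LQ q f := by
  unfold LQ
  simp_rw [mrn _ _ hq.le]
  rw [lintegral_const_mul _ fz, mrn _ _ pz,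
    ← eRm, mul_one_div_cancel hq.ne', eR1]

lemma LQ_sum {q : ℝ} (hq : 1 ≤ q) {ι : Type*} (S : Finset ι) {f : ι → Ω → EN} (hf : ∀ i, Measurable (f i)) :
    LQ q (fun x => ∑ i ∈ S, f i x) ≤ ∑ i ∈ S, LQ q (f i) := by
  classical
  have hq0 : 0 < q := by linarith
  induction S using Finset.induction_on with
  | empty => simp [LQ, hq0]
  | insert a S ha ih =>
    simp_rw [Finset.sum_insert ha]
    exact (LQ_add hq (hf a) (Finset.measurable_fun_sum S fun i _ => hf i)).trans (by gcongr)

lemma LQ_tsum {q : ℝ} (hq : 1 ≤ q) {ι : Type*} [Countable ι] {f : ι → Ω → EN} (hf : ∀ i, Measurable (f i)) :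
    LQ q (fun x => ∑' i, f i x) ≤ ∑' i, LQ q (f i) := by
  have hq0 : 0 < q := by linarith
  have e : ∫⁻ x, (∑' i, f i x) ^ q = ⨆ S : Finset ι, ∫⁻ x, (∑ i ∈ S, f i x) ^ q := by
    rw [← lintegral_iSup_directed]
    · apply lintegral_congr; intro x
      rw [ENNReal.tsum_eq_iSup_sum]
      exact (ENNReal.orderIsoRpow q hq0).map_iSup _
    · intro S; exact ((Finset.measurable_fun_sum S fun i _ => hf i).pow_const q).aemeasurable
    · refine Monotone.directed_le fun S T h x => rle ?_ hq0.le
      exact Finset.sum_le_sum_of_subset h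
  unfold LQ
  rw [e]
  have h2 := (ENNReal.orderIsoRpow (1 / q) pz).map_iSup (fun S : Finset ι => ∫⁻ x, (∑ i ∈ S, f i x) ^ q)
  simp only [ENNReal.orderIsoRpow_apply] at h2
  rw [h2]
  exact iSup_le fun S => (LQ_sum hq S hf).trans (ENNReal.sum_le_tsum _)

lemma LQ_interp {q : ℝ} (hq : 2 ≤ q) {f : Ω → EN} {M : EN} (hM : M ≠ ⊤) (h : ∀ x, f x ≤ M) :
    LQ q f ≤ M ^ (1 - 2 / q) * (∫⁻ x, f x ^ 2) ^ (1 / q) := by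
  have hq0 : 0 < q := by linarith
  have h1 : ∫⁻ x, f x ^ q ≤ M ^ (q - 2) * ∫⁻ x, f x ^ 2 := by
    rw [← lintegral_const_mul' _ _ (rnt lz hM)]
    refine lintegral_mono fun x => ?_
    have : f x ^ q = f x ^ (q - 2) * f x ^ 2 := by
      rw [← eR2, ← eRa _ _ lz nz]; congr 1; ring
    rw [this]
    exact MLL (rle (h x) lz) _
  refine (rle h1 pz).trans_eq ?_
  rw [mrn _ _ pz, ← eRm]
  congr 2; field_simp
end

def p2 (r : ℝ) : EN := eO (tw ^ r)

lemma p2_add (r s : ℝ) : p2 (r + s) = p2 r * p2 s := by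
  unfold p2; rw [Real.rpow_add nz, oM pz]
lemma p2_ne_top (r : ℝ) : p2 r ≠ ⊤ := ENNReal.ofReal_ne_top
lemma p2_zero : p2 0 = 1 := by simp [p2]
lemma p2_mono {r s : ℝ} (h : r ≤ s) : p2 r ≤ p2 s :=
  oLe (Real.rpow_le_rpow_of_exponent_le nz h)
lemma p2_rpow (r s : ℝ) : p2 r ^ s = p2 (r * s) := by
  unfold p2; rw [ENNReal.ofReal_rpow_of_pos pz, ← Real.rpow_mul nz]
lemma p2_pow2 (r : ℝ) : p2 r ^ 2 = p2 (2 * r) := by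
  rw [← eR2, p2_rpow, mul_comm]
lemma p2_int (k : ℤ) : p2 k = eO (tw ^ k) := by unfold p2; rw [Real.rpow_intCast]
lemma p2_geom {d : ℝ} (hd : 0 < d) : ∑' n : ℕ, p2 (-(d * n)) ≠ ⊤ := by
  have e : ∀ n : ℕ, p2 (-(d * n)) = p2 (-d) ^ n := by
    intro n; rw [← ENNReal.rpow_natCast, p2_rpow]; congr 1; ring
  simp_rw [e]
  rw [ENNReal.tsum_geometric]
  have : p2 (-d) < 1 := by
    rw [← p2_zero]; unfold p2
    exact (ENNReal.ofReal_lt_ofReal_iff pz).2 (Real.rpow_lt_rpow_of_exponent_lt nz lz)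
  exact ENNReal.inv_ne_top.2 (tsub_pos_iff_lt.2 this).ne'

lemma Ck_cv (κ : VC) (k : ℤ) (H : VC) (x : V2) :
    ‖Ck κ k H x‖ₑ ≤ ∫⁻ y, eO ((tw ^ k) ^ 2) * ‖κ ((tw ^ k) • y)‖ₑ * ‖H (x - y)‖ₑ := by
  refine (Ck_enorm_le κ k H x).trans_eq ?_
  have h := lint_scale (tw ^ k) pz (fun z => ‖κ z‖ₑ * ‖H (x - (tw ^ (-k)) • z)‖ₑ)
  simp only [smul_smul] at h
  rw [show tw ^ (-k) * 2 ^ k = 1 by rw [← zpow_add₀ nz]; simp] at h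
  simp only [one_smul] at h
  simp_rw [mul_assoc]
  rw [lintegral_const_mul' _ _ ENNReal.ofReal_ne_top, h, ← mul_assoc, ← oM pz,
    mul_inv_cancel₀ pz]
  simp

lemma enorm_inv_eq {y : V2} (hy : y ≠ 0) : ‖y‖ₑ⁻¹ = eO ‖y‖⁻¹ := by
  rw [ENNReal.ofReal_inv_of_pos (norm_pos_iff.2 hy), ofReal_norm]

lemma ker_pt {r v C : ℝ} (hr : 0 < r) (hv : 0 < v) (hC : 0 < C) :
    v ^ 2 * (C * (1 + v * r) ^ (-(4:ℝ))) ≤ C * v * r⁻¹ * (v * r / (1 + v * r) ^ 2) := by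
  rw [Real.rpow_neg pz, show (4:ℝ) = ((4:ℕ):ℝ) by norm_num, Real.rpow_natCast]
  have h1 : 1 ≤ (1 + v * r) ^ 2 := one_le_pow₀ (by nlinarith [mul_pos hv hr])
  have : ((1 + v * r) ^ 4)⁻¹ ≤ ((1 + v * r) ^ 2)⁻¹ := by
    apply inv_anti₀ pz
    nlinarith
  calc v ^ 2 * (C * ((1 + v * r) ^ 4)⁻¹) ≤ v ^ 2 * (C * ((1 + v * r) ^ 2)⁻¹) := by gcongr
    _ = _ := by field_simp

lemma ker_pt' (h : IsKer κ M) : ∃ C : ℝ, 0 < C ∧ ∀ (k : ℤ) (y : V2), y ≠ 0 →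
    eO ((tw ^ k) ^ 2) * ‖κ ((tw ^ k) • y)‖ₑ ≤ eO C * eO (tw ^ k) *
      ‖y‖ₑ⁻¹ * eO (tw ^ k * ‖y‖ / (1 + tw ^ k * ‖y‖) ^ 2) := by
  obtain ⟨C, hC, hd⟩ := h.dec'
  refine ⟨C, hC, fun k y hy => ?_⟩
  have hr : 0 < ‖y‖ := norm_pos_iff.2 hy
  have hv : (0:ℝ) < 2 ^ k := by positivity
  rw [enorm_inv_eq hy, ← ofReal_norm, ← oM pz, ← oM pz,
    ← oM pz, ← oM pz]
  apply oLe
  refine le_trans ?_ (ker_pt hr hv hC)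
  have := hd (tw ^ k • y)
  rw [norm_smul, nrn hv.le] at this
  gcongr

lemma Ck_RT (h : IsKer κ M) : ∃ C : EN, C ≠ ⊤ ∧ ∀ (k : ℤ) (H : VC), Measurable H → ∀ x,
    ‖Ck κ k H x‖ₑ ≤ C * p2 k * RT (fun y => ‖H y‖ₑ) x := by
  obtain ⟨C, hC, hd⟩ := ker_pt' h
  refine ⟨eO C, ENNReal.ofReal_ne_top, fun k H hH x => (Ck_cv κ k H x).trans ?_⟩
  unfold RT
  rw [← lintegral_const_mul' _ _ (by finiteness [p2_ne_top k])]
  apply lintegral_mono_ae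
  filter_upwards [Measure.ae_ne volume (0:V2)] with y hy
  rw [← mul_assoc, p2_int]
  refine MLL ((hd k y hy).trans (mul_le_of_le_one_right zero_le ?_)) _
  have hr : 0 < tw ^ k * ‖y‖ := by have := norm_pos_iff.2 hy; positivity
  rw [ENNReal.ofReal_le_one, div_le_one pz]
  nlinarith

lemma tele (r : ℝ) (hr : 0 < r) : ∑' n : ℕ, eO (tw ^ (-(n:ℤ)) * r / (1 + tw ^ (-(n:ℤ)) * r) ^ 2) ≤ 2 := by
  rw [ENNReal.tsum_eq_iSup_nat]
  refine iSup_le fun N => ?_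
  have hu : ∀ n : ℕ, 0 < tw ^ (-(n:ℤ)) * r := fun n => by positivity
  rw [← ENNReal.ofReal_sum_of_nonneg (fun n _ => by have := hu n; positivity)]
  have : ∑ n ∈ Finset.range N, (tw ^ (-(n:ℤ)) * r / (1 + tw ^ (-(n:ℤ)) * r) ^ 2) ≤
      2 * (1 / (1 + 2 * (tw ^ (-(N:ℤ)) * r)) - 1 / (1 + 2 * r)) := by
    induction N with
    | zero => simp
    | succ N ih =>
      rw [Finset.sum_range_succ]
      have e : 2 * (tw ^ (-((N + 1 : ℕ):ℤ)) * r) = tw ^ (-(N:ℤ)) * r := by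
        rw [← mul_assoc]; congr 1
        rw [Nat.cast_add, neg_add, zpow_add₀ nz]; norm_num; ring
      rw [e]
      set u := tw ^ (-(N:ℤ)) * r
      have hu := hu N
      have : u / (1 + u) ^ 2 ≤ 2 * (1 / (1 + u) - 1 / (1 + 2 * u)) := by
        have h0 : 0 < u := hu
        rw [div_sub_div _ _ pz pz, ← mul_div_assoc, div_le_div_iff₀ pz pz]
        nlinarith [mul_pos h0 h0, mul_pos h0 (mul_pos h0 h0)]
      linarith
  refine (oLe this).trans ?_
  rw [show (2:EN) = eO 2 by simp]
  apply oLe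
  have h1 : 1 / (1 + 2 * (tw ^ (-(N:ℤ)) * r)) ≤ 1 := by
    rw [div_le_one (by have := hu N; positivity)]; linarith [hu N]
  have h2 : 0 ≤ 1 / (1 + 2 * r) := by positivity
  linarith

lemma Ck_RTsum (h : IsKer κ M) : ∃ C : EN, C ≠ ⊤ ∧ ∀ (H : VC), Measurable H → ∀ x,
    ∑' n : ℕ, p2 n * ‖Ck κ (-(n:ℤ)) H x‖ₑ ≤ C * RT (fun y => ‖H y‖ₑ) x := by
  obtain ⟨C, hC, hd⟩ := ker_pt' h
  refine ⟨eO C * 2, by finiteness, fun H hH x => ?_⟩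
  have h1 : ∀ n : ℕ, p2 n * ‖Ck κ (-(n:ℤ)) H x‖ₑ ≤ ∫⁻ y, eO C * (‖y‖ₑ⁻¹ * ‖H (x - y)‖ₑ) *
      eO (tw ^ (-(n:ℤ)) * ‖y‖ / (1 + tw ^ (-(n:ℤ)) * ‖y‖) ^ 2) := by
    intro n
    refine (MLR (Ck_cv κ _ H x) _).trans ?_
    rw [← lintegral_const_mul' _ _ (p2_ne_top _)]
    apply lintegral_mono_ae
    filter_upwards [Measure.ae_ne volume (0:V2)] with y hy
    refine (MLR (MLL (hd (-(n:ℤ)) y hy) _) _).trans_eq ?_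
    have e : p2 n * eO (tw ^ (-(n:ℤ))) = 1 := by
      rw [← p2_int, ← p2_add]; push_cast; rw [add_neg_cancel, p2_zero]
    calc _ = (p2 n * eO (tw ^ (-(n:ℤ)))) * (eO C * (‖y‖ₑ⁻¹ * ‖H (x - y)‖ₑ) *
      eO (tw ^ (-(n:ℤ)) * ‖y‖ / (1 + tw ^ (-(n:ℤ)) * ‖y‖) ^ 2)) := by ring
      _ = _ := by rw [e, one_mul]
  refine (tle h1).trans ?_
  rw [← lintegral_tsum (fun n => Measurable.aemeasurable fz)]
  unfold RT
  rw [← lintegral_const_mul' _ _ (by finiteness)]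
  apply lintegral_mono_ae
  filter_upwards [Measure.ae_ne volume (0:V2)] with y hy
  rw [ENNReal.tsum_mul_left]
  refine (MLR (tele ‖y‖ (norm_pos_iff.2 hy)) _).trans (le_of_eq (by ring))

lemma Ck_sup (h : IsKer κ M) {q : ℝ} (hq : 1 < q) : ∃ C : EN, C ≠ ⊤ ∧ ∀ (k : ℤ) (H : VC), Measurable H → ∀ x,
    ‖Ck κ k H x‖ₑ ≤ C * p2 (k * (2 / q)) * LQ q (fun y => ‖H y‖ₑ) := by
  have hc : (q / (q - 1)).HolderConjugate q := (Real.HolderConjugate.conjExponent hq).symm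
  set q' := q / (q - 1) with hq'
  have hq0 : 0 < q := by linarith
  have hq'1 : 1 < q' := hc.lt
  have hκm := h.cont.measurable
  refine ⟨(∫⁻ z, ‖κ z‖ₑ ^ q') ^ (1 / q'), ?_, fun k H hH x => (Ck_enorm_le κ k H x).trans ?_⟩
  · apply rnt pz
    obtain ⟨C, hC, hd⟩ := h.dec'
    have hb : ∀ z, ‖κ z‖ₑ ≤ eO C := by
      intro z; rw [← ofReal_norm]; apply oLe
      refine (hd z).trans (mul_le_of_le_one_right hC.le ?_)
      exact Real.rpow_le_one_of_one_le_of_nonpos (by linarith [norm_nonneg z]) nz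
    have : ∀ z, ‖κ z‖ₑ ^ q' ≤ eO C ^ (q' - 1) * ‖κ z‖ₑ := by
      intro z
      calc ‖κ z‖ₑ ^ q' = ‖κ z‖ₑ ^ (q' - 1) * ‖κ z‖ₑ ^ (1:ℝ) := by
            rw [← eRa _ _ lz nz]; congr 1; ring
        _ ≤ _ := by rw [eR1]; exact MLL (rle (hb z) lz) _
    refine ((lintegral_mono this).trans_lt ?_).ne
    rw [lintegral_const_mul _ hκm.enorm]
    exact ENNReal.mul_lt_top (ENNReal.rpow_lt_top_of_nonneg lz ENNReal.ofReal_ne_top) h.integrable.2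
  · have h1 := ENNReal.lintegral_mul_le_Lp_mul_Lq volume hc (f := fun z => ‖κ z‖ₑ)
      (g := fun z => ‖H (x - (tw ^ (-k)) • z)‖ₑ) fz fz
    refine h1.trans ?_
    rw [mul_assoc]
    refine MLR (le_of_eq ?_) _
    have h2 := lint_scale (tw ^ (-k)) pz (fun z => ‖H (x - z)‖ₑ ^ q)
    rw [h2, lintegral_sub_left_eq_self (fun z => ‖H z‖ₑ ^ q) x, mrn _ _ pz]
    unfold LQ
    congr 1
    have : ((tw ^ (-k)) ^ 2)⁻¹ = tw ^ ((k:ℝ) * 2) := by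
      rw [Real.rpow_mul nz, Real.rpow_intCast, zpow_neg, Real.rpow_two]; simp
    rw [this]
    have := p2_rpow (k * 2) (1 / q)
    rw [p2] at this
    rw [this]; congr 1; ring

def g2 (G : VC) (S : Set V2) : EN := (∫⁻ ξ in S, ‖G ξ‖ₑ ^ 2) ^ hfw
def gam (s : ℝ) (G : VC) : EN := (∫⁻ ξ, eO ((1 + ‖ξ‖ ^ 2) ^ s) * ‖G ξ‖ₑ ^ 2) ^ hfw

lemma sq_half (x : EN) : (x ^ hfw) ^ 2 = x := by
  rw [← eR2, ← eRm]; norm_num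
lemma half_sq (x : EN) : (x ^ 2) ^ hfw = x := by
  rw [← eR2, ← eRm]; norm_num

lemma g2_le {s r : ℝ} (hs : 0 ≤ s) (G : VC) {S : Set V2} (hS : MeasurableSet S) (h : ∀ ξ ∈ S, tw ^ r ≤ ‖ξ‖) :
    g2 G S ≤ p2 (-(r * s)) * gam s G := by
  unfold g2 gam
  rw [show p2 (-(r * s)) = p2 (-(2 * r * s)) ^ hfw by rw [p2_rpow]; congr 1; ring,
    ← mrn _ _ nz]
  apply rle _ nz
  rw [← lintegral_const_mul' _ _ (p2_ne_top _)]
  refine le_trans ?_ (setLIntegral_le_lintegral S _)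
  refine setLIntegral_mono' hS fun ξ hξ => ?_
  rw [← mul_assoc]
  nth_rewrite 1 [← one_mul (‖G ξ‖ₑ ^ 2)]
  refine MLL ?_ _
  calc (1:EN) = p2 (-(2 * r * s)) * p2 (2 * r * s) := by rw [← p2_add, neg_add_cancel, p2_zero]
    _ ≤ _ := by
      refine MLR (oLe ?_) _
      rw [Real.rpow_mul nz, mul_comm 2 r, Real.rpow_mul nz, Real.rpow_two]
      have := h ξ hξ
      apply Real.rpow_le_rpow pz _ hs
      have : (tw ^ r) ^ 2 ≤ ‖ξ‖ ^ 2 := by gcongr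
      linarith

lemma g2_le_gam {s : ℝ} (hs : 0 ≤ s) (G : VC) (S : Set V2) : g2 G S ≤ gam s G := by
  apply rle _ nz
  refine (setLIntegral_le_lintegral S _).trans (lintegral_mono fun ξ => ?_)
  nth_rewrite 1 [← one_mul (‖G ξ‖ₑ ^ 2)]
  refine MLL ?_ _
  rw [ENNReal.one_le_ofReal]
  exact Real.one_le_rpow (by linarith [sq_nonneg ‖ξ‖]) hs

lemma ind_lint (G : VC) {S : Set V2} (hS : MeasurableSet S) (m : ℕ) (hm : m ≠ 0) :
    ∫⁻ ξ, ‖S.indicator G ξ‖ₑ ^ m = ∫⁻ ξ in S, ‖G ξ‖ₑ ^ m := by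
  rw [← lintegral_indicator hS]
  apply lintegral_congr; intro ξ
  by_cases h : ξ ∈ S <;> simp [h, hm]

lemma J_L2 {G : VC} (hG : Integrable G) {S : Set V2} (hS : MeasurableSet S) :
    ∫⁻ x, ‖J (S.indicator G) x‖ₑ ^ 2 ≤ (eO (2 * π) * g2 G S) ^ 2 := by
  refine (plancherel (hG.indicator hS)).trans_eq ?_
  rw [ind_lint G hS 2 nz, mul_pow, g2, sq_half, ← ENNReal.ofReal_pow pz]
  congr 2; ring

lemma J_sup : ∃ C : EN, C ≠ ⊤ ∧ ∀ (G : VC), Integrable G → ∀ S : Set V2, MeasurableSet S → ∀ r : ℝ, (∀ ξ ∈ S, ‖ξ‖ ≤ tw ^ r) →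
    ∀ x, ‖J (S.indicator G) x‖ₑ ≤ C * p2 r * g2 G S := by
  refine ⟨(volume (Metric.ball (0:V2) 1)) ^ hfw, rnt nz measure_ball_lt_top.ne,
    fun G hG S hS r hr x => (J_enorm_le _ x).trans ?_⟩
  have h1 := ind_lint G hS 1 nz
  simp only [pow_one] at h1
  rw [h1]
  have h2 := CS_lint (μ := volume.restrict S) (f := fun _ => 1) (g := fun ξ => ‖G ξ‖ₑ) fz
    hG.aestronglyMeasurable.enorm.restrict
  simp only [one_mul, one_pow, lintegral_const, Measure.restrict_apply MeasurableSet.univ, Set.univ_inter] at h2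
  have h3 : volume S ≤ p2 r ^ 2 * volume (Metric.ball (0:V2) 1) := by
    refine (measure_mono (t := Metric.closedBall (0:V2) (tw ^ r)) fun ξ hξ => by simpa using hr ξ hξ).trans ?_
    rw [Measure.addHaar_closedBall _ _ pz]
    simp [p2]
    rw [← ENNReal.ofReal_pow pz]
  have h4 := ENNReal.rpow_le_rpow (h2.trans (mul_le_mul_left h3 _)) (z := 1 / tw) nz
  rw [half_sq, mrn _ _ nz, mrn _ _ nz, half_sq,
    mul_comm (p2 r)] at h4
  exact h4

lemma J_Lq {q : ℝ} (hq : 2 < q) : ∃ C : EN, C ≠ ⊤ ∧ ∀ (G : VC), Integrable G → ∀ S : Set V2, MeasurableSet S → ∀ r : ℝ, (∀ ξ ∈ S, ‖ξ‖ ≤ tw ^ r) →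
    g2 G S ≠ ⊤ → LQ q (fun x => ‖J (S.indicator G) x‖ₑ) ≤ C * p2 (r * (1 - 2 / q)) * g2 G S := by
  obtain ⟨C, hC, h⟩ := J_sup
  have h0 : 0 ≤ 1 - 2 / q := by rw [sub_nonneg, div_le_one lz]; exact hq.le
  refine ⟨C ^ (1 - 2 / q) * (eO (2 * π)) ^ (2 / q), mnt (rnt h0 hC)
    (rnt pz ENNReal.ofReal_ne_top), fun G hG S hS r hr hg => ?_⟩
  refine (LQ_interp hq.le (by finiteness [p2_ne_top r]) (h G hG S hS r hr)).trans ?_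
  refine (MLR (rle (J_L2 hG hS) pz) _).trans_eq ?_
  have e : ((eO (2 * π) * g2 G S) ^ 2) ^ (1 / q) = eO (2 * π) ^ (2 / q) * g2 G S ^ (2 / q) := by
    rw [← eR2, ← eRm, mrn _ _ pz, mul_one_div]
  rw [e, mrn _ _ h0, mrn _ _ h0, p2_rpow]
  have e2 : g2 G S = g2 G S ^ (1 - 2 / q) * g2 G S ^ (2 / q) := by
    rw [← eRa _ _ h0 pz]; simp
  conv_rhs => rw [e2]
  ring

lemma Ck_add (h : IsKer κ M) (k : ℤ) {H1 H2 : VC} (h1 : Continuous H1) (h2 : Continuous H2)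
    (b1 : ∃ C, ∀ x, ‖H1 x‖ ≤ C) (b2 : ∃ C, ∀ x, ‖H2 x‖ ≤ C) (x : V2) :
    Ck κ k (fun y => H1 y + H2 y) x = Ck κ k H1 x + Ck κ k H2 x := by
  have key : ∀ {H : VC}, Continuous H → (∃ C, ∀ x, ‖H x‖ ≤ C) →
      Integrable fun z => κ z * H (x - (tw ^ (-k)) • z) := by
    rintro H hH ⟨C, hC⟩
    exact h.integrable.mul_bdd (c := C) (Continuous.aestronglyMeasurable fz) (fall fun z => hC _)
  unfold Ck
  simp_rw [mul_add]
  exact integral_add (key h1 b1) (key h2 b2)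

lemma J_bdd {G : VC} (hG : Integrable G) : ∃ C, ∀ x, ‖J G x‖ ≤ C := by
  refine ⟨∫ ξ, ‖G ξ‖, fun x => ?_⟩
  refine (norm_integral_le_integral_norm _).trans_eq ?_
  simp only [norm_mul, ph_norm, one_mul]

lemma bdd_mul' {f g : VC} (hf : ∃ C, ∀ x, ‖f x‖ ≤ C) (hg : ∃ C, ∀ x, ‖g x‖ ≤ C) : ∃ C, ∀ x, ‖f x * g x‖ ≤ C := by
  obtain ⟨C, hC⟩ := hf; obtain ⟨D, hD⟩ := hg
  refine ⟨C * D, fun x => ?_⟩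
  rw [norm_mul]
  exact mul_le_mul (hC x) (hD x) (norm_nonneg _) ((norm_nonneg _).trans (hC x))

lemma tsum_int_le (f : ℤ → EN) : ∑' k, f k = ∑' n : ℕ, f (-(n:ℤ)) + ∑' n : ℕ, f (n + 1) := by
  have h := HasSum.of_nat_of_neg_add_one (f := fun k => f (-k)) (ENNReal.summable (f := fun n : ℕ => f (-(n:ℤ)))).hasSum
    (m' := ∑' n : ℕ, f (n + 1)) (by
      simp only [neg_neg]
      exact (ENNReal.summable (f := fun n : ℕ => f ((n:ℤ) + 1))).hasSum)
  rw [← h.tsum_eq]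
  exact ((Equiv.neg ℤ).tsum_eq f).symm

def DA (a : ℝ) (A : SchwartzMap V2 ℂ) : V2 → ℂ := J (fun ξ => ((‖ξ‖ ^ a : ℝ) : ℂ) * nft A ξ)

lemma DA_cont {a : ℝ} (ha : 0 ≤ a) (A : SchwartzMap V2 ℂ) : Continuous (DA a A) := J_cont (nft_pow_int A ha)

lemma Ck_meas (h : IsKer κ M) (k : ℤ) {H : VC} (hH : Continuous H) : Measurable (Ck κ k H) := by
  have h1 : Continuous (fun p : V2 × V2 => κ p.2 * H (p.1 - (tw ^ (-k)) • p.2)) := by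
    have := h.cont; fun_prop
  exact (h1.stronglyMeasurable.integral_prod_right (ν := volume)).measurable

lemma psiA {a : ℝ} (ha : 0 ≤ a) (A : SchwartzMap V2 ℂ) {lam : VC}
    (hl : IsKer lam (fun ζ => ((‖ζ‖ ^ (-a) : ℝ) : ℂ) * (psi ζ : ℂ))) (i : ℤ) (x : V2) :
    ‖J (fun ξ => (psi (tw ^ (-i) • ξ) : ℂ) * nft A ξ) x‖ₑ = p2 (-(i * a)) * ‖Ck lam i (DA a A) x‖ₑ := by
  have h1 : Ck lam i (DA a A) x = ((tw ^ (i * a) : ℝ) : ℂ) * J (fun ξ => (psi (tw ^ (-i) • ξ) : ℂ) * nft A ξ) x := by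
    rw [DA, Ck_J (nft_pow_int A ha) hl, ← J_const_mul]
    congr 1; ext ξ
    by_cases h0 : ξ = 0
    · subst h0; simp [psi_lo (ζ := 0) (by simp)]
    · have hr : 0 < ‖ξ‖ := norm_pos_iff.2 h0
      have : (‖tw ^ (-i) • ξ‖) ^ (-a) * ‖ξ‖ ^ a = tw ^ (i * a) := by
        rw [norm_sc, Real.mul_rpow pz hr.le, mul_assoc, ← Real.rpow_add hr, neg_add_cancel, Real.rpow_zero,
          mul_one, ← Real.rpow_intCast, ← Real.rpow_mul nz]
        push_cast; congr 1; ring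
      rw [← this]; push_cast; ring
  rw [h1, enorm_mul, ← mul_assoc,
    ← ofReal_norm ((tw ^ (i * a) : ℝ) : ℂ), Complex.norm_real, nrn pz]
  change _ = p2 _ * p2 _ * _
  rw [← p2_add, neg_add_cancel, p2_zero, one_mul]

lemma Ahi_Lq {a q : ℝ} (ha : 0 < a) (hq : 1 < q) : ∃ C : EN, C ≠ ⊤ ∧ ∀ (A : SchwartzMap V2 ℂ) (K : ℤ),
    LQ q (fun x => ‖A x - J (fun ξ => (chi (tw ^ (-K) • ξ) : ℂ) * nft A ξ) x‖ₑ) ≤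
      C * p2 (-(K * a)) * LQ q (fun x => ‖DA a A x‖ₑ) := by
  obtain ⟨lam, hl⟩ := pow_ker (-a)
  refine ⟨(∫⁻ z, ‖lam z‖ₑ) * ∑' i : ℕ, p2 (-(a * i)), mnt hl.integrable.2.ne (p2_geom ha), fun A K => ?_⟩
  have h1 : ∀ x, ‖A x - J (fun ξ => (chi (tw ^ (-K) • ξ) : ℂ) * nft A ξ) x‖ₑ ≤
      ∑' i : ℕ, p2 (-(((K + 1 + i : ℤ) : ℝ) * a)) * ‖Ck lam (K + 1 + i) (DA a A) x‖ₑ := by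
    intro x
    rw [← J_nft A x]
    refine (LP_hi (nft_integrable0 A) K x).trans_eq ?_
    exact tsum_congr fun i => psiA ha.le A hl _ x
  have hm : ∀ i : ℤ, Measurable fun x => ‖Ck lam i (DA a A) x‖ₑ := fun i => (Ck_meas hl i (DA_cont ha.le A)).enorm
  refine (LQ_mono lz h1).trans ((LQ_tsum hq.le fun i => (hm _).const_mul _).trans ?_)
  have h2 : ∀ i : ℕ, LQ q (fun x => p2 (-(((K + 1 + i : ℤ) : ℝ) * a)) * ‖Ck lam (K + 1 + i) (DA a A) x‖ₑ) ≤
      p2 (-(a * i)) * ((∫⁻ z, ‖lam z‖ₑ) * p2 (-(K * a)) * LQ q (fun x => ‖DA a A x‖ₑ)) := by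
    intro i
    rw [LQ_cmul lz _ (hm _)]
    refine (mul_le_mul' (p2_mono (s := -(a * i) + -(K * a)) (by push_cast; nlinarith))
      (Ck_Lq hq hl (K + 1 + i) (DA_cont ha.le A).measurable)).trans_eq ?_
    rw [p2_add]; unfold LQ; ring
  refine (tle h2).trans_eq ?_
  rw [ENNReal.tsum_mul_right]; ring

lemma A_sup {a q : ℝ} (ha : 0 < a) (hq : 1 < q) (haq : 2 < a * q) : ∃ C : EN, C ≠ ⊤ ∧ ∀ (A : SchwartzMap V2 ℂ) (x : V2),
    ‖A x‖ₑ ≤ C * (LQ q (fun x => ‖A x‖ₑ) + LQ q (fun x => ‖DA a A x‖ₑ)) := by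
  obtain ⟨lam, hl⟩ := pow_ker (-a)
  obtain ⟨ch, hc⟩ := chi_ker
  obtain ⟨C1, hC1, h1⟩ := Ck_sup hc hq
  obtain ⟨C2, hC2, h2⟩ := Ck_sup hl hq
  have hd : 0 < a - 2 / q := by rw [sub_pos, div_lt_iff₀ lz]; exact haq
  refine ⟨C1 + C2 * ∑' i : ℕ, p2 (-((a - 2 / q) * i)), by finiteness [p2_geom hd], fun A x => ?_⟩
  set X := LQ q (fun x => ‖A x‖ₑ)
  set Y := LQ q (fun x => ‖DA a A x‖ₑ)
  have e0 : (A : VC) = J (nft A) := by ext y; exact (J_nft A y).symm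
  have h3 : ‖Ck ch 0 A x‖ₑ ≤ C1 * X := by simpa [p2_zero] using h1 0 A A.continuous.measurable x
  have h4 := LP_hi (nft_integrable0 A) 0 x
  have e1 : J (fun ξ => (chi (tw ^ (-(0:ℤ)) • ξ) : ℂ) * nft A ξ) x = Ck ch 0 A x := by
    rw [e0, Ck_J (nft_integrable0 A) hc]
    rw [← e0]
  rw [e1, J_nft] at h4
  have h5 : ∀ i : ℕ, ‖J (fun ξ => (psi (tw ^ (-(0 + 1 + i : ℤ)) • ξ) : ℂ) * nft A ξ) x‖ₑ ≤
      p2 (-((a - 2 / q) * i)) * (C2 * Y) := by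
    intro i
    rw [psiA ha.le A hl]
    refine (MLR (h2 _ _ (DA_cont ha.le A).measurable x) _).trans ?_
    calc _ = (p2 (-(((0 + 1 + i : ℤ) : ℝ) * a)) * p2 (((0 + 1 + i : ℤ) : ℝ) * (2 / q))) * (C2 * Y) := by ring
      _ ≤ _ := by
        rw [← p2_add]
        refine MLL (p2_mono ?_) _
        push_cast; nlinarith
  calc ‖A x‖ₑ = ‖(A x - Ck ch 0 A x) + Ck ch 0 A x‖ₑ := by rw [sub_add_cancel]
    _ ≤ _ := enorm_add_le _ _
    _ ≤ (∑' i : ℕ, p2 (-((a - 2 / q) * i))) * (C2 * Y) + C1 * X := by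
      refine add_le_add (h4.trans ((tle h5).trans_eq ?_)) h3
      rw [ENNReal.tsum_mul_right]
    _ = C2 * (∑' i : ℕ, p2 (-((a - 2 / q) * i))) * Y + C1 * X := by ring
    _ ≤ _ := by
      rw [add_mul, mul_add, mul_add]
      exact (add_comm _ _).le.trans (add_le_add le_self_add le_add_self)

lemma hls_c {q : ℝ} (hq : 2 < q) : ∃ C : EN, C ≠ ⊤ ∧ ∀ (F : VC) (G : VC) (S : Set V2), Measurable F → Integrable G → MeasurableSet S →
    LQ q (RT (fun y => ‖F y * J (S.indicator G) y‖ₑ)) ≤ C * LQ q (fun y => ‖F y‖ₑ) * g2 G S := by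
  obtain ⟨C, hC, h⟩ := hls2 q hq
  refine ⟨C * eO (2 * π), by finiteness, fun F G S hF hG hS => ?_⟩
  simp_rw [enorm_mul]
  refine (h (fun y => ‖F y‖ₑ) (fun y => ‖J (S.indicator G) y‖ₑ) hF.enorm (J_cont (hG.indicator hS)).measurable.enorm).trans ?_
  have := ENNReal.rpow_le_rpow (J_L2 hG hS) (z := 1 / tw) nz
  rw [half_sq] at this
  simp_rw [eR2]
  refine (MLR (MLR this _) _).trans_eq ?_
  unfold LQ; ring

lemma ind_split (G : VC) (hG : Integrable G) {S : Set V2} (hS : MeasurableSet S) (y : V2) :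
    J G y = J (S.indicator G) y + J (Sᶜ.indicator G) y := by
  rw [← J_add (hG.indicator hS) (hG.indicator hS.compl)]
  congr 1; ext ξ
  by_cases h : ξ ∈ S <;> simp [h]

lemma LQ_mul_sup {q : ℝ} (hq : 0 < q) {f g : VC} (hg : Measurable g) {B : EN} (h : ∀ y, ‖f y‖ₑ ≤ B) :
    LQ q (fun y => ‖f y * g y‖ₑ) ≤ B * LQ q (fun y => ‖g y‖ₑ) := by
  rw [← LQ_cmul hq _ hg.enorm]
  refine LQ_mono hq.le fun y => ?_
  rw [enorm_mul]; exact MLL (h y) _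

lemma cmul {f g : VC} (hf : Continuous f) (hg : Continuous g) : Continuous fun y => f y * g y := hf.mul hg
lemma cadd {f g : VC} (hf : Continuous f) (hg : Continuous g) : Continuous fun y => f y + g y := hf.add hg

lemma lin_pos {a q s : ℝ} (ha : 0 < a) (hs : 0 < s) (hq : 2 < q) (haq : 2 < a * q) (h : IsKer κ M)
    (hlo : Lowz M) (hhi : Hiwz M) : ∃ C : EN, C ≠ ⊤ ∧
    ∀ (A : SchwartzMap V2 ℂ) (G : VC), Integrable G → gam s G ≠ ⊤ → ∀ k : ℤ,
      LQ q (fun x => ‖Ck κ k (fun y => A y * J G y) x‖ₑ) ≤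
        C * (p2 (k * (1 - 2 / q - s)) + p2 (k * (1 - a - s / 2)) + p2 (k * (1 / 2 - a))) *
          ((LQ q (fun x => ‖A x‖ₑ) + LQ q (fun x => ‖DA a A x‖ₑ)) * gam s G) := by
  have hq1 : 1 < q := by linarith
  have hq0 : 0 < q := by linarith
  obtain ⟨ch, hc⟩ := chi_ker
  obtain ⟨C1, hC1, h1⟩ := A_sup ha hq1 haq
  obtain ⟨C2, hC2, h2⟩ := Ahi_Lq ha hq1
  obtain ⟨C3, hC3, h3⟩ := J_Lq hq
  obtain ⟨C4, hC4, h4⟩ := J_sup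
  obtain ⟨C5, hC5, h5⟩ := hls_c hq
  obtain ⟨C6, hC6, h6⟩ := Ck_RT h
  set c0 := ∫⁻ z, ‖κ z‖ₑ with hc0
  have hc0t : c0 ≠ ⊤ := h.integrable.2.ne
  set c1 := ∫⁻ z, ‖ch z‖ₑ with hc1
  have hc1t : c1 ≠ ⊤ := hc.integrable.2.ne
  set D1 := c0 * c1 * C1 * C3 * p2 (2 * (1 - 2 / q)) * p2 (2 * s) with hD1
  set D2 := C6 * C5 * C2 * p2 (4 * a) with hD2
  set D3 := c0 * C4 * C2 * p2 (4 * a) with hD3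
  refine ⟨D1 + D2 + D3, by simp only [hD1, hD2, hD3]; finiteness [p2_ne_top (2 * (1 - 2 / q)), p2_ne_top (2 * s), p2_ne_top (4 * a)], fun A G hG hγ k => ?_⟩
  set X := LQ q (fun x => ‖A x‖ₑ) + LQ q (fun x => ‖DA a A x‖ₑ) with hX
  set γ := gam s G with hγd
  set GA : V2 → ℂ := fun ξ => (chi (tw ^ (-(k - 4)) • ξ) : ℂ) * nft A ξ with hGA
  have hGAi : Integrable GA := chik_int (nft_integrable0 A) (k - 4)
  set Hi : V2 → ℂ := fun y => A y - J GA y with hHi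
  have hHic : Continuous Hi := A.continuous.sub (J_cont hGAi)
  have e0 : (A : VC) = J (nft A) := by ext y; exact (J_nft A y).symm
  have hAb : ∃ C, ∀ x, ‖A x‖ ≤ C := by rw [e0]; exact J_bdd (nft_integrable0 A)
  have hHib : ∃ C, ∀ x, ‖Hi x‖ ≤ C := by
    obtain ⟨c, hc⟩ := hAb; obtain ⟨d, hd⟩ := J_bdd hGAi
    exact ⟨c + d, fun x => (norm_sub_le _ _).trans (add_le_add (hc x) (hd x))⟩
  have hHiq : LQ q (fun y => ‖Hi y‖ₑ) ≤ C2 * p2 (4 * a) * p2 (-(k * a)) * X := by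
    refine (h2 A (k - 4)).trans ?_
    refine (mul_le_mul_right (le_add_self (a := LQ q (fun x => ‖DA a A x‖ₑ)) (b := LQ q (fun x => ‖A x‖ₑ))) _).trans_eq ?_
    rw [← hX]; congr 1
    rw [mul_assoc, ← p2_add]; congr 2; push_cast; ring
  -- the sets
  set S : Set V2 := {ξ | tw ^ ((k:ℝ) - 2) ≤ ‖ξ‖ ∧ ‖ξ‖ ≤ tw ^ ((k:ℝ) + 2)} with hS
  have hSm : MeasurableSet S := (measurableSet_le measurable_const measurable_norm).inter (measurableSet_le measurable_norm measurable_const)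
  set T : Set V2 := {ξ | tw ^ ((k:ℝ) / 2) ≤ ‖ξ‖} with hT
  have hTm : MeasurableSet T := measurableSet_le measurable_const measurable_norm
  -- splitting
  have split : ∀ x, ‖Ck κ k (fun y => A y * J G y) x‖ₑ ≤ ‖Ck κ k (fun y => J GA y * J (S.indicator G) y) x‖ₑ +
      (‖Ck κ k (fun y => Hi y * J (T.indicator G) y) x‖ₑ + ‖Ck κ k (fun y => Hi y * J (Tᶜ.indicator G) y) x‖ₑ) := by
    intro x
    have i1 := J_cont hGAi
    have i2 := J_bdd hGAi
    have jS := hG.indicator hSm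
    have jS' := hG.indicator hSm.compl
    have jT := hG.indicator hTm
    have jT' := hG.indicator hTm.compl
    have f1 : (fun y => A y * J G y) = fun y => (J GA y * J (S.indicator G) y + J GA y * J (Sᶜ.indicator G) y) +
        (Hi y * J (T.indicator G) y + Hi y * J (Tᶜ.indicator G) y) := by
      ext y
      rw [← mul_add, ← mul_add, ← ind_split G hG hSm, ← ind_split G hG hTm, hHi]; ring
    have bd : ∀ {f g : VC}, (∃ C, ∀ x, ‖f x‖ ≤ C) → (∃ C, ∀ x, ‖g x‖ ≤ C) → ∃ C, ∀ x, ‖f x + g x‖ ≤ C := by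
      rintro f g ⟨c, hc⟩ ⟨d, hd⟩
      exact ⟨c + d, fun x => (norm_add_le _ _).trans (add_le_add (hc x) (hd x))⟩
    have b1 := bdd_mul' i2 (J_bdd jS)
    have b2 := bdd_mul' i2 (J_bdd jS')
    have b3 := bdd_mul' hHib (J_bdd jT)
    have b4 := bdd_mul' hHib (J_bdd jT')
    have d1 := cmul i1 (J_cont jS)
    have d2 := cmul i1 (J_cont jS')
    have d3 := cmul hHic (J_cont jT)
    have d4 := cmul hHic (J_cont jT')
    rw [f1, Ck_add h k (cadd d1 d2) (cadd d3 d4) (bd b1 b2) (bd b3 b4), Ck_add h k d1 d2 b1 b2, Ck_add h k d3 d4 b3 b4,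
      Ck_JJ_zero hGAi jS' h k _ x, add_zero]
    · exact (enorm_add_le _ _).trans (by gcongr; exact enorm_add_le _ _)
    · intro ξ η hξ hη
      have hk : (0:ℝ) < tw ^ (-k) := by positivity
      have hk2 : tw ^ (-k) * tw ^ (k:ℝ) = 1 := by
        rw [Real.rpow_intCast, ← zpow_add₀ nz]; simp
      have a1 : ‖ξ‖ < tw ^ (k:ℝ) / 8 := by
        by_contra hcon
        push Not at hcon
        apply hξ
        rw [hGA]
        simp only
        rw [chi_zero]
        · simp
        · rw [norm_sc, show -(k - 4) = -k + 4 by ring, zpow_add₀ nz]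
          have := mlr hcon hk.le
          rw [← mul_div_assoc, hk2] at this
          have e16 : tw ^ (4:ℤ) = 16 := by norm_num
          rw [e16]; linarith
      have a2 : η ∉ S := by
        intro hc; apply hη; simp [hc]
      have r1 : tw ^ ((k:ℝ) - 2) = tw ^ (k:ℝ) / 4 := by
        rw [Real.rpow_sub nz]; norm_num
      have r2 : tw ^ ((k:ℝ) + 2) = tw ^ (k:ℝ) * 4 := by
        rw [Real.rpow_add nz]; norm_num
      by_cases a3 : tw ^ (k:ℝ) / 4 ≤ ‖η‖
      · have a4 : tw ^ (k:ℝ) * 4 < ‖η‖ := by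
          by_contra hc
          push Not at hc
          exact a2 ⟨by rw [r1]; exact a3, by rw [r2]; exact hc⟩
        apply hhi
        rw [norm_sc]
        have := norm_sub_le (ξ + η) ξ
        rw [add_sub_cancel_left] at this
        have t : tw ^ (k:ℝ) * 2 ≤ ‖ξ + η‖ := by linarith [show (0:ℝ) < tw ^ (k:ℝ) by positivity]
        have := mlr t hk.le
        rw [← mul_assoc, hk2] at this; linarith
      · push Not at a3
        apply hlo
        rw [norm_sc]
        have t : ‖ξ + η‖ ≤ tw ^ (k:ℝ) / 2 := by linarith [norm_add_le ξ η, show (0:ℝ) < tw ^ (k:ℝ) by positivity]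
        have := mlr t hk.le
        rw [← mul_div_assoc, hk2] at this; linarith
  -- estimate of the three terms
  have gS := h3 G hG S hSm (k + 2) (fun ξ hξ => hξ.2) ((g2_le_gam hs.le G S).trans_lt hγ.lt_top).ne
  have gS2 := g2_le hs.le G hSm (r := k - 2) (fun ξ hξ => hξ.1)
  have E1 : LQ q (fun x => ‖Ck κ k (fun y => J GA y * J (S.indicator G) y) x‖ₑ) ≤ D1 * p2 (k * (1 - 2 / q - s)) * (X * γ) := by
    have cS := J_cont (hG.indicator hSm)
    refine (Ck_Lq hq1 h k ((J_cont hGAi).mul cS).measurable).trans ?_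
    have b : ∀ y, ‖J GA y‖ₑ ≤ c1 * (C1 * X) := by
      intro y
      have : J GA y = Ck ch (k - 4) A y := by rw [e0, Ck_J (nft_integrable0 A) hc, hGA]
      rw [this]
      refine (Ck_enorm_le _ _ _ _).trans ?_
      refine (lintegral_mono fun z => MLR (h1 A _) _).trans_eq ?_
      rw [lintegral_mul_const _ hc.cont.measurable.enorm]
    refine (MLR (LQ_mul_sup hq0 cS.measurable b) _).trans ?_
    refine (MLR (MLR (gS.trans (MLR gS2 _)) _) _).trans_eq ?_
    rw [show ((k:ℝ) + 2) * (1 - 2 / q) = k * (1 - 2 / q) + 2 * (1 - 2 / q) by ring,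
      show -(((k:ℝ) - 2) * s) = k * (-s) + 2 * s by ring, show (k:ℝ) * (1 - 2 / q - s) = k * (1 - 2 / q) + k * (-s) by ring,
      p2_add, p2_add, p2_add, hD1]
    ring
  have E2 : LQ q (fun x => ‖Ck κ k (fun y => Hi y * J (T.indicator G) y) x‖ₑ) ≤ D2 * p2 (k * (1 - a - s / 2)) * (X * γ) := by
    have cT := J_cont (hG.indicator hTm)
    have mm : Measurable fun y => Hi y * J (T.indicator G) y := (hHic.mul cT).measurable
    refine (LQ_mono hq0.le (h6 k _ mm)).trans ?_
    rw [LQ_cmul hq0 _ (RT_meas mm.enorm)]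
    refine (MLR (h5 Hi G T hHic.measurable hG hTm) _).trans ?_
    refine (mul_le_mul_right (mul_le_mul' (mul_le_mul_right hHiq _) (g2_le hs.le G hTm (r := k / 2) (fun ξ hξ => hξ))) _).trans_eq ?_
    rw [show (k:ℝ) * (1 - a - s / 2) = k + -(k * a) + -(k / 2 * s) by ring, p2_add, p2_add, hD2]
    ring
  have E3 : LQ q (fun x => ‖Ck κ k (fun y => Hi y * J (Tᶜ.indicator G) y) x‖ₑ) ≤ D3 * p2 (k * (1 / 2 - a)) * (X * γ) := by
    have cT := J_cont (hG.indicator hTm.compl)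
    refine (Ck_Lq hq1 h k (hHic.mul cT).measurable).trans ?_
    have b := h4 G hG Tᶜ hTm.compl (k / 2) (fun ξ hξ => by
      have : ¬ (tw ^ ((k:ℝ) / 2) ≤ ‖ξ‖) := hξ
      exact (not_le.1 this).le)
    have e : (fun x => ‖Hi x * J (Tᶜ.indicator G) x‖ₑ) = fun x => ‖J (Tᶜ.indicator G) x * Hi x‖ₑ := by
      ext x; rw [mul_comm]
    have L := LQ_mul_sup hq0 hHic.measurable b
    rw [← e] at L
    refine (MLR (L.trans (mul_le_mul' (MLR (g2_le_gam hs.le G _) _) hHiq)) _).trans_eq ?_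
    rw [show (k:ℝ) * (1 / 2 - a) = k / 2 + -(k * a) by ring, p2_add, hD3]
    ring
  have m1 := (Ck_meas h k (cmul (J_cont hGAi) (J_cont (hG.indicator hSm)))).enorm
  have m2 := (Ck_meas h k (cmul hHic (J_cont (hG.indicator hTm)))).enorm
  have m3 := (Ck_meas h k (cmul hHic (J_cont (hG.indicator hTm.compl)))).enorm
  refine (LQ_mono hq0.le split).trans ((LQ_add hq1.le m1 (m2.add m3)).trans ?_)
  refine (add_le_add E1 ((LQ_add hq1.le m2 m3).trans (add_le_add E2 E3))).trans ?_
  set P1 := p2 (k * (1 - 2 / q - s))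
  set P2 := p2 (k * (1 - a - s / 2))
  set P3 := p2 (k * (1 / 2 - a))
  rw [← add_mul, ← add_mul]
  refine MLL ?_ _
  calc D1 * P1 + (D2 * P2 + D3 * P3) ≤ (D1 + D2 + D3) * P1 + ((D1 + D2 + D3) * P2 + (D1 + D2 + D3) * P3) := by
        gcongr
        · exact le_self_add.trans le_self_add
        · exact le_add_self.trans le_self_add
        · exact le_add_self
    _ = _ := by ring

lemma Sb_eq (κ : VC) (b : ℝ) (H : VC) (x : V2) : Sb κ b H x = ∑' k : ℤ, p2 (k * (b - 1)) * ‖Ck κ k H x‖ₑ := rfl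

lemma linear_lem {a q s : ℝ} (ha : 0 < a) (hs : 0 < s) (hq : 2 < q) (haq : 2 < a * q) (h3 : a - s < 2 / q) (h : IsKer κ M)
    (hlo : Lowz M) (hhi : Hiwz M) : ∃ C : EN, C ≠ ⊤ ∧
    ∀ (A : SchwartzMap V2 ℂ) (G : VC), Integrable G → gam s G ≠ ⊤ → ∀ b, 0 ≤ b → b ≤ a →
      LQ q (Sb κ b (fun y => A y * J G y)) ≤
        C * ((LQ q (fun x => ‖A x‖ₑ) + LQ q (fun x => ‖DA a A x‖ₑ)) * gam s G) := by
  have hq1 : 1 < q := by linarith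
  have hq0 : 0 < q := by linarith
  obtain ⟨C1, hC1, h1⟩ := lin_pos ha hs hq haq h hlo hhi
  obtain ⟨C2, hC2, h2⟩ := Ck_RTsum h
  obtain ⟨C3, hC3, h4⟩ := hls_c hq
  have t1 := p2_geom (d := 2 / q + s - a) lz
  have t2 := p2_geom (d := s / 2) lz
  have t3 := p2_geom (d := 1 / 2) nz
  set T1 := ∑' n : ℕ, p2 (-((2 / q + s - a) * n))
  set T2 := ∑' n : ℕ, p2 (-(s / 2 * n))
  set T3 := ∑' n : ℕ, p2 (-((1:ℝ) / 2 * n))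
  refine ⟨C2 * C3 + C1 * (T1 + T2 + T3), by finiteness, fun A G hG hγ b hb hba => ?_⟩
  set X := LQ q (fun x => ‖A x‖ₑ) + LQ q (fun x => ‖DA a A x‖ₑ) with hX
  set γ := gam s G with hγd
  have hc : Continuous fun y => A y * J G y := cmul A.continuous (J_cont hG)
  have hm : ∀ k, Measurable fun x => ‖Ck κ k (fun y => A y * J G y) x‖ₑ := fun k => (Ck_meas h k hc).enorm
  have s1 : ∀ x, Sb κ b (fun y => A y * J G y) x ≤ C2 * RT (fun y => ‖A y * J G y‖ₑ) x +
      ∑' n : ℕ, p2 ((n + 1) * (a - 1)) * ‖Ck κ (n + 1) (fun y => A y * J G y) x‖ₑ := by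
    intro x
    rw [Sb_eq, tsum_int_le]
    refine add_le_add (le_trans (tle fun n => ?_) (h2 _ hc.measurable x)) (tle fun n => ?_)
    · refine MLL (p2_mono ?_) _
      push_cast; nlinarith [(Nat.cast_nonneg n : (0:ℝ) ≤ n)]
    · refine MLL (p2_mono ?_) _
      push_cast; nlinarith [(Nat.cast_nonneg n : (0:ℝ) ≤ n)]
  have mR := RT_meas hc.measurable.enorm
  have mm : ∀ n : ℕ, Measurable fun x => p2 ((n + 1) * (a - 1)) * ‖Ck κ (n + 1) (fun y => A y * J G y) x‖ₑ :=
    fun n => (hm _).const_mul _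
  refine (LQ_mono hq0.le s1).trans ((LQ_add hq1.le (mR.const_mul _) (Measurable.ennreal_tsum mm)).trans ?_)
  rw [add_mul]
  refine add_le_add ?_ ?_
  · rw [LQ_cmul hq0 _ mR, mul_assoc]
    refine MLR ?_ _
    have := h4 A G Set.univ A.continuous.measurable hG MeasurableSet.univ
    rw [Set.indicator_univ] at this
    refine this.trans ?_
    rw [mul_assoc]
    exact MLR (mul_le_mul' le_self_add (g2_le_gam hs.le G _)) _
  · refine (LQ_tsum hq1.le mm).trans ?_
    have key : ∀ n : ℕ, LQ q (fun x => p2 ((n + 1) * (a - 1)) * ‖Ck κ (n + 1) (fun y => A y * J G y) x‖ₑ) ≤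
        (p2 (-((2 / q + s - a) * n)) + p2 (-(s / 2 * n)) + p2 (-((1:ℝ) / 2 * n))) * (C1 * (X * γ)) := by
      intro n
      have hn : (0:ℝ) ≤ n := Nat.cast_nonneg n
      rw [LQ_cmul hq0 _ (hm _)]
      refine (MLR (h1 A G hG hγ (n + 1)) _).trans ?_
      rw [← hX, ← hγd]
      push_cast
      set P1 := p2 (((n:ℝ) + 1) * (1 - 2 / q - s)) with hP1
      set P2 := p2 (((n:ℝ) + 1) * (1 - a - s / 2)) with hP2
      set P3 := p2 (((n:ℝ) + 1) * (1 / 2 - a)) with hP3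
      set P0 := p2 (((n:ℝ) + 1) * (a - 1)) with hP0
      calc P0 * (C1 * (P1 + P2 + P3) * (X * γ)) = (P0 * P1 + P0 * P2 + P0 * P3) * (C1 * (X * γ)) := by ring
        _ ≤ _ := by
          refine MLL ?_ _
          rw [hP0, hP1, hP2, hP3, ← p2_add, ← p2_add, ← p2_add]
          refine add_le_add (add_le_add (p2_mono ?_) (p2_mono ?_)) (p2_mono ?_) <;> nlinarith
    refine (tle key).trans_eq ?_
    rw [ENNReal.tsum_mul_right, ENNReal.tsum_add, ENNReal.tsum_add]
    ring

lemma schur {ι ι' : Type*} [Countable ι] [Countable ι'] (K : ι → ι' → EN) (x : ι → EN) (y : ι' → EN) (D : EN)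
    (hr : ∀ i, ∑' j, K i j ≤ D) (hc : ∀ j, ∑' i, K i j ≤ D) :
    ∑' i, ∑' j, K i j * (x i * y j) ≤ D * ((∑' i, x i ^ 2) ^ hfw * (∑' j, y j ^ 2) ^ hfw) := by
  letI : MeasurableSpace (ι × ι') := ⊤
  have hm : ∀ f : ι × ι' → EN, Measurable f := fun f => measurable_from_top
  have h := CS_lint (μ := (Measure.count : Measure (ι × ι'))) (hm fun z => K z.1 z.2 ^ hfw * x z.1).aemeasurable
    (hm fun z => K z.1 z.2 ^ hfw * y z.2).aemeasurable
  simp only [lintegral_count] at h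
  have e1 : ∀ z : ι × ι', K z.1 z.2 ^ hfw * x z.1 * (K z.1 z.2 ^ hfw * y z.2) = K z.1 z.2 * (x z.1 * y z.2) := by
    intro z
    calc _ = (K z.1 z.2 ^ hfw) ^ 2 * (x z.1 * y z.2) := by ring
      _ = _ := by rw [sq_half]
  have b1 : ∑' z : ι × ι', (K z.1 z.2 ^ hfw * x z.1) ^ 2 ≤ D * ∑' i, x i ^ 2 := by
    rw [ENNReal.tsum_prod (f := fun i j => (K i j ^ hfw * x i) ^ 2), ← ENNReal.tsum_mul_left]
    refine tle fun i => ?_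
    simp_rw [mul_pow, sq_half]
    rw [ENNReal.tsum_mul_right]
    exact MLL (hr i) _
  have b2 : ∑' z : ι × ι', (K z.1 z.2 ^ hfw * y z.2) ^ 2 ≤ D * ∑' i, y i ^ 2 := by
    rw [ENNReal.tsum_prod (f := fun i j => (K i j ^ hfw * y j) ^ 2), ENNReal.tsum_comm, ← ENNReal.tsum_mul_left]
    refine tle fun i => ?_
    simp_rw [mul_pow, sq_half]
    rw [ENNReal.tsum_mul_right]
    exact MLL (hc i) _
  simp_rw [e1] at h
  rw [ENNReal.tsum_prod (f := fun i j => K i j * (x i * y j))] at h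
  have h2 := ENNReal.rpow_le_rpow (h.trans (mul_le_mul' b1 b2)) (z := 1 / tw) nz
  rw [half_sq] at h2
  refine h2.trans_eq ?_
  rw [show ∀ a b : EN, D * a * (D * b) = D ^ 2 * (a * b) by intros; ring,
    mrn _ _ nz, mrn _ _ nz, half_sq]

lemma abs_geom {d : ℝ} (hd : 0 < d) : ∃ C : EN, C ≠ ⊤ ∧ ∀ l : ℤ, ∑' k : ℤ, p2 (-(d * |((l - k : ℤ) : ℝ)|)) ≤ C := by
  have t := p2_geom hd
  set T := ∑' n : ℕ, p2 (-(d * n)) with hT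
  refine ⟨T + T, by finiteness, fun l => ?_⟩
  have e := (Equiv.subLeft l).tsum_eq (fun k : ℤ => p2 (-(d * |((k : ℤ) : ℝ)|)))
  simp only [Equiv.subLeft_apply] at e
  rw [e, tsum_int_le]
  refine add_le_add (tle fun n => p2_mono ?_) (tle fun n => p2_mono ?_)
  · push_cast; rw [abs_neg, Nat.abs_cast]
  · push_cast
    rw [abs_of_nonneg pz]
    nlinarith

lemma coef {b a p q s : ℝ} (hb : 0 ≤ b) (hba : b ≤ a) (hs : 0 < s) (hq : 2 < q) (hp : 2 < p) (h1 : 1 / p < 1 / 2 - 1 / q)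
    (h2 : 1 - 2 / q + a - 2 * s ≤ 1 / p) (h3 : a - s < 2 / q) : ∃ C δ : ℝ, 0 < δ ∧
    ∀ k l m : ℤ, m ≤ l → k ≤ l + 2 → (l - 1 ≤ m ∨ l - 1 ≤ k) →
      k * (b - 1) + (min k l : ℤ) * (1 - 2 / q - 1 / p) + l * (1 / (2 * p)) + (min k m : ℤ) * (1 - 1 / p) + m * (1 / (2 * p))
        - s * (max l 0 : ℤ) - s * (max m 0 : ℤ) ≤ C - δ * (|((l - m : ℤ) : ℝ)| + |((l - k : ℤ) : ℝ)|) := by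
  have e2 : 1 / (2 * p) = (1 / p) / 2 := by field_simp
  have e3 : tw / q = 2 * (1 / q) := by ring
  have hP : 0 < 1 / p := by positivity
  have hQ : 0 < 1 / q := by positivity
  simp only [e2, e3] at h2 h3 ⊢
  generalize 1 / p = P at *
  generalize 1 / q = Q at *
  obtain ⟨A, hA⟩ : ∃ A, A = b - 2 * Q - P / 2 := ⟨_, rfl⟩
  obtain ⟨B, hB⟩ : ∃ B, B = 1 - P / 2 := ⟨_, rfl⟩
  obtain ⟨γ, hγ⟩ : ∃ γ, γ = 1 + b - 2 * Q - 2 * P := ⟨_, rfl⟩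
  obtain ⟨β, hβ⟩ : ∃ β, β = b - 2 * Q - P := ⟨_, rfl⟩
  obtain ⟨δ, hδ, hd1, hd2, hd3⟩ : ∃ δ : ℝ, 0 < δ ∧ δ ≤ γ ∧ δ ≤ s - A ∧ δ ≤ B := by
    refine ⟨min γ (min (s - A) B), ?_, min_le_left _ _, (min_le_right _ _).trans (min_le_left _ _), (min_le_right _ _).trans (min_le_right _ _)⟩
    refine lt_min (by rw [hγ]; linarith) (lt_min (by rw [hA]; linarith) (by rw [hB]; linarith))
  refine ⟨2 * γ + s + 2 * |β| + 5 * δ, δ, hδ, fun k l m hml hk hor => ?_⟩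
  have hβ1 := le_abs_self β
  have hβ2 := neg_abs_le β
  have hβ0 := abs_nonneg β
  have c1 : ((min k l : ℤ) : ℝ) ≤ k := by exact_mod_cast min_le_left _ _
  have c2 : ((min k m : ℤ) : ℝ) ≤ k := by exact_mod_cast min_le_left _ _
  have c3 : ((min k m : ℤ) : ℝ) ≤ m := by exact_mod_cast min_le_right _ _
  have c4 : (l:ℝ) ≤ (max l 0 : ℤ) := by exact_mod_cast le_max_left _ _
  have c5 : (m:ℝ) ≤ (max m 0 : ℤ) := by exact_mod_cast le_max_left _ _
  have c6 : (0:ℝ) ≤ (max l 0 : ℤ) := by exact_mod_cast le_max_right _ _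
  have c7 : (0:ℝ) ≤ (max m 0 : ℤ) := by exact_mod_cast le_max_right _ _
  have c8 : (m:ℝ) ≤ l := by exact_mod_cast hml
  have c9 : (k:ℝ) ≤ l + 2 := by exact_mod_cast hk
  set L := ((max l 0 : ℤ) : ℝ)
  set R := ((max m 0 : ℤ) : ℝ)
  have ab1 : |((l - m : ℤ) : ℝ)| = l - m := by push_cast; exact abs_of_nonneg lz
  have ab2 : |((l - k : ℤ) : ℝ)| ≤ (l - k) + 4 := by push_cast; rw [abs_le]; constructor <;> linarith
  have step : δ * (|((l - m : ℤ) : ℝ)| + |((l - k : ℤ) : ℝ)|) ≤ δ * ((l - m) + (l - k) + 4) := by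
    rw [ab1]; exact mlr lz hδ.le
  have m1 : ((min k l : ℤ) : ℝ) * (1 - 2 * Q - P) ≤ k * (1 - 2 * Q - P) := mul_le_mul_of_nonneg_right c1 lz
  rcases hor with ho | ho
  · have d1 : (l:ℝ) - 1 ≤ m := by exact_mod_cast ho
    have m2 : ((min k m : ℤ) : ℝ) * (1 - P) ≤ k * (1 - P) := mul_le_mul_of_nonneg_right c2 lz
    have m3 : (m:ℝ) * (P / 2) ≤ l * (P / 2) := mul_le_mul_of_nonneg_right c8 lz
    have hLR : L - 1 ≤ R := by
      have : max l 0 - 1 ≤ max m 0 := by omega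
      have h := (Int.cast_le (R := ℝ)).2 this
      push_cast at h
      simpa [L, R] using h
    have m4 : s * (L - 1) ≤ s * R := mlr hLR hs.le
    have m5 : (l:ℝ) * (γ + P) ≤ 2 * s * L := by
      calc (l:ℝ) * (γ + P) ≤ L * (γ + P) := mul_le_mul_of_nonneg_right c4 lz
        _ ≤ L * (2 * s) := mlr (by rw [hγ]; linarith) c6
        _ = _ := by ring
    have m6 : (δ - γ) * (l + 2 - k) ≤ 0 := mul_nonpos_of_nonpos_of_nonneg lz lz
    have m7 : δ * (l - m) ≤ δ * 1 := mlr lz hδ.le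
    have id : k * (b - 1) + k * (1 - 2 * Q - P) + k * (1 - P) = k * γ := by rw [hγ]; ring
    linarith
  · have d1 : (l:ℝ) - 1 ≤ k := by exact_mod_cast ho
    have m2 : ((min k m : ℤ) : ℝ) * (1 - P) ≤ m * (1 - P) := mul_le_mul_of_nonneg_right c3 lz
    have m3 : (k - l) * β ≤ 2 * |β| := by
      rcases le_total 0 β with hh | hh
      · rw [abs_of_nonneg hh]; exact mul_le_mul_of_nonneg_right lz hh
      · rw [abs_of_nonpos hh]; nlinarith
    have m4 : l * A + m * B - s * L - s * R ≤ - (δ * (l - m)) := by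
      have hAB : A + B = γ + P := by rw [hA, hB, hγ]; ring
      have hAB2 : γ + P ≤ 2 * s := by rw [hγ]; linarith
      rcases le_total 0 m with hm | hm
      · have hm' : (0:ℝ) ≤ m := by exact_mod_cast hm
        have i1 : s * l ≤ s * L := mlr c4 hs.le
        have i2 : s * m ≤ s * R := mlr c5 hs.le
        have i3 : (m:ℝ) * (A + B) ≤ m * (2 * s) := mlr lz hm'
        have i4 : ((l:ℝ) - m) * δ ≤ (l - m) * (s - A) := mlr hd2 lz
        linarith
      · have hm' : (m:ℝ) ≤ 0 := by exact_mod_cast hm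
        have i0 : 0 ≤ s * R := by positivity
        have i5 : (-(m:ℝ)) * δ ≤ -m * B := mlr hd3 lz
        rcases le_total 0 l with hl | hl
        · have hl' : (0:ℝ) ≤ l := by exact_mod_cast hl
          have i1 : s * l ≤ s * L := mlr c4 hs.le
          have i4 : (l:ℝ) * δ ≤ l * (s - A) := mlr hd2 hl'
          linarith
        · have hl' : (l:ℝ) ≤ 0 := by exact_mod_cast hl
          have i1 : 0 ≤ s * L := by positivity
          have i4 : (l:ℝ) * (A + B) ≤ 0 := mul_nonpos_of_nonpos_of_nonneg hl' lz
          have i6 : ((l:ℝ) - m) * δ ≤ (l - m) * B := mlr hd3 lz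
          linarith
    have m7 : δ * (l - k) ≤ δ * 1 := mlr lz hδ.le
    have id : k * (b - 1) + k * (1 - 2 * Q - P) = k * β := by rw [hβ]; ring
    have id2 : m * (1 - P) + m * (P / 2) = m * B := by rw [hB]; ring
    have id3 : l * β + l * (P / 2) = l * A := by rw [hA, hβ]; ring
    linarith

def Ann (l : ℤ) : Set V2 := {ξ | tw ^ l ≤ ‖ξ‖ ∧ ‖ξ‖ < tw ^ (l + 1)}
def mu (k l : ℤ) : ℝ := tw ^ (min k l - 3)
def EE (k l : ℤ) (i : Fin 2 → ℤ) : Set V2 := Ann l ∩ Cube (fun c => mu k l * i c) (mu k l)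
def FRel (k : ℤ) (E E' : Set V2) : Prop := ∃ ξ ∈ E, ∃ η ∈ E', tw ^ (k - 1) < ‖ξ + η‖ ∧ ‖ξ + η‖ < tw ^ (k + 1)

lemma Rel_symm {k : ℤ} {E E' : Set V2} (h : FRel k E E') : FRel k E' E := by
  obtain ⟨ξ, hξ, η, hη, h⟩ := h
  exact ⟨η, hη, ξ, hξ, by rwa [add_comm]⟩

lemma mu_pos (k l : ℤ) : 0 < mu k l := by unfold mu; positivity

lemma Ann_meas (l : ℤ) : MeasurableSet (Ann l) :=
  (measurableSet_le measurable_const measurable_norm).inter (measurableSet_lt measurable_norm measurable_const)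

lemma EE_meas (k l : ℤ) (i : Fin 2 → ℤ) : MeasurableSet (EE k l i) := (Ann_meas l).inter (Cube_meas _ _)

lemma Ann_disj : Pairwise (Function.onFun Disjoint Ann) := by
  have key : ∀ l m : ℤ, l < m → Disjoint (Ann l) (Ann m) := by
    intro l m h
    refine Set.disjoint_left.2 fun ξ h1 h2 => ?_
    have : tw ^ (l + 1) ≤ 2 ^ m := zpow_le_zpow_right₀ nz (by omega)
    exact absurd (h1.2.trans_le this) (not_lt.2 h2.1)
  intro l m h
  rcases lt_or_gt_of_ne h with h | h
  · exact key _ _ h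
  · exact (key _ _ h).symm

lemma cube_idx {μ x : ℝ} (hμ : 0 < μ) (i : ℤ) (h : x ∈ Set.Ico (μ * i) (μ * i + μ)) : i = ⌊x / μ⌋ := by
  symm
  rw [Int.floor_eq_iff, le_div_iff₀ hμ, div_lt_iff₀ hμ]
  constructor <;> nlinarith [h.1, h.2]

lemma EE_disj' (k l : ℤ) : Pairwise (Function.onFun Disjoint (EE k l)) := by
  intro i j h
  refine Set.disjoint_left.2 fun ξ h1 h2 => h ?_
  funext c
  rw [cube_idx (mu_pos k l) _ (h1.2 c), cube_idx (mu_pos k l) _ (h2.2 c)]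

lemma EE_disj (k : ℤ) : Pairwise (Function.onFun Disjoint (fun z : ℤ × (Fin 2 → ℤ) => EE k z.1 z.2)) := by
  rintro ⟨l, i⟩ ⟨m, j⟩ h
  by_cases hl : l = m
  · subst hl
    exact EE_disj' k l (fun h1 => h (by simpa using h1))
  · exact (Ann_disj hl).mono Set.inter_subset_left Set.inter_subset_left

lemma EE_cover (k : ℤ) : ∀ᵐ ξ : V2, ξ ∈ ⋃ z : ℤ × (Fin 2 → ℤ), EE k z.1 z.2 := by
  filter_upwards [Measure.ae_ne volume (0:V2)] with ξ hξ
  obtain ⟨l, hl⟩ := exists_mem_Ico_zpow (norm_pos_iff.2 hξ) (by norm_num : (1:ℝ) < 2)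
  refine Set.mem_iUnion.2 ⟨(l, fun c => ⌊ξ c / mu k l⌋), hl, fun c => ?_⟩
  have hμ := mu_pos k l
  have h1 := Int.floor_le (ξ c / mu k l)
  have h2 := Int.lt_floor_add_one (ξ c / mu k l)
  rw [le_div_iff₀ hμ] at h1
  rw [div_lt_iff₀ hμ] at h2
  dsimp only
  constructor <;> nlinarith

lemma wE_sum {ι : Type*} [Countable ι] (s θ : ℝ) (U : WC) {F : ι → Set V2} {S : Set V2} (hF : ∀ i, MeasurableSet (F i))
    (hd : Pairwise (Function.onFun Disjoint F)) (hS : ∀ i, F i ⊆ S) : ∑' i, wE s θ U (F i) ≤ wE s θ U S := by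
  unfold wE
  rw [← lintegral_iUnion (fun i => measurable_snd (hF i)) (fun i j h => Disjoint.preimage _ (hd h))]
  exact lintegral_mono_set (Set.iUnion_subset fun i => Set.preimage_mono (hS i))

lemma Rel_case {k l m : ℤ} {i j : Fin 2 → ℤ} (h : FRel k (EE k l i) (EE k m j)) (hml : m ≤ l) :
    k ≤ l + 2 ∧ (l - 1 ≤ m ∨ l - 1 ≤ k) := by
  obtain ⟨ξ, hξ, η, hη, h1, h2⟩ := h
  have a1 := hξ.1
  have a2 := hη.1
  constructor
  · have hm : tw ^ (m + 1) ≤ 2 ^ (l + 1) := zpow_le_zpow_right₀ nz (by omega)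
    have h3 : tw ^ (k - 1) < 2 ^ (l + 2) := by
      rw [show l + 2 = (l + 1) + 1 by ring, zpow_add_one₀ nz]
      linarith [norm_add_le ξ η, a1.2, a2.2]
    have := (zpow_lt_zpow_iff_right₀ (by norm_num : (1:ℝ) < 2)).1 h3
    omega
  · by_contra! hc
    have hm : tw ^ (m + 1) ≤ 2 ^ (l - 1) := zpow_le_zpow_right₀ nz (by omega)
    have hk : tw ^ (k + 1) ≤ 2 ^ (l - 1) := zpow_le_zpow_right₀ nz (by omega)
    have hl : tw ^ l = 2 ^ (l - 1) * 2 := by rw [← zpow_add_one₀ nz]; congr 1; ring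
    have := norm_sub_le (ξ + η) η
    rw [add_sub_cancel_right] at this
    linarith [a1.1, a2.2]

lemma Rel_deg (k l m : ℤ) (i : Fin 2 → ℤ) : ∃ S : Finset (Fin 2 → ℤ), S.card ≤ 67 ^ 2 ∧
    ∀ j, FRel k (EE k l i) (EE k m j) → j ∈ S := by
  by_cases hne : (EE k l i).Nonempty
  swap
  · refine ⟨∅, by simp, fun j hj => ?_⟩
    obtain ⟨ξ, hξ, _⟩ := hj
    exact absurd ⟨ξ, hξ⟩ hne
  obtain ⟨ξ0, h0⟩ := hne
  set X : Fin 2 → ℝ := fun c => if k ≤ m then - ξ0 c else 0 with hX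
  have hμ := mu_pos k m
  refine ⟨Fintype.piFinset fun c => Finset.Icc (⌊X c / mu k m⌋ - 33) (⌊X c / mu k m⌋ + 33), ?_, fun j hj => ?_⟩
  · rw [Fintype.card_piFinset]
    simp only [Int.card_Icc]
    rw [Fin.prod_univ_two]
    have : ∀ z : ℤ, (z + 33 + 1 - (z - 33)).toNat = 67 := by intro z; omega
    rw [this, this]; norm_num
  rw [Fintype.mem_piFinset]
  intro c
  obtain ⟨ξ, hξ, η, hη, h1, h2⟩ := hj
  have hc : |η c - X c| ≤ 32 * mu k m := by
    have n1 : |ξ c + η c| ≤ ‖ξ + η‖ := PiLp.norm_apply_le (ξ + η) c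
    have n2 : |η c| ≤ ‖η‖ := PiLp.norm_apply_le η c
    have e1 := hξ.2 c
    have e2 := h0.2 c
    have n3 : |ξ0 c - ξ c| ≤ mu k l := by rw [abs_le]; constructor <;> linarith [e1.1, e1.2, e2.1, e2.2]
    have hmu : mu k l ≤ 2 ^ (k + 1) := zpow_le_zpow_right₀ nz (by omega)
    by_cases hkm : k ≤ m
    · have : 32 * mu k m = 2 ^ (k + 1) * 2 := by
        unfold mu
        rw [min_eq_left hkm, ← zpow_add_one₀ nz, show (32:ℝ) = 2 ^ (5:ℤ) by norm_num, ← zpow_add₀ nz]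
        congr 1; ring
      rw [this]
      simp only [hX, if_pos hkm]
      rw [abs_le] at *
      constructor <;> linarith
    · have h32 : tw ^ (m + 1) ≤ 32 * mu k m := by
        unfold mu
        rw [min_eq_right (by omega), show (32:ℝ) = 2 ^ (5:ℤ) by norm_num, ← zpow_add₀ nz]
        exact zpow_le_zpow_right₀ nz (by omega)
      simp only [hX, if_neg hkm, sub_zero]
      linarith [hη.1.2]
  have e := hη.2 c
  have f1 := Int.floor_le (X c / mu k m)
  have f2 := Int.lt_floor_add_one (X c / mu k m)
  rw [le_div_iff₀ hμ] at f1
  rw [div_lt_iff₀ hμ] at f2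
  rw [abs_le] at hc
  rw [Finset.mem_Icc]
  set f := ⌊X c / mu k m⌋
  have g1 := e.1
  have g2 := e.2
  dsimp only at g1 g2
  have c1 : (f:ℝ) - 34 < j c := by
    by_contra! hh
    nlinarith [mlr hh hμ.le]
  have c2 : (j c : ℝ) < f + 34 := by
    by_contra! hh
    nlinarith [mlr hh hμ.le]
  have c1' : f - 34 < j c := by exact_mod_cast c1
  have c2' : j c < f + 34 := by exact_mod_cast c2
  constructor <;> omega

open Classical in
def RK (k l m : ℤ) (i j : Fin 2 → ℤ) : EN := if FRel k (EE k l i) (EE k m j) then 1 else 0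

lemma RK_symm (k l m : ℤ) (i j : Fin 2 → ℤ) : RK k l m i j = RK k m l j i := by
  unfold RK; congr 1; exact propext ⟨Rel_symm, Rel_symm⟩

lemma RK_row (k l m : ℤ) (i : Fin 2 → ℤ) : ∑' j, RK k l m i j ≤ 67 ^ 2 := by
  obtain ⟨S, hS, h⟩ := Rel_deg k l m i
  have hz : ∀ j ∉ S, RK k l m i j = 0 := fun j hj => if_neg fun h' => hj (h j h')
  rw [tsum_eq_sum hz]
  refine (Finset.sum_le_card_nsmul S _ 1 fun j _ => ?_).trans ?_
  · unfold RK; split_ifs <;> simp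
  · rw [nsmul_eq_mul, mul_one]; exact_mod_cast hS

lemma block_sum {s θ : ℝ} (U V : WC) (k l m : ℤ) :
    ∑' i, ∑' j, RK k l m i j * (wE s θ U (EE k l i) ^ hfw * wE s θ V (EE k m j) ^ hfw) ≤
      67 ^ 2 * (wE s θ U (Ann l) ^ hfw * wE s θ V (Ann m) ^ hfw) := by
  refine (schur (RK k l m) _ _ (67 ^ 2) (RK_row k l m) (fun j => ?_)).trans ?_
  · simp_rw [RK_symm k l m]; exact RK_row k m l j
  · simp_rw [sq_half]
    refine MLR (mul_le_mul' (rle ?_ nz) (rle ?_ nz)) _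
    · exact wE_sum s θ U (EE_meas k l) (EE_disj' k l) fun i => Set.inter_subset_left
    · exact wE_sum s θ V (EE_meas k m) (EE_disj' k m) fun i => Set.inter_subset_left

lemma all_sum {d : ℝ} (hd : 0 < d) (s θ : ℝ) : ∃ C : EN, C ≠ ⊤ ∧ ∀ U V : ℝ × V2 → ℂ,
    ∑' k : ℤ, ∑' l : ℤ, ∑' m : ℤ, p2 (-(d * (|((l - m : ℤ) : ℝ)| + |((l - k : ℤ) : ℝ)|))) *
      ∑' i, ∑' j, RK k l m i j * (wE s θ U (EE k l i) ^ hfw * wE s θ V (EE k m j) ^ hfw) ≤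
      C * (wE s θ U Set.univ ^ hfw * wE s θ V Set.univ ^ hfw) := by
  obtain ⟨T, hT, hg⟩ := abs_geom hd
  refine ⟨67 ^ 2 * T * T, by finiteness, fun U V => ?_⟩
  set x := fun l => wE s θ U (Ann l) ^ hfw
  set y := fun l => wE s θ V (Ann l) ^ hfw
  have s1 : ∀ k l m : ℤ, p2 (-(d * (|((l - m : ℤ) : ℝ)| + |((l - k : ℤ) : ℝ)|))) *
      ∑' i, ∑' j, RK k l m i j * (wE s θ U (EE k l i) ^ hfw * wE s θ V (EE k m j) ^ hfw) ≤
      p2 (-(d * |((l - k : ℤ) : ℝ)|)) * (p2 (-(d * |((l - m : ℤ) : ℝ)|)) * (67 ^ 2 * (x l * y m))) := by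
    intro k l m
    refine (MLR (block_sum U V k l m) _).trans_eq ?_
    rw [mul_add, neg_add, p2_add]; ring
  refine (tle fun k => tle fun l => tle fun m => s1 k l m).trans ?_
  simp_rw [ENNReal.tsum_mul_left]
  rw [ENNReal.tsum_comm]
  simp_rw [ENNReal.tsum_mul_right]
  refine (tle fun l => MLL (hg l) _).trans ?_
  rw [ENNReal.tsum_mul_left]
  have s2 := schur (fun l m : ℤ => p2 (-(d * |((l - m : ℤ) : ℝ)|))) x y T hg (fun m => by
    simp_rw [show ∀ l : ℤ, |((l - m : ℤ) : ℝ)| = |((m - l : ℤ) : ℝ)| by intro l; push_cast; exact abs_sub_comm _ _]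
    exact hg m)
  have s3 : ∑' l, ∑' m, p2 (-(d * |((l - m : ℤ) : ℝ)|)) * (67 ^ 2 * (x l * y m)) =
      67 ^ 2 * ∑' l, ∑' m, p2 (-(d * |((l - m : ℤ) : ℝ)|)) * (x l * y m) := by
    simp_rw [← ENNReal.tsum_mul_left]
    refine tsum_congr fun l => tsum_congr fun m => by ring
  rw [s3]
  have hx : (∑' l, x l ^ 2) ≤ wE s θ U Set.univ := by
    simp only [x]
    simp_rw [sq_half]; exact wE_sum s θ U Ann_meas Ann_disj fun i => Set.subset_univ _
  have hy : (∑' l, y l ^ 2) ≤ wE s θ V Set.univ := by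
    simp only [y]
    simp_rw [sq_half]; exact wE_sum s θ V Ann_meas Ann_disj fun i => Set.subset_univ _
  calc _ ≤ T * (67 ^ 2 * (T * (wE s θ U Set.univ ^ hfw * wE s θ V Set.univ ^ hfw))) := by
        refine MLR (MLR (s2.trans (MLR (mul_le_mul' ?_ ?_) _)) _) _
        · exact rle hx nz
        · exact rle hy nz
    _ = _ := by ring

def Ms (U : WC) (E : Set V2) (t : ℝ) : EN := ⨆ x, ‖J (E.indicator (Gt U t)) x‖ₑ

lemma Ms_meas {U : WC} (hUi : Integrable U) {E : Set V2} (hE : MeasurableSet E) : Measurable (Ms U E) := by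
  have h : LowerSemicontinuous (Ms U E) := by
    refine lowerSemicontinuous_iSup fun x => Continuous.lowerSemicontinuous ?_
    have h1 : Continuous fun t : ℝ => (t, x) := by fun_prop
    have h2 := (uE_cont hUi hE).comp h1
    exact h2.enorm
  exact h.measurable

lemma LQ_meas {q : ℝ} {F : ℝ × V2 → EN} (hF : Measurable F) : Measurable fun t => LQ q (fun x => F (t, x)) := by
  have h := (hF.pow_const q).lintegral_prod_right' (ν := (volume : Measure V2))
  exact h.pow_const _

lemma LQ_holder {Ω : Type*} [MeasureSpace Ω] {p : ℝ} (hp : 0 < p) {f g : Ω → EN} (hf : Measurable f) (hg : Measurable g) :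
    LQ p (fun x => f x * g x) ≤ LQ (2 * p) f * LQ (2 * p) g :=
  ENNReal.lintegral_Lp_mul_le_Lq_mul_Lr hp lz (by field_simp; norm_num) volume hf.aemeasurable hg.aemeasurable

lemma rho_lem {s : ℝ} (hs : 0 < s) {l : ℤ} {ξ : V2} (h : ξ ∈ Ann l) :
    1 ≤ tw ^ (-(2 * s * (max l 0 : ℤ))) * (1 + ‖ξ‖ ^ 2) ^ s := by
  have h1 : tw ^ (2 * ((max l 0 : ℤ) : ℝ)) ≤ 1 + ‖ξ‖ ^ 2 := by
    rcases le_total 0 l with hl | hl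
    · rw [max_eq_left hl, mul_comm, Real.rpow_mul nz, Real.rpow_intCast, Real.rpow_two]
      have := h.1
      have h0 : (0:ℝ) < 2 ^ l := by positivity
      nlinarith
    · rw [max_eq_right hl]; norm_num
  have h2 := Real.rpow_le_rpow pz h1 hs.le
  rw [← Real.rpow_mul nz] at h2
  rw [Real.rpow_neg nz]
  rw [show 2 * s * ((max l 0 : ℤ) : ℝ) = 2 * ((max l 0 : ℤ) : ℝ) * s by ring]
  have h0 : (0:ℝ) < 2 ^ (2 * ((max l 0 : ℤ) : ℝ) * s) := by positivity
  rw [← div_eq_inv_mul, le_div_iff₀ h0]; linarith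

lemma piece_sup {s θ P : ℝ} (hs : 0 < s) (hθ : 1 / 2 < θ) (hP : 4 < P) : ∃ C : EN, C ≠ ⊤ ∧ ∀ (U : WC), Measurable U → Integrable U →
    ∀ (k l : ℤ) (i : Fin 2 → ℤ), LQ P (Ms U (EE k l i)) ≤
      C * (p2 ((min k l : ℤ) * (1 - 2 / P) + l * (1 / P) - s * (max l 0 : ℤ)) * wE s θ U (EE k l i) ^ hfw) := by
  have hP0 : 0 < P := by linarith
  refine ⟨(4 * (eO (400 * cθ θ) * cP P ^ (2 / P))) ^ hfw, ?_, fun U hU hUi k l i => ?_⟩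
  · have := cP_ne_top hP
    refine rnt nz (mnt nz (mnt ENNReal.ofReal_ne_top ?_))
    exact rnt pz this
  have hμ := mu_pos k l
  have hN : (0:ℝ) < 2 ^ l := by positivity
  have hμN : mu k l ≤ 2 ^ l / 8 := by
    rw [show tw ^ l / 8 = 2 ^ (l - 3) by rw [zpow_sub₀ nz]; norm_num]
    exact zpow_le_zpow_right₀ nz (by omega)
  have h := tts hθ hP hU hUi (EE_meas k l i) hμ hN hμN (ρ := tw ^ (-(2 * s * (max l 0 : ℤ)))) pz Set.inter_subset_right
    (fun ξ hξ => ⟨hξ.1.1, by rw [mul_comm, ← zpow_add_one₀ nz]; exact hξ.1.2.le⟩) (fun ξ hξ => rho_lem hs hξ.1)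
  have h2 := ENNReal.rpow_le_rpow h (z := 1 / tw) nz
  rw [← eRm, show 2 / P * (1 / 2) = 1 / P by ring] at h2
  refine h2.trans ?_
  have hmu : mu k l ≤ tw ^ ((min k l : ℤ) : ℝ) := by
    rw [Real.rpow_intCast]; exact zpow_le_zpow_right₀ nz (by omega)
  have key : 400 * tw ^ (-(2 * s * (max l 0 : ℤ))) * cθ θ * mu k l ^ 2 * (2 ^ l / mu k l ^ 2) ^ (2 / P) ≤
      (400 * cθ θ) * tw ^ (2 * ((min k l : ℤ) * (1 - 2 / P) + l * (1 / P) - s * (max l 0 : ℤ))) := by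
    have e1 : mu k l ^ 2 * (2 ^ l / mu k l ^ 2) ^ (2 / P) = mu k l ^ (2 * (1 - 2 / P)) * tw ^ (l * (2 / P)) := by
      rw [Real.div_rpow hN.le pz, ← Real.rpow_intCast, ← Real.rpow_mul nz, ← Real.rpow_two, ← Real.rpow_mul hμ.le,
        show 2 * (1 - 2 / P) = 2 - 2 * (2 / P) by ring, Real.rpow_sub hμ]
      ring
    have e2 : mu k l ^ (2 * (1 - 2 / P)) ≤ tw ^ (((min k l : ℤ) : ℝ) * (2 * (1 - 2 / P))) := by
      have : 2 / P < 1 := by rw [div_lt_one hP0]; linarith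
      rw [Real.rpow_mul (x := 2) nz]
      exact Real.rpow_le_rpow hμ.le hmu lz
    have hc := cθ_nonneg θ
    calc _ = (400 * cθ θ) * (tw ^ (-(2 * s * (max l 0 : ℤ))) * (mu k l ^ 2 * (2 ^ l / mu k l ^ 2) ^ (2 / P))) := by ring
      _ ≤ (400 * cθ θ) * (tw ^ (-(2 * s * (max l 0 : ℤ))) * (tw ^ (((min k l : ℤ) : ℝ) * (2 * (1 - 2 / P))) * tw ^ (l * (2 / P)))) := by
          rw [e1]
          refine mlr (mlr (mul_le_mul_of_nonneg_right e2 pz) pz) pz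
      _ = _ := by
          rw [← Real.rpow_add nz, ← Real.rpow_add nz]
          congr 2; ring
  set w := wE s θ U (EE k l i)
  set X := (((min k l : ℤ) : ℝ) * (1 - 2 / P) + l * (1 / P) - s * (max l 0 : ℤ))
  have key2 := oLe key
  rw [ENNReal.ofReal_mul (p := 400 * cθ θ) (by have := cθ_nonneg θ; positivity)] at key2
  change _ ≤ _ * p2 (2 * X) at key2
  rw [← p2_pow2] at key2
  refine (rle (MLR (MLR (MLL key2 _) _) _) nz).trans_eq ?_
  rw [show 4 * (w * (eO (400 * cθ θ) * p2 X ^ 2 * cP P ^ (2 / P))) =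
    (4 * (eO (400 * cθ θ) * cP P ^ (2 / P))) * (p2 X ^ 2 * w) by ring,
    mrn _ _ nz, mrn (p2 X ^ 2) _ nz, half_sq]

lemma piece_q {s θ p q : ℝ} (hs : 0 < s) (hθ : 1 / 2 < θ) (hq : 2 < q) (hp : 2 < p) (hpq : 1 / p < 1 / 2 - 1 / q) :
    ∃ C : EN, C ≠ ⊤ ∧ ∀ (U : WC), Measurable U → Integrable U →
    ∀ (k l : ℤ) (i : Fin 2 → ℤ), LQ (2 * p) (fun t => LQ q (fun x => ‖J ((EE k l i).indicator (Gt U t)) x‖ₑ)) ≤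
      C * (p2 ((min k l : ℤ) * (1 - 2 / q - 1 / p) + l * (1 / (2 * p)) - s * (max l 0 : ℤ)) * wE s θ U (EE k l i) ^ hfw) := by
  have hq0 : 0 < q := by linarith
  have hp0 : 0 < p := by linarith
  have e2q : 2 / q = 2 * (1 / q) := by ring
  have h1q : 0 < 1 - 2 / q := by have : 0 < 1 / p := by positivity
                                 linarith
  set P := 2 * p * (1 - 2 / q) with hPd
  have hP : 4 < P := by
    have : 2 * p * (2 * (1 / p)) = 4 := by field_simp; norm_num
    rw [hPd, ← this]
    exact mul_lt_mul_of_pos_left lz pz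
  have hP0 : 0 < P := by linarith
  have fr : 1 / P * (1 - 2 / q) = 1 / (2 * p) := by
    rw [hPd, one_div_mul_eq_div]; exact div_mul_cancel_right₀ h1q.ne' _ |>.trans (one_div _).symm
  obtain ⟨C1, hC1, h1⟩ := piece_sup hs hθ hP
  refine ⟨C1 ^ (1 - 2 / q) * eO (4 * π ^ 2 * (2 * cθ θ)) ^ (1 / q), ?_, fun U hU hUi k l i => ?_⟩
  · exact mnt (rnt h1q.le hC1) (rnt pz ENNReal.ofReal_ne_top)
  have hE := EE_meas k l i
  set E := EE k l i with hEd
  set K0 := eO (4 * π ^ 2 * (2 * cθ θ)) with hK0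
  set ρ := tw ^ (-(2 * s * (max l 0 : ℤ))) with hρ
  set w := wE s θ U E with hw
  have pt : ∀ t, LQ q (fun x => ‖J (E.indicator (Gt U t)) x‖ₑ) ≤ (K0 * (eO ρ * w)) ^ (1 / q) * Ms U E t ^ (1 - 2 / q) := by
    intro t
    have hfin : Ms U E t ≠ ⊤ := by
      obtain ⟨c, hc⟩ := J_bdd ((Gt_int hUi t).indicator hE)
      refine ne_top_of_le_ne_top (ENNReal.ofReal_ne_top (r := c)) (iSup_le fun x => ?_)
      rw [← ofReal_norm]; exact oLe (hc x)
    refine (LQ_interp hq.le hfin (fun x => le_iSup (fun x => ‖J (E.indicator (Gt U t)) x‖ₑ) x)).trans ?_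
    rw [mul_comm]
    refine MLL (rle ?_ pz) _
    exact uE_L2 hθ hU hUi t hE (fun ξ hξ => rho_lem hs hξ.1)
  refine (LQ_mono pz pt).trans ?_
  rw [LQ_cmul pz _ ((Ms_meas hUi hE).pow_const _)]
  have e1 : LQ (2 * p) (fun t => Ms U E t ^ (1 - 2 / q)) = LQ P (Ms U E) ^ (1 - 2 / q) := by
    unfold LQ
    simp_rw [← eRm]
    rw [show (1 - 2 / q) * (2 * p) = P by rw [hPd]; ring, show 1 / P * (1 - 2 / q) = 1 / (2 * p) from fr]
  rw [e1]
  have h2 := ENNReal.rpow_le_rpow (h1 U hU hUi k l i) (z := 1 - 2 / q) h1q.le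
  refine (MLR h2 _).trans_eq ?_
  rw [← hEd, ← hw]
  have hρ2 : eO ρ = p2 (-(2 * s * (max l 0 : ℤ))) := rfl
  rw [hρ2, mrn _ _ h1q.le, mrn _ _ h1q.le, mrn _ _ pz,
    mrn _ _ pz, p2_rpow, p2_rpow, ← eRm]
  have ew : w ^ hfw = w ^ (1 / q) * w ^ (1 / 2 * (1 - 2 / q)) := by
    rw [← eRa _ _ pz pz]; congr 1; ring
  have ep : p2 ((min k l : ℤ) * (1 - 2 / q - 1 / p) + l * (1 / (2 * p)) - s * (max l 0 : ℤ)) =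
      p2 (-(2 * s * (max l 0 : ℤ)) * (1 / q)) * p2 (((min k l : ℤ) * (1 - 2 / P) + l * (1 / P) - s * (max l 0 : ℤ)) * (1 - 2 / q)) := by
    rw [← p2_add]
    congr 1
    have f1 := fr
    have f2 : 1 - 2 / q - 1 / p = (1 - 2 / P) * (1 - 2 / q) := by
      rw [sub_mul, show 2 / P * (1 - 2 / q) = 2 * (1 / P * (1 - 2 / q)) by ring, f1]; field_simp
    rw [f2, ← f1]; ring
  rw [ew, ep]; ring

lemma LQ_zero {Ω : Type*} [MeasureSpace Ω] {q : ℝ} (hq : 0 < q) : LQ q (fun _ : Ω => 0) = 0 := by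
  simp [LQ, hq]

lemma not_rel (h : IsKer κ M) (hlo : Lowz M) (hhi : Hiwz M) {G1 G2 : VC}
    (h1 : Integrable G1) (h2 : Integrable G2) {E E' : Set V2} (hE : MeasurableSet E) (hE' : MeasurableSet E') {k : ℤ}
    (hr : ¬ FRel k E E') (x : V2) : Ck κ k (fun y => J (E.indicator G1) y * J (E'.indicator G2) y) x = 0 := by
  refine Ck_JJ_zero (h1.indicator hE) (h2.indicator hE') h k (fun ξ η hξ hη => ?_) x
  have m1 : ξ ∈ E := by by_contra hh; exact hξ (Set.indicator_of_notMem hh _)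
  have m2 : η ∈ E' := by by_contra hh; exact hη (Set.indicator_of_notMem hh _)
  have hn : ‖tw ^ (-k) • (ξ + η)‖ = ‖ξ + η‖ / 2 ^ k := by
    rw [norm_smul, nrn pz, zpow_neg, inv_mul_eq_div]
  have h0 : (0:ℝ) < 2 ^ k := by positivity
  by_cases c1 : ‖ξ + η‖ ≤ 2 ^ (k - 1)
  · refine hlo _ ?_
    rw [zpow_sub_one₀ nz] at c1
    rw [hn, div_le_iff₀ h0]; linarith
  · by_cases c2 : 2 ^ (k + 1) ≤ ‖ξ + η‖
    · refine hhi _ ?_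
      rw [zpow_add_one₀ nz] at c2
      rw [hn, le_div_iff₀ h0]; linarith
    · exact absurd ⟨ξ, m1, η, m2, not_le.1 c1, not_le.1 c2⟩ hr

lemma pair_half {a b p q s θ : ℝ} (hb : 0 ≤ b) (hba : b ≤ a) (hs : 0 < s) (hθ : 1 / 2 < θ) (hq : 2 < q) (hp : 2 < p)
    (h1 : 1 / p < 1 / 2 - 1 / q) (h2 : 1 - 2 / q + a - 2 * s ≤ 1 / p) (h3 : a - s < 2 / q) (h : IsKer κ M)
    (hlo : Lowz M) (hhi : Hiwz M) : ∃ (C : EN) (d : ℝ), C ≠ ⊤ ∧ 0 < d ∧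
    ∀ U V : ℝ × V2 → ℂ, Measurable U → Integrable U → Measurable V → Integrable V → ∀ k l m : ℤ, m ≤ l → ∀ i j : Fin 2 → ℤ,
      p2 (k * (b - 1)) * LQ p (fun t => LQ q (fun x => ‖Ck κ k (fun y => J ((EE k l i).indicator (Gt U t)) y *
        J ((EE k m j).indicator (Gt V t)) y) x‖ₑ)) ≤ C * (p2 (-(d * (|((l - m : ℤ) : ℝ)| + |((l - k : ℤ) : ℝ)|))) *
        (RK k l m i j * (wE s θ U (EE k l i) ^ hfw * wE s θ V (EE k m j) ^ hfw))) := by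
  have hp0 : 0 < p := by linarith
  have hq0 : 0 < q := by linarith
  obtain ⟨C1, d, hd, hcoef⟩ := coef hb hba hs hq hp h1 h2 h3
  obtain ⟨C2, hC2, hQ⟩ := piece_q hs hθ hq hp h1
  obtain ⟨C3, hC3, hI⟩ := piece_sup hs hθ (P := 2 * p) lz
  have hκ : ∫⁻ z, ‖κ z‖ₑ ≠ ⊤ := h.integrable.2.ne
  set C0 := ∫⁻ z, ‖κ z‖ₑ with hC0
  refine ⟨p2 C1 * (C0 * (C2 * C3)), d, by have := p2_ne_top C1; finiteness, hd, fun U V hU hUi hV hVi k l m hml i j => ?_⟩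
  by_cases hr : FRel k (EE k l i) (EE k m j)
  swap
  · simp_rw [not_rel h hlo hhi (Gt_int hUi _) (Gt_int hVi _) (EE_meas k l i) (EE_meas k m j) hr, enorm_zero, LQ_zero hq0, LQ_zero hp0]
    simp
  have hRK : RK k l m i j = 1 := if_pos hr
  obtain ⟨g1, g2⟩ := Rel_case hr hml
  have hc := hcoef k l m hml g1 g2
  have hE := EE_meas k l i
  have hE' := EE_meas k m j
  have bQ := hQ U hU hUi k l i
  have bI := hI V hV hVi k m j
  rw [hRK, one_mul]
  set E := EE k l i
  set E' := EE k m j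
  set w := wE s θ U E ^ hfw
  set w' := wE s θ V E' ^ hfw
  have cU := uE_cont hUi hE
  have cV := uE_cont hVi hE'
  have cu : ∀ t, Continuous (J (E.indicator (Gt U t))) := fun t => J_cont ((Gt_int hUi t).indicator hE)
  have cv : ∀ t, Continuous (J (E'.indicator (Gt V t))) := fun t => J_cont ((Gt_int hVi t).indicator hE')
  have pt : ∀ t, LQ q (fun x => ‖Ck κ k (fun y => J (E.indicator (Gt U t)) y * J (E'.indicator (Gt V t)) y) x‖ₑ) ≤
      C0 * (LQ q (fun x => ‖J (E.indicator (Gt U t)) x‖ₑ) * Ms V E' t) := by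
    intro t
    refine (Ck_Lq (by linarith : 1 < q) h k (cmul (cu t) (cv t)).measurable).trans (MLR ?_ _)
    have := LQ_mul_sup (f := J (E'.indicator (Gt V t))) hq0 (cu t).measurable (fun y => le_iSup (fun x => ‖J (E'.indicator (Gt V t)) x‖ₑ) y)
    rw [mul_comm (LQ q _)]
    simp_rw [mul_comm (J (E.indicator (Gt U t)) _)]
    exact this
  have mq : Measurable fun t => LQ q (fun x => ‖J (E.indicator (Gt U t)) x‖ₑ) := LQ_meas (F := fun z => ‖J (E.indicator (Gt U z.1)) z.2‖ₑ) cU.measurable.enorm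
  have mM := Ms_meas hVi hE'
  have s1 := LQ_mono hp0.le pt
  have mm : Measurable fun t => LQ q (fun x => ‖J (E.indicator (Gt U t)) x‖ₑ) * Ms V E' t := mq.mul mM
  rw [LQ_cmul hp0 _ mm] at s1
  have s2 := s1.trans (MLR ((LQ_holder hp0 mq mM).trans (mul_le_mul' bQ bI)) _)
  refine (MLR s2 _).trans ?_
  set X1 := ((min k l : ℤ) : ℝ) * (1 - 2 / q - 1 / p) + l * (1 / (2 * p)) - s * (max l 0 : ℤ) with hX1
  set X2 := ((min k m : ℤ) : ℝ) * (1 - 2 / (2 * p)) + m * (1 / (2 * p)) - s * (max m 0 : ℤ) with hX2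
  have e : (1 - 2 / (2 * p)) = 1 - 1 / p := by field_simp
  calc p2 (k * (b - 1)) * (C0 * (C2 * (p2 X1 * w) * (C3 * (p2 X2 * w'))))
      = (p2 (k * (b - 1)) * p2 X1 * p2 X2) * ((C0 * (C2 * C3)) * (w * w')) := by ring
    _ ≤ (p2 C1 * p2 (-(d * (|((l - m : ℤ) : ℝ)| + |((l - k : ℤ) : ℝ)|)))) * ((C0 * (C2 * C3)) * (w * w')) := by
        refine MLL ?_ _
        rw [← p2_add, ← p2_add, ← p2_add]
        refine p2_mono ?_
        rw [hX1, hX2, e]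
        linarith
    _ = _ := by ring

lemma pair_full {a b p q s θ : ℝ} (hb : 0 ≤ b) (hba : b ≤ a) (hs : 0 < s) (hθ : 1 / 2 < θ) (hq : 2 < q) (hp : 2 < p)
    (h1 : 1 / p < 1 / 2 - 1 / q) (h2 : 1 - 2 / q + a - 2 * s ≤ 1 / p) (h3 : a - s < 2 / q) (h : IsKer κ M)
    (hlo : Lowz M) (hhi : Hiwz M) : ∃ (C : EN) (d : ℝ), C ≠ ⊤ ∧ 0 < d ∧
    ∀ U V : ℝ × V2 → ℂ, Measurable U → Integrable U → Measurable V → Integrable V → ∀ k l m : ℤ, ∀ i j : Fin 2 → ℤ,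
      p2 (k * (b - 1)) * LQ p (fun t => LQ q (fun x => ‖Ck κ k (fun y => J ((EE k l i).indicator (Gt U t)) y *
        J ((EE k m j).indicator (Gt V t)) y) x‖ₑ)) ≤ C * (p2 (-(d * (|((l - m : ℤ) : ℝ)| + |((l - k : ℤ) : ℝ)|))) *
        (RK k l m i j * (wE s θ U (EE k l i) ^ hfw * wE s θ V (EE k m j) ^ hfw))) := by
  obtain ⟨C, d, hC, hd, key⟩ := pair_half hb hba hs hθ hq hp h1 h2 h3 h hlo hhi
  refine ⟨C, d / 2, hC, by positivity, fun U V hU hUi hV hVi k l m i j => ?_⟩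
  rcases le_total m l with hml | hml
  · refine (key U V hU hUi hV hVi k l m hml i j).trans (MLR (MLL (p2_mono ?_) _) _)
    nlinarith [abs_nonneg ((l - m : ℤ) : ℝ), abs_nonneg ((l - k : ℤ) : ℝ)]
  · have := key V U hV hVi hU hUi k m l hml j i
    simp_rw [mul_comm (J ((EE k m j).indicator _) _)] at this
    refine this.trans (MLR (mul_le_mul' (p2_mono ?_) (le_of_eq ?_)) _)
    · have t1 : |((m - l : ℤ) : ℝ)| = |((l - m : ℤ) : ℝ)| := by push_cast; exact abs_sub_comm _ _
      have t2 : |((l - k : ℤ) : ℝ)| ≤ |((l - m : ℤ) : ℝ)| + |((m - k : ℤ) : ℝ)| := by push_cast; exact abs_sub_le _ _ _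
      rw [t1]
      nlinarith [abs_nonneg ((m - k : ℤ) : ℝ)]
    · rw [RK_symm]; ring

lemma Ck_meas_t (h : IsKer κ M) (k : ℤ) {H : WC} (hH : Continuous H) :
    Measurable fun z : ℝ × V2 => Ck κ k (fun y => H (z.1, y)) z.2 := by
  have h1 : Continuous (fun p : (ℝ × V2) × V2 => κ p.2 * H (p.1.1, p.1.2 - (tw ^ (-k)) • p.2)) := by
    have := h.cont; fun_prop
  exact (h1.stronglyMeasurable.integral_prod_right (ν := volume)).measurable

lemma LQ_LQ_tsum {ι : Type*} [Countable ι] {p q : ℝ} (hp1 : 1 ≤ p) (hq1 : 1 ≤ q) (c : ℤ → EN) (T : ℤ → ι → ℝ → V2 → EN) (F : ℝ → V2 → EN)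
    (mT : ∀ k z, Measurable (fun w : ℝ × V2 => T k z w.1 w.2)) (pt : ∀ t x, F t x ≤ ∑' k : ℤ, ∑' z, c k * T k z t x) :
    LQ p (fun t => LQ q (F t)) ≤ ∑' k : ℤ, ∑' z, c k * LQ p (fun t => LQ q (T k z t)) := by
  have hq0 : 0 < q := by linarith
  have hp0 : 0 < p := by linarith
  have mT1 : ∀ k z t, Measurable (T k z t) := by
    intro k z t
    have h2 := (mT k z).comp (measurable_prodMk_left (x := t))
    simp only [Function.comp_def] at h2
    exact h2
  have mT2 : ∀ k z, Measurable (fun t => LQ q (T k z t)) := fun k z => LQ_meas (F := fun w => T k z w.1 w.2) (mT k z)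
  have pt2 : ∀ t, LQ q (F t) ≤ ∑' k : ℤ, ∑' z, c k * LQ q (T k z t) := by
    intro t
    refine (LQ_mono hq0.le (pt t)).trans ((LQ_tsum hq1 fun k => Measurable.ennreal_tsum fun z => (mT1 k z t).const_mul _).trans ?_)
    refine tle fun k => (LQ_tsum hq1 fun z => (mT1 k z t).const_mul _).trans (tle fun z => ?_)
    exact (LQ_cmul hq0 _ (mT1 k z t)).le
  refine (LQ_mono hp0.le pt2).trans ((LQ_tsum hp1 fun k => Measurable.ennreal_tsum fun z => (mT2 k z).const_mul _).trans ?_)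
  refine tle fun k => (LQ_tsum hp1 fun z => (mT2 k z).const_mul _).trans (tle fun z => ?_)
  exact (LQ_cmul hp0 _ (mT2 k z)).le

lemma source_lem {a b p q s θ : ℝ} (hb : 0 ≤ b) (hba : b ≤ a) (hs : 0 < s) (hθ : 1 / 2 < θ) (hq : 2 < q) (hp : 2 < p)
    (h1 : 1 / p < 1 / 2 - 1 / q) (h2 : 1 - 2 / q + a - 2 * s ≤ 1 / p) (h3 : a - s < 2 / q) (h : IsKer κ M)
    (hlo : Lowz M) (hhi : Hiwz M) : ∃ C : EN, C ≠ ⊤ ∧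
    ∀ U V : ℝ × V2 → ℂ, Measurable U → Integrable U → Measurable V → Integrable V →
      LQ p (fun t => LQ q (Sb κ b (fun y => J (Gt U t) y * J (Gt V t) y))) ≤
        C * (wE s θ U Set.univ ^ hfw * wE s θ V Set.univ ^ hfw) := by
  obtain ⟨C1, d, hC1, hd, key⟩ := pair_full hb hba hs hθ hq hp h1 h2 h3 h hlo hhi
  obtain ⟨C2, hC2, hsum⟩ := all_sum hd s θ
  refine ⟨C1 * C2, by finiteness, fun U V hU hUi hV hVi => ?_⟩
  have hq1 : 1 ≤ q := by linarith
  have hp1 : 1 ≤ p := by linarith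
  have hq0 : 0 < q := by linarith
  have hp0 : 0 < p := by linarith
  set T := fun (k : ℤ) (z : (ℤ × (Fin 2 → ℤ)) × (ℤ × (Fin 2 → ℤ))) (t : ℝ) (x : V2) =>
    ‖Ck κ k (fun y => J ((EE k z.1.1 z.1.2).indicator (Gt U t)) y * J ((EE k z.2.1 z.2.2).indicator (Gt V t)) y) x‖ₑ with hT
  have mT : ∀ k z, Measurable (fun w : ℝ × V2 => T k z w.1 w.2) := by
    intro k z
    have := Ck_meas_t h k (H := fun w => J ((EE k z.1.1 z.1.2).indicator (Gt U w.1)) w.2 * J ((EE k z.2.1 z.2.2).indicator (Gt V w.1)) w.2)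
      ((uE_cont hUi (EE_meas k z.1.1 z.1.2)).mul (uE_cont hVi (EE_meas k z.2.1 z.2.2)))
    exact this.enorm
  have pt : ∀ t x, Sb κ b (fun y => J (Gt U t) y * J (Gt V t) y) x ≤ ∑' k : ℤ, ∑' z, p2 (k * (b - 1)) * T k z t x := by
    intro t x
    rw [Sb_eq]
    refine tle fun k => ?_
    rw [ENNReal.tsum_mul_left]
    refine MLR ?_ _
    exact (Ck_JJ_decomp (E := fun z : ℤ × (Fin 2 → ℤ) => EE k z.1 z.2) (E' := fun z : ℤ × (Fin 2 → ℤ) => EE k z.1 z.2) (fun z => EE_meas k z.1 z.2) (fun z => EE_meas k z.1 z.2) (EE_disj k) (EE_disj k) (EE_cover k) (EE_cover k)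
      (Gt_int hUi t) (Gt_int hVi t) h k x)
  refine (LQ_LQ_tsum hp1 hq1 (fun k => p2 (k * (b - 1))) T _ mT pt).trans ?_
  have fin : ∀ k : ℤ, ∑' z, p2 (k * (b - 1)) * LQ p (fun t => LQ q (T k z t)) ≤ ∑' l : ℤ, ∑' m : ℤ,
      C1 * (p2 (-(d * (|((l - m : ℤ) : ℝ)| + |((l - k : ℤ) : ℝ)|))) * ∑' i, ∑' j,
        (RK k l m i j * (wE s θ U (EE k l i) ^ hfw * wE s θ V (EE k m j) ^ hfw))) := by
    intro k
    have : ∀ z : (ℤ × (Fin 2 → ℤ)) × (ℤ × (Fin 2 → ℤ)), p2 (k * (b - 1)) * LQ p (fun t => LQ q (T k z t)) ≤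
        (fun x y : ℤ × (Fin 2 → ℤ) => C1 * (p2 (-(d * (|((x.1 - y.1 : ℤ) : ℝ)| + |((x.1 - k : ℤ) : ℝ)|))) *
        (RK k x.1 y.1 x.2 y.2 * (wE s θ U (EE k x.1 x.2) ^ hfw * wE s θ V (EE k y.1 y.2) ^ hfw)))) z.1 z.2 := by
      intro z
      exact key U V hU hUi hV hVi k z.1.1 z.2.1 z.1.2 z.2.2
    refine (tle this).trans_eq ?_
    rw [ENNReal.tsum_prod', ENNReal.tsum_prod']
    refine tsum_congr fun l => ?_
    simp_rw [ENNReal.tsum_prod']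
    rw [ENNReal.tsum_comm]
    refine tsum_congr fun m => ?_
    simp_rw [ENNReal.tsum_mul_left]
  refine (tle fin).trans ?_
  simp_rw [ENNReal.tsum_mul_left]
  rw [mul_assoc]
  exact MLR (hsum U V) _

lemma S_bdd (H : SchwartzMap V2 ℂ) : ∃ C, ∀ x, ‖H x‖ ≤ C := by
  obtain ⟨C, _, h⟩ := H.decay 0 0
  exact ⟨C, fun x => by simpa using h x⟩

lemma Sb_add (h : IsKer κ M) (b : ℝ) (H1 H2 : SchwartzMap V2 ℂ) (x : V2) :
    Sb κ b (H1 + H2 : SchwartzMap V2 ℂ) x ≤ Sb κ b H1 x + Sb κ b H2 x := by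
  unfold Sb
  rw [← ENNReal.tsum_add]
  refine tle fun k => ?_
  rw [← mul_add]
  have e : Ck κ k (H1 + H2 : SchwartzMap V2 ℂ) x = _ := Ck_add h k H1.continuous H2.continuous (S_bdd H1) (S_bdd H2) x
  rw [e]
  exact MLR (enorm_add_le _ _) _

lemma Sb_neg (κ : VC) (b : ℝ) (H : SchwartzMap V2 ℂ) (x : V2) : Sb κ b (-H : SchwartzMap V2 ℂ) x = Sb κ b H x := by
  unfold Sb
  congr 1; ext k
  have e : Ck κ k (-H : SchwartzMap V2 ℂ) x = - Ck κ k H x := by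
    unfold Ck
    rw [← integral_neg]
    congr 1; ext z
    simp
  rw [e, enorm_neg]

lemma Sb_sum (h : IsKer κ M) (b : ℝ) {ι : Type*} (S : Finset ι) (H : ι → SchwartzMap V2 ℂ) (x : V2) :
    Sb κ b (∑ i ∈ S, H i : SchwartzMap V2 ℂ) x ≤ ∑ i ∈ S, Sb κ b (H i) x := by
  classical
  induction S using Finset.induction_on with
  | empty => simp [Sb, Ck]
  | insert i S hi ih =>
    rw [Finset.sum_insert hi, Finset.sum_insert hi]
    exact (Sb_add h b _ _ x).trans (add_le_add_right ih _)

lemma Sb_meas_t (h : IsKer κ M) (b : ℝ) {H : WC} (hH : Continuous H) :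
    Measurable fun z : ℝ × V2 => Sb κ b (fun y => H (z.1, y)) z.2 := by
  unfold Sb
  refine Measurable.ennreal_tsum fun k => ?_
  exact (Ck_meas_t h k hH).enorm.const_mul _

lemma Sb_meas (h : IsKer κ M) (b : ℝ) {H : VC} (hH : Continuous H) : Measurable (Sb κ b H) := by
  unfold Sb
  refine Measurable.ennreal_tsum fun k => ?_
  exact (Ck_meas h k hH).enorm.const_mul _

abbrev SSp := SchwartzMap (ℝ × V2) ℂ

def mulS (U V : SSp) : SSp := SchwartzMap.pairing (ContinuousLinearMap.mul ℂ ℂ) U V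

lemma mulS_apply (U V : SSp) (z : ℝ × V2) : mulS U V z = U z * V z := rfl

def mcS {n : ℕ} (U V : Fin n → Fin n → SSp) (i k : Fin n) : SSp :=
  (∑ l, mulS (U i l) (V l k)) + -∑ l, mulS (U l k) (V i l)

lemma mcS_coe {n : ℕ} (U V : Fin n → Fin n → SSp) (i k : Fin n) : ⇑(mcS U V i k) = mcomm (cF U) (cF V) i k := by
  ext z
  unfold mcS mcomm cF
  simp only [add_apply, neg_apply, sum_apply, mulS_apply]
  rw [sub_eq_add_neg]
  congr 2
  exact Finset.sum_congr rfl fun l _ => mul_comm _ _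

lemma slice_mcS {n : ℕ} (U V : Fin n → Fin n → SSp) (i k : Fin n) (t : ℝ) : slice (mcS U V i k) t =
    (∑ l, slice (mulS (U i l) (V l k)) t) + -∑ l, slice (mulS (U l k) (V i l)) t := by
  ext x
  unfold mcS
  simp only [add_apply, neg_apply, sum_apply, slice_apply]

lemma Sb_mcS (h : IsKer κ M) (b : ℝ) {n : ℕ} {q : ℝ} (hq : 1 ≤ q) (U V : Fin n → Fin n → SSp) (i k : Fin n) (t : ℝ) :
    LQ q (Sb κ b (slice (mcS U V i k) t)) ≤
      (∑ l, LQ q (Sb κ b (slice (mulS (U i l) (V l k)) t))) + ∑ l, LQ q (Sb κ b (slice (mulS (U l k) (V i l)) t)) := by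
  have hm : ∀ H : SchwartzMap V2 ℂ, Measurable (Sb κ b H) := fun H => Sb_meas h b H.continuous
  have h1 := LQ_sum hq Finset.univ (f := fun l => Sb κ b (slice (mulS (U i l) (V l k)) t)) (fun l => hm _)
  have h2 := LQ_sum hq Finset.univ (f := fun l => Sb κ b (slice (mulS (U l k) (V i l)) t)) (fun l => hm _)
  refine le_trans ?_ (add_le_add h1 h2)
  refine le_trans ?_ (LQ_add hq (Finset.measurable_fun_sum _ fun l _ => hm _) (Finset.measurable_fun_sum _ fun l _ => hm _))
  refine LQ_mono lz fun x => ?_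
  rw [slice_mcS]
  refine (Sb_add h b _ _ x).trans (add_le_add (Sb_sum h b _ _ x) ?_)
  rw [Sb_neg]
  exact Sb_sum h b _ _ x

def cg (θ : ℝ) : EN := (eO (2 * cθ θ) * eO ((((2 * π) ^ 3)⁻¹) ^ 2)) ^ hfw

lemma gam_HN {s θ : ℝ} (hθ : 1 / 2 < θ) (u : SSp) (t : ℝ) : gam s (Gt (Us u) t) ≤ cg θ * HN s θ u := by
  have h := Gt_L2 (s := s) hθ (Us_facts u).1.measurable t MeasurableSet.univ
  rw [Measure.restrict_univ, wE_HN, ← mul_assoc] at h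
  have h2 := ENNReal.rpow_le_rpow h (z := 1 / tw) nz
  rwa [mrn _ _ nz, half_sq] at h2

lemma cg_ne (θ : ℝ) : cg θ ≠ ⊤ := rnt nz (by finiteness)

lemma wE_half (s θ : ℝ) (u : WC) : wE s θ (Us u) Set.univ ^ hfw =
    eO (((2 * π) ^ 3)⁻¹) * HN s θ u := by
  rw [wE_HN, mrn _ _ nz, half_sq, ENNReal.ofReal_pow pz, half_sq]

lemma HN_le_HNM {n : ℕ} (s θ : ℝ) (U : Fin n → Fin n → (ℝ × V2 → ℂ)) (i k : Fin n) : HN s θ (U i k) ≤ HNM s θ U :=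
  (Finset.single_le_sum (f := fun k => HN s θ (U i k)) (fun _ _ => zero_le) (Finset.mem_univ k)).trans
    (Finset.single_le_sum (f := fun i => ∑ k, HN s θ (U i k)) (fun _ _ => zero_le) (Finset.mem_univ i))

lemma HNM_le_grad {n : ℕ} (s θ : ℝ) (f : Fin n → Fin n → SSp) (j : Fin 2) : HNM s θ (pdf j f) ≤ gradN s θ f := by
  rw [← half_sq (HNM s θ (pdf j f))]
  refine rle ?_ nz
  fin_cases j
  · exact le_self_add
  · exact le_add_self

def XX {n : ℕ} (q a : ℝ) (A : Fin n → Fin n → SSp) (t : ℝ) : EN :=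
  ∑ i, ∑ k, (LQ q (fun x => ‖slice (A i k) t x‖ₑ) + LQ q (fun x => ‖DA a (slice (A i k) t) x‖ₑ))

lemma le_XX {n : ℕ} (q a : ℝ) (A : Fin n → Fin n → SSp) (t : ℝ) (i k : Fin n) :
    LQ q (fun x => ‖slice (A i k) t x‖ₑ) + LQ q (fun x => ‖DA a (slice (A i k) t) x‖ₑ) ≤ XX q a A t :=
  (Finset.single_le_sum (f := fun k => LQ q (fun x => ‖slice (A i k) t x‖ₑ) + LQ q (fun x => ‖DA a (slice (A i k) t) x‖ₑ))
    (fun _ _ => zero_le) (Finset.mem_univ k)).trans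
    (Finset.single_le_sum (f := fun i => ∑ k, (LQ q (fun x => ‖slice (A i k) t x‖ₑ) + LQ q (fun x => ‖DA a (slice (A i k) t) x‖ₑ)))
      (fun _ _ => zero_le) (Finset.mem_univ i))

def pdM {n : ℕ} (j : Fin 2) (f : Fin n → Fin n → SSp) (i k : Fin n) : SSp := pdS j (f i k)

lemma sum2_le {n : ℕ} {f g : Fin n → EN} {D : EN} (hf : ∀ l, f l ≤ D) (hg : ∀ l, g l ≤ D) :
    (∑ l, f l) + ∑ l, g l ≤ (2 * n : ℕ) * D := by
  have h1 := Finset.sum_le_card_nsmul Finset.univ f D (fun l _ => hf l)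
  have h2 := Finset.sum_le_card_nsmul Finset.univ g D (fun l _ => hg l)
  rw [Finset.card_univ, Fintype.card_fin, nsmul_eq_mul] at h1 h2
  refine (add_le_add h1 h2).trans_eq ?_
  push_cast; ring

lemma HN_pd_le {n : ℕ} (s θ : ℝ) (f : Fin n → Fin n → SSp) (j : Fin 2) (i k : Fin n) :
    HN s θ (pdM j f i k) ≤ gradN s θ f :=
  (HN_le_HNM s θ (pdf j f) i k).trans (HNM_le_grad s θ f j)

lemma lin_comm {a q s θ : ℝ} (n : ℕ) (ha : 0 < a) (hs : 0 < s) (hθ : 1 / 2 < θ) (hq : 2 < q) (haq : 2 < a * q) (h3 : a - s < 2 / q)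
    (h : IsKer κ M)
    (hlo : Lowz M) (hhi : Hiwz M) : ∃ C : EN, C ≠ ⊤ ∧
    ∀ A f : Fin n → Fin n → SSp, gradN s θ f ≠ ⊤ → ∀ b, 0 ≤ b → b ≤ a → ∀ j i k t,
      LQ q (Sb κ b (slice (mcS A (pdM j f) i k) t)) ≤ C * (XX q a A t * gradN s θ f) := by
  obtain ⟨C, hC, hl⟩ := linear_lem ha hs hq haq h3 h hlo hhi
  refine ⟨(2 * n : ℕ) * (C * cg θ), mnt (ENNReal.natCast_ne_top _) (mnt hC (cg_ne θ)),
    fun A f hf b hb hba j i k t => ?_⟩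
  have key : ∀ i k i' k', LQ q (Sb κ b (slice (mulS (A i k) (pdM j f i' k')) t)) ≤ C * cg θ * (XX q a A t * gradN s θ f) := by
    intro i k i' k'
    have hU := Us_facts (pdM j f i' k')
    have hg := (gam_HN (s := s) hθ (pdM j f i' k') t).trans (MLR (HN_pd_le s θ f j i' k') (cg θ))
    have h1 := hl (slice (A i k) t) (Gt (Us (pdM j f i' k')) t) (Gt_int hU.2.1 t)
      (ne_top_of_le_ne_top (mnt (cg_ne θ) hf) hg) b hb hba
    have e : ⇑(slice (mulS (A i k) (pdM j f i' k')) t) = fun y => slice (A i k) t y * J (Gt (Us (pdM j f i' k')) t) y := by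
      ext y; rw [hU.2.2]; rfl
    rw [e]
    refine h1.trans ((MLR (mul_le_mul' (le_XX q a A t i k) hg) C).trans_eq ?_)
    ring
  refine (Sb_mcS h b lz A (pdM j f) i k t).trans ((sum2_le (fun l => key _ _ _ _) (fun l => key _ _ _ _)).trans_eq ?_)
  ring

lemma src_comm {a b p q s θ : ℝ} (n : ℕ) (hb : 0 ≤ b) (hba : b ≤ a) (hs : 0 < s) (hθ : 1 / 2 < θ) (hq : 2 < q) (hp : 2 < p)
    (h1 : 1 / p < 1 / 2 - 1 / q) (h2 : 1 - 2 / q + a - 2 * s ≤ 1 / p) (h3 : a - s < 2 / q) (h : IsKer κ M)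
    (hlo : Lowz M) (hhi : Hiwz M) : ∃ C : EN, C ≠ ⊤ ∧
    ∀ f φ : Fin n → Fin n → SSp, ∀ j i k,
      Measurable (fun t => LQ q (Sb κ b (slice (mcS (pdM j f) φ i k) t))) ∧
      LQ p (fun t => LQ q (Sb κ b (slice (mcS (pdM j f) φ i k) t))) ≤ C * (HNM s θ (cF φ) * gradN s θ f) := by
  obtain ⟨C, hC, hl⟩ := source_lem hb hba hs hθ hq hp h1 h2 h3 h hlo hhi
  obtain ⟨c, hc⟩ : ∃ c, c = eO (((2 * π) ^ 3)⁻¹) := ⟨_, rfl⟩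
  have hc' : c ≠ ⊤ := by rw [hc]; finiteness
  refine ⟨(2 * n : ℕ) * (C * (c * c)), mnt (ENNReal.natCast_ne_top _) (by finiteness),
    fun f φ j i k => ?_⟩
  have hm : ∀ H : SSp, Measurable (fun t => LQ q (Sb κ b (slice H t))) := fun H =>
    LQ_meas (F := fun z => Sb κ b (fun y => H (z.1, y)) z.2) (Sb_meas_t h b H.continuous)
  refine ⟨hm _, ?_⟩
  have hp1 : 1 ≤ p := by linarith
  have key : ∀ i k i' k', LQ p (fun t => LQ q (Sb κ b (slice (mulS (pdM j f i k) (φ i' k')) t))) ≤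
      C * (c * c) * (HNM s θ (cF φ) * gradN s θ f) := by
    intro i k i' k'
    have hU := Us_facts (pdM j f i k)
    have hV := Us_facts (φ i' k')
    have h4 := hl _ _ hU.1.measurable hU.2.1 hV.1.measurable hV.2.1
    rw [wE_half, wE_half, ← hc] at h4
    have e : (fun t => LQ q (Sb κ b (slice (mulS (pdM j f i k) (φ i' k')) t))) =
        fun t => LQ q (Sb κ b (fun y => J (Gt (Us (pdM j f i k)) t) y * J (Gt (Us (φ i' k')) t) y)) := by
      ext t; congr 2; ext y; rw [hU.2.2, hV.2.2]; rfl
    rw [e]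
    have h5 : HN s θ (φ i' k') ≤ HNM s θ (cF φ) := HN_le_HNM s θ (cF φ) i' k'
    refine h4.trans ((MLR (mul_le_mul' (MLR (HN_pd_le s θ f j i k) c) (MLR h5 c)) C).trans_eq ?_)
    ring
  refine (LQ_mono lz fun t => Sb_mcS h b lz (pdM j f) φ i k t).trans ?_
  refine (LQ_add hp1 (Finset.measurable_fun_sum _ fun l _ => hm _) (Finset.measurable_fun_sum _ fun l _ => hm _)).trans ?_
  refine (add_le_add (LQ_sum hp1 _ fun l => hm _) (LQ_sum hp1 _ fun l => hm _)).trans ?_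
  refine (sum2_le (fun l => key _ _ _ _) (fun l => key _ _ _ _)).trans_eq ?_
  ring

open scoped LineDeriv in
lemma ell_slice {n : ℕ} {A f φ : Fin n → Fin n → SSp} (h : EllipticEq A f φ) (i k : Fin n) (t : ℝ) {b : ℝ} (hb : 0 ≤ b)
    {κ0 κ1 : VC} (h0 : IsKer κ0 (Mel 0 b)) (h1 : IsKer κ1 (Mel 1 b)) (x : V2) :
    ‖DA b (slice (A i k) t) x‖ₑ ≤ Sb κ0 b (slice (mcS A (pdM 1 f) i k) t) x + Sb κ1 b (slice (mcS A (pdM 0 f) i k) t) x +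
      Sb κ0 b (slice (mcS (pdM 0 f) φ i k) t) x + Sb κ1 b (slice (mcS (pdM 1 f) φ i k) t) x := by
  refine ell_bound hb h0 h1 _ _ _ _ _ ?_ x
  simp only [← slice_pdS]
  ext y
  simp only [add_apply, neg_apply, slice_apply, pdS_coe, mcS_coe]
  exact h i k (t, y)

lemma Mel_lo (j : Fin 2) (b : ℝ) (ζ : V2) (h : ‖ζ‖ ≤ 1 / 2) : Mel j b ζ = 0 := by simp [Mel, psi_lo h]
lemma Mel_hi (j : Fin 2) (b : ℝ) (ζ : V2) (h : 2 ≤ ‖ζ‖) : Mel j b ζ = 0 := by simp [Mel, psi_hi h]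

lemma one_b {a b p q s θ : ℝ} (n : ℕ) (hb : 0 ≤ b) (hba : b ≤ a) (ha : 0 < a) (haq : 2 < a * q) (hs : 0 < s) (hθ : 1 / 2 < θ) (hq : 2 < q)
    (hp : 2 < p) (h1 : 1 / p < 1 / 2 - 1 / q) (h2 : 1 - 2 / q + a - 2 * s ≤ 1 / p) (h3 : a - s < 2 / q) :
    ∃ C : EN, C ≠ ⊤ ∧ ∀ A f φ : Fin n → Fin n → SSp, EllipticEq A f φ → gradN s θ f ≠ ⊤ → ∃ S : Fin n → Fin n → ℝ → EN,
      ∀ i k, Measurable (S i k) ∧ LQ p (S i k) ≤ C * (HNM s θ (cF φ) * gradN s θ f) ∧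
        ∀ t, LQ q (fun x => ‖DA b (slice (A i k) t) x‖ₑ) ≤ C * (XX q a A t * gradN s θ f) + S i k t := by
  obtain ⟨κ0, k0⟩ := Mel_ker 0 b
  obtain ⟨κ1, k1⟩ := Mel_ker 1 b
  obtain ⟨C0, hC0, l0⟩ := lin_comm n ha hs hθ hq haq h3 k0 (Mel_lo 0 b) (Mel_hi 0 b)
  obtain ⟨C1, hC1, l1⟩ := lin_comm n ha hs hθ hq haq h3 k1 (Mel_lo 1 b) (Mel_hi 1 b)
  obtain ⟨D0, hD0, s0⟩ := src_comm n hb hba hs hθ hq hp h1 h2 h3 k0 (Mel_lo 0 b) (Mel_hi 0 b)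
  obtain ⟨D1, hD1, s1⟩ := src_comm n hb hba hs hθ hq hp h1 h2 h3 k1 (Mel_lo 1 b) (Mel_hi 1 b)
  have hq1 : 1 ≤ q := by linarith
  have hp1 : 1 ≤ p := by linarith
  refine ⟨C0 + C1 + (D0 + D1), by finiteness, fun A f φ he hf => ⟨fun i k t => LQ q (Sb κ0 b (slice (mcS (pdM 0 f) φ i k) t)) +
    LQ q (Sb κ1 b (slice (mcS (pdM 1 f) φ i k) t)), fun i k => ?_⟩⟩
  have m0 := s0 f φ 0 i k
  have m1 := s1 f φ 1 i k
  refine ⟨m0.1.add m1.1, ?_, fun t => ?_⟩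
  · refine (LQ_add hp1 m0.1 m1.1).trans ((add_le_add m0.2 m1.2).trans ?_)
    rw [← add_mul]
    exact MLL le_add_self _
  · have e0 : ∀ H : SchwartzMap V2 ℂ, Measurable (Sb κ0 b H) := fun H => Sb_meas k0 b H.continuous
    have e1 : ∀ H : SchwartzMap V2 ℂ, Measurable (Sb κ1 b H) := fun H => Sb_meas k1 b H.continuous
    refine (LQ_mono lz fun x => ell_slice he i k t hb k0 k1 x).trans ?_
    refine (LQ_add hq1 (((e0 _).add (e1 _)).add (e0 _)) (e1 _)).trans ?_
    rw [← add_assoc]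
    refine add_le_add_left ((LQ_add hq1 ((e0 _).add (e1 _)) (e0 _)).trans (add_le_add_left ((LQ_add hq1 (e0 _) (e1 _)).trans ?_) _)) _
    refine (add_le_add (l0 A f hf b hb hba 1 i k t) (l1 A f hf b hb hba 0 i k t)).trans ?_
    rw [← add_mul]
    exact MLL le_self_add _

lemma DA_zero (A : SchwartzMap V2 ℂ) (x : V2) : DA 0 A x = A x := by
  unfold DA
  simp only [Real.rpow_zero, Complex.ofReal_one, one_mul]
  exact J_nft A x

lemma DA_fin {a q : ℝ} (ha : 0 ≤ a) (hq : 2 < q) (A : SchwartzMap V2 ℂ) : LQ q (fun x => ‖DA a A x‖ₑ) ≠ ⊤ := by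
  have hI := nft_pow_int A ha
  have hb : ∀ x, ‖DA a A x‖ₑ ≤ ∫⁻ ξ, ‖((‖ξ‖ ^ a : ℝ) : ℂ) * nft A ξ‖ₑ := J_enorm_le _
  have hM : ∫⁻ ξ, ‖((‖ξ‖ ^ a : ℝ) : ℂ) * nft A ξ‖ₑ ≠ ⊤ := hI.2.ne
  refine ne_top_of_le_ne_top ?_ (LQ_interp hq.le hM hb)
  have h0 : 0 ≤ 1 - 2 / q := by rw [sub_nonneg, div_le_one lz]; exact hq.le
  refine mnt (rnt h0 hM) (rnt pz ?_)
  refine ne_top_of_le_ne_top ?_ (plancherel hI)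
  refine mnt (by finiteness) ?_
  obtain ⟨C, hC⟩ : ∃ C : ℝ, ∀ ξ, ‖nft A ξ‖ ≤ C := by
    refine ⟨((2 * π) ^ 2)⁻¹ * ∫ x, ‖A x‖, fun ξ => ?_⟩
    unfold nft ft2
    rw [norm_mul, Complex.norm_real, nrn pz]
    refine mlr ((norm_integral_le_integral_norm _).trans_eq ?_) pz
    congr 1; ext x
    rw [norm_mul, neg_mul, ← mul_neg, ← Complex.ofReal_neg, Complex.norm_exp_I_mul_ofReal, one_mul]
  have h2 := nft_pow_int A (b := 2 * a) lz
  refine ne_top_of_le_ne_top (b := eO C * ∫⁻ ξ, ‖((‖ξ‖ ^ (2 * a) : ℝ) : ℂ) * nft A ξ‖ₑ)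
    (mnt (by finiteness) h2.2.ne) ?_
  rw [← lintegral_const_mul' _ _ (by finiteness)]
  refine lintegral_mono fun ξ => ?_
  have e : ((‖ξ‖ ^ (2 * a) : ℝ) : ℂ) = ((‖ξ‖ ^ a : ℝ) : ℂ) ^ 2 := by
    rw [mul_comm, Real.rpow_mul (norm_nonneg _)]; push_cast; norm_num
  have e2 : ‖nft A ξ‖ₑ ≤ eO C := by
    rw [← ofReal_norm]; exact oLe (hC ξ)
  rw [e, enorm_mul, enorm_mul, enorm_pow, mul_pow, sq ‖nft A ξ‖ₑ, ← mul_assoc, mul_comm]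
  exact MLL e2 _

lemma XX_fin {n : ℕ} {a q : ℝ} (ha : 0 ≤ a) (hq : 2 < q) (A : Fin n → Fin n → SSp) (t : ℝ) : XX q a A t ≠ ⊤ := by
  unfold XX
  refine (ENNReal.sum_lt_top.mpr fun i _ => ENNReal.sum_lt_top.mpr fun k _ => ENNReal.add_lt_top.mpr ⟨?_, ?_⟩).ne
  · have := DA_fin (le_refl 0) hq (slice (A i k) t)
    simp only [DA_zero] at this
    exact this.lt_top
  · exact (DA_fin ha hq _).lt_top

lemma DxA_eq (a : ℝ) (u : SSp) (t : ℝ) (x : V2) : DxA a u (t, x) = DA a (slice u t) x := by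
  unfold DxA ift2 DA J nft
  rw [← integral_const_mul]
  congr 1; ext ξ
  unfold ph
  have : (fun y => u ((t, x).1, y)) = ⇑(slice u t) := rfl
  rw [this]
  ring

lemma LQ_sum2 {Ω : Type*} [MeasureSpace Ω] {q : ℝ} (hq : 1 ≤ q) {n : ℕ} {f : Fin n → Fin n → Ω → EN} (hf : ∀ i k, Measurable (f i k)) :
    LQ q (fun x => ∑ i, ∑ k, f i k x) ≤ ∑ i, ∑ k, LQ q (f i k) :=
  (LQ_sum hq _ fun i => Finset.measurable_fun_sum _ fun k _ => hf i k).trans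
    (Finset.sum_le_sum fun i _ => LQ_sum hq _ fun k => hf i k)

lemma Lq_le_XX {n : ℕ} {a q : ℝ} (ha : 0 ≤ a) (hq : 2 < q) (A : Fin n → Fin n → SSp) (t : ℝ) :
    LqAt q (cF A) t + LqAt q (DxU a (cF A)) t ≤ XX q a A t := by
  have hq1 : 1 ≤ q := by linarith
  have e1 : LqAt q (cF A) t = LQ q (fun x => ∑ i, ∑ k, ‖slice (A i k) t x‖ₑ) := by
    unfold LqAt LQ; rw [one_div]; rfl
  have e2 : LqAt q (DxU a (cF A)) t = LQ q (fun x => ∑ i, ∑ k, ‖DA a (slice (A i k) t) x‖ₑ) := by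
    unfold LqAt LQ mE DxU cF
    simp only [DxA_eq]
    rw [one_div]; rfl
  rw [e1, e2]
  refine (add_le_add (LQ_sum2 hq1 fun i k => (slice (A i k) t).continuous.measurable.enorm)
    (LQ_sum2 hq1 fun i k => (DA_cont ha _).measurable.enorm)).trans_eq ?_
  unfold XX
  simp only [Finset.sum_add_distrib]

lemma sumsum_le {n : ℕ} {f : Fin n → Fin n → EN} {D : EN} (hf : ∀ i k, f i k ≤ D) :
    ∑ i, ∑ k, f i k ≤ (n * n : ℕ) * D := by
  have h1 : ∀ i, ∑ k, f i k ≤ n * D := fun i => by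
    simpa using Finset.sum_le_card_nsmul Finset.univ (f i) D (fun l _ => hf i l)
  have h2 := Finset.sum_le_card_nsmul Finset.univ _ _ (fun i _ => h1 i)
  refine h2.trans_eq ?_
  simp [mul_assoc]

lemma absorb {X S g : EN} (hX : X ≠ ⊤) (hg : g ≤ eO (1 / 2)) (h : X ≤ g * X + S) : X ≤ 2 * S := by
  rcases eq_or_ne S ⊤ with hS | hS
  · rw [hS]; simp
  have h1 : X ≤ eO (1 / 2) * X + S := h.trans (add_le_add_left (MLL hg X) S)
  lift X to NNReal using hX
  lift S to NNReal using hS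
  rw [ENNReal.ofReal_eq_coe_nnreal nz] at h1
  norm_cast at h1 ⊢
  have h2 : (X : ℝ) ≤ 1 / 2 * X + S := h1
  show (X : ℝ) ≤ 2 * S
  linarith

lemma main_aux {a p q s θ : ℝ} (n : ℕ) (ha : 0 < a) (haq : 2 < a * q) (hs : 0 < s) (hθ : 1 / 2 < θ) (hq : 2 < q)
    (hp : 2 < p) (h1 : 1 / p < 1 / 2 - 1 / q) (h2 : 1 - 2 / q + a - 2 * s ≤ 1 / p) (h3 : a - s < 2 / q) :
    ∃ K D : EN, K ≠ ⊤ ∧ D ≠ ⊤ ∧ ∀ A f φ : Fin n → Fin n → SSp, EllipticEq A f φ → gradN s θ f ≠ ⊤ →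
      K * gradN s θ f ≤ eO (1 / 2) → LQ p (fun t => XX q a A t) ≤ D * (HNM s θ (cF φ) * gradN s θ f) := by
  obtain ⟨C0, hC0, H0⟩ := one_b n le_rfl ha.le ha haq hs hθ hq hp h1 h2 h3
  obtain ⟨C1, hC1, H1⟩ := one_b n ha.le le_rfl ha haq hs hθ hq hp h1 h2 h3
  have hN : ((n * n : ℕ) : EN) ≠ ⊤ := ENNReal.natCast_ne_top _
  refine ⟨(n * n : ℕ) * (C0 + C1), 2 * ((n * n : ℕ) * (C0 + C1)), by finiteness, by finiteness, fun A f φ he hf hK => ?_⟩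
  obtain ⟨S0, T0⟩ := H0 A f φ he hf
  obtain ⟨S1, T1⟩ := H1 A f φ he hf
  have hm : ∀ i k, Measurable fun t => S0 i k t + S1 i k t := fun i k => (T0 i k).1.add (T1 i k).1
  have hM : Measurable fun t => ∑ i, ∑ k, (S0 i k t + S1 i k t) :=
    Finset.measurable_fun_sum _ fun i _ => Finset.measurable_fun_sum _ fun k _ => hm i k
  have hp1 : 1 ≤ p := by linarith
  have key : ∀ t, XX q a A t ≤ 2 * ∑ i, ∑ k, (S0 i k t + S1 i k t) := by
    intro t
    refine absorb (XX_fin ha.le hq A t) hK ?_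
    have e : XX q a A t ≤ ∑ i, ∑ k, ((C0 + C1) * (XX q a A t * gradN s θ f) + (S0 i k t + S1 i k t)) := by
      conv_lhs => unfold XX
      refine Finset.sum_le_sum fun i _ => Finset.sum_le_sum fun k _ => ?_
      have r0 := (T0 i k).2.2 t
      have r1 := (T1 i k).2.2 t
      simp only [DA_zero] at r0
      refine (add_le_add r0 r1).trans_eq ?_
      ring
    have e2 : ∀ Y : EN, ∑ i, ∑ k, (Y + (S0 i k t + S1 i k t)) =
        (∑ _i : Fin n, ∑ _k : Fin n, Y) + ∑ i, ∑ k, (S0 i k t + S1 i k t) := fun Y => by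
      simp only [Finset.sum_add_distrib]
    rw [e2] at e
    refine e.trans (add_le_add_left ((sumsum_le fun i k => le_rfl).trans_eq ?_) _)
    ring
  refine (LQ_mono lz key).trans ?_
  rw [LQ_cmul lz 2 hM, mul_assoc, mul_assoc]
  refine MLR ((LQ_sum2 hp1 hm).trans (sumsum_le fun i k => ?_)) 2
  refine (LQ_add hp1 (T0 i k).1 (T1 i k).1).trans ((add_le_add (T0 i k).2.1 (T1 i k).2.1).trans_eq ?_)
  ring

/-- Non-homogeneous elliptic estimate for `A₀` (Theorem 5.2, part ii, `aq > 2`):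
for `s > 1/4`, `θ > 1/2`, `0 < a < min(4s-1, 1+s, 2s)`, `aq > 2`,
`max((a-s)/2, 1/2 + a - 2s) < 1/q < min(a,1)/2` and
`1 - 2/q + a - 2s ≤ 1/p < 1/2 - 1/q`, there exist `ε₀ > 0` and `C` such that any
Schwartz matrix-valued solution of
`△A₀ = -∂₁[A₀,∂₂f] + ∂₂[A₀,∂₁f] + ∂₁[∂₁f,φ] + ∂₂[∂₂f,φ]` with
`‖∇f‖_{H^{s,θ}} ≤ ε₀` satisfies `‖A₀‖_{L^p_t W^{a,q}_x} ≤ C ‖φ‖_{H^{s,θ}} ‖∇f‖_{H^{s,θ}}`. -/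
theorem elliptic_nonhomogeneous_estimate_aq_gt_two (n : ℕ) (hn : 1 ≤ n)
    (s θ a p q : ℝ) (hs : 1 / 4 < s) (hθ : 1 / 2 < θ)
    (ha0 : 0 < a) (ha1 : a < min (4 * s - 1) (min (1 + s) (2 * s)))
    (hp0 : 1 ≤ p) (haq : 2 < a * q)
    (hq1 : max ((a - s) / 2) (1 / 2 + a - 2 * s) < 1 / q) (hq2 : 1 / q < min a 1 / 2)
    (hp1 : 1 - 2 / q + a - 2 * s ≤ 1 / p) (hp2 : 1 / p < 1 / 2 - 1 / q) :
    ∃ ε₀ C : ℝ, 0 < ε₀ ∧ 0 < C ∧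
      ∀ A0 f φ : Fin n → Fin n → SchwartzMap (ℝ × V2) ℂ,
        EllipticEq A0 f φ →
        gradN s θ f ≤ ENNReal.ofReal ε₀ →
        Ltp p (fun t => LqAt q (cF A0) t + LqAt q (DxU a (cF A0)) t) ≤
          ENNReal.ofReal C * (HNM s θ (cF φ) * gradN s θ f) := by
  have hq0 : 0 < q := by
    by_contra hc
    push Not at hc
    nlinarith
  have m1 : 1 / q < 1 / 2 := by have := min_le_right a 1; linarith
  have hq : 2 < q := by
    rw [div_lt_div_iff₀ hq0 nz] at m1; linarith
  have hs0 : 0 < s := by linarith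
  have hp : 2 < p := by
    have h : 1 / p < 1 / 2 := by have : 0 < 1 / q := by positivity
                                 linarith
    rw [div_lt_div_iff₀ lz nz] at h; linarith
  have h3 : a - s < 2 / q := by
    have h := (le_max_left _ _).trans_lt hq1
    have e : 2 / q = 2 * (1 / q) := by ring
    rw [e]; linarith
  obtain ⟨K, D, hK, hD, H⟩ := main_aux n ha0 haq hs0 hθ hq hp hp2 hp1 h3
  have hK0 : 0 ≤ K.toReal := ENNReal.toReal_nonneg
  have hD0 : 0 ≤ D.toReal := ENNReal.toReal_nonneg
  refine ⟨1 / (2 * (K.toReal + 1)), D.toReal + 1, by positivity, by positivity, fun A f φ he hf => ?_⟩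
  have hg : gradN s θ f ≠ ⊤ := ne_top_of_le_ne_top ENNReal.ofReal_ne_top hf
  have hKg : K * gradN s θ f ≤ eO (1 / 2) := by
    refine (MLR hf K).trans ?_
    rw [← ENNReal.ofReal_toReal hK, ← oM hK0, ENNReal.toReal_ofReal hK0]
    refine oLe ?_
    rw [mul_one_div, div_le_div_iff₀ pz nz]
    linarith
  have hfin := H A f φ he hg hKg
  have e : Ltp p (fun t => LqAt q (cF A) t + LqAt q (DxU a (cF A)) t) =
      LQ p (fun t => LqAt q (cF A) t + LqAt q (DxU a (cF A)) t) := by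
    unfold Ltp LQ; rw [one_div]
  rw [e]
  refine (LQ_mono lz fun t => Lq_le_XX ha0.le hq A t).trans (hfin.trans (MLL ?_ _))
  rw [← ENNReal.ofReal_toReal hD]
  refine oLe ?_
  rw [ENNReal.toReal_ofReal hD0]; linarith
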